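/- arXiv:1512.07289 — 2 statements merged into one kernel-verified Lean document; each statement's English description precedes it below -/
import Mathlib

section
/- Let n ≥ 2, let K be a convex body in R^n containing the origin in its interior, and let E = T(B₂ⁿ) be a centered ellipsoid in R^n (the image of the Euclidean unit ball under an invertible linear map T). If S_E(t) ≤ S_K(t) for all t ≥ 0, then |E| ≤ |K|. -/
open MeasureTheory Metric Set
open scoped RealInnerProductSpace ENNReal NNReal

noncomputable section

/-- Euclidean space `ℝ^n`. -/
abbrev Euc (n : ℕ) := EuclideanSpace ℝ (Fin n)

/-- A convex body: a compact convex set with nonempty interior. -/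
def IsConvexBody {n : ℕ} (K : Set (Euc n)) : Prop :=
  Convex ℝ K ∧ IsCompact K ∧ (interior K).Nonempty

/-- The Haar (rotation invariant) probability measure of a set of directions on the
unit sphere `S^{n-1}`, realized as normalized `(n-1)`-dimensional Hausdorff measure. -/
def sphHaar (n : ℕ) (A : Set (Euc n)) : ℝ≥0∞ :=
  μH[(n : ℝ) - 1] (A ∩ sphere (0 : Euc n) 1) / μH[(n : ℝ) - 1] (sphere (0 : Euc n) 1)

/-- `|K ∩ θ^⊥|`: the `(n-1)`-dimensional Hausdorff measure of the central section of `K`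
perpendicular to `θ`. -/
def sectionVol (n : ℕ) (K : Set (Euc n)) (θ : Euc n) : ℝ≥0∞ :=
  μH[(n : ℝ) - 1] (K ∩ {x : Euc n | ⟪x, θ⟫ = 0})

/-- `S_K(t)`: distribution function of the areas of central hyperplane sections. -/
def Sdist (n : ℕ) (K : Set (Euc n)) (t : ℝ) : ℝ≥0∞ :=
  sphHaar n {θ : Euc n | ENNReal.ofReal t ≤ sectionVol n K θ}

/-- `|K | θ^⊥|`: the `(n-1)`-dimensional Hausdorff measure of the orthogonal projection
of `K` onto the hyperplane `θ^⊥` (for a unit vector `θ`). -/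
def projVol (n : ℕ) (K : Set (Euc n)) (θ : Euc n) : ℝ≥0∞ :=
  μH[(n : ℝ) - 1] ((fun x => x - ⟪x, θ⟫ • θ) '' K)

/-- `Π_K(t)`: distribution function of the volumes of hyperplane projections. -/
def PiDist (n : ℕ) (K : Set (Euc n)) (t : ℝ) : ℝ≥0∞ :=
  sphHaar n {θ : Euc n | ENNReal.ofReal t ≤ projVol n K θ}

/-- The radial function `ρ_K(θ) = max {a ≥ 0 : a • θ ∈ K}`. -/
def radial {n : ℕ} (K : Set (Euc n)) (θ : Euc n) : ℝ :=
  sSup {a : ℝ | 0 ≤ a ∧ a • θ ∈ K}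

/-- The support function `h_K(θ) = sup_{y ∈ K} ⟨θ, y⟩`. -/
def suppFn {n : ℕ} (K : Set (Euc n)) (θ : Euc n) : ℝ :=
  sSup ((fun y => ⟪θ, y⟫) '' K)

/-- The polar body `K° = {x : ⟨x, y⟩ ≤ 1 for all y ∈ K}`. -/
def polarBody {n : ℕ} (K : Set (Euc n)) : Set (Euc n) :=
  {x | ∀ y ∈ K, ⟪x, y⟫ ≤ 1}

/-! ### Splitting off the first coordinate -/

/-- The point of `ℝ^(k+1)` with first coordinate `a` and remaining coordinates `y`. -/
def consE {k : ℕ} (a : ℝ) (y : Euc k) : Euc (k + 1) := WithLp.toLp 2 (Fin.cons a y.ofLp)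

/-- The last `k` coordinates of a point of `ℝ^(k+1)`. -/
def tailE {k : ℕ} (x : Euc (k + 1)) : Euc k := WithLp.toLp 2 (Fin.tail x.ofLp)

@[simp] lemma consE_zero {k : ℕ} (a : ℝ) (y : Euc k) : consE a y 0 = a := rfl

@[simp] lemma consE_succ {k : ℕ} (a : ℝ) (y : Euc k) (i : Fin k) : consE a y i.succ = y i := rfl

@[simp] lemma tailE_apply {k : ℕ} (x : Euc (k + 1)) (i : Fin k) : tailE x i = x i.succ := rfl

@[simp] lemma tailE_consE {k : ℕ} (a : ℝ) (y : Euc k) : tailE (consE a y) = y := by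
  ext i; simp

@[simp] lemma consE_tailE {k : ℕ} (x : Euc (k + 1)) : consE (x 0) (tailE x) = x := by
  ext i; refine Fin.cases ?_ (fun j => ?_) i <;> simp

lemma consE_inj {k : ℕ} {a b : ℝ} {y z : Euc k} (h : consE a y = consE b z) : a = b ∧ y = z :=
  ⟨by simpa using congrArg (fun x : Euc (k + 1) => x 0) h, by simpa using congrArg tailE h⟩

lemma consE_add {k : ℕ} (a b : ℝ) (y z : Euc k) :
    consE a y + consE b z = consE (a + b) (y + z) := by
  ext i; refine Fin.cases ?_ (fun j => ?_) i <;> simp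

lemma smul_consE {k : ℕ} (c a : ℝ) (y : Euc k) : c • consE a y = consE (c * a) (c • y) := by
  ext i; refine Fin.cases ?_ (fun j => ?_) i <;> simp

lemma norm_consE_sq {k : ℕ} (a : ℝ) (y : Euc k) : ‖consE a y‖ ^ 2 = a ^ 2 + ‖y‖ ^ 2 := by
  simp [EuclideanSpace.norm_sq_eq, Fin.sum_univ_succ]

lemma inner_consE {k : ℕ} (a b : ℝ) (y z : Euc k) :
    ⟪consE a y, consE b z⟫ = a * b + ⟪y, z⟫ := by
  simp [PiLp.inner_apply, Fin.sum_univ_succ, mul_comm]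

lemma continuous_consE {k : ℕ} : Continuous (fun p : ℝ × Euc k => consE p.1 p.2) := by
  refine (PiLp.continuous_toLp 2 _).comp (continuous_pi fun i => ?_)
  refine Fin.cases ?_ (fun j => ?_) i
  · exact continuous_fst
  · simpa using (by fun_prop : Continuous fun p : ℝ × Euc k => p.2 j)

lemma continuous_tailE {k : ℕ} : Continuous (tailE : Euc (k + 1) → Euc k) := by
  refine (PiLp.continuous_toLp 2 _).comp (continuous_pi fun i => ?_)
  simpa [Fin.tail] using (by fun_prop : Continuous fun x : Euc (k + 1) => x i.succ)

/-- The identification of `ℝ × ℝ^k` with `ℝ^(k+1)`. -/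
def consEquiv (k : ℕ) : (ℝ × Euc k) ≃ᵐ Euc (k + 1) where
  toFun p := consE p.1 p.2
  invFun x := (x 0, tailE x)
  left_inv p := by simp
  right_inv x := by simp
  measurable_toFun := continuous_consE.measurable
  measurable_invFun :=
    ((by fun_prop : Continuous fun x : Euc (k + 1) => x 0).prodMk continuous_tailE).measurable

lemma measurePreserving_consEquiv (k : ℕ) : MeasurePreserving (consEquiv k) := by
  have h1 := (volume_preserving_piFinSuccAbove (fun _ : Fin (k + 1) => ℝ) 0).symm
  have h2 : MeasurePreserving (Prod.map (id : ℝ → ℝ) (WithLp.ofLp : Euc k → Fin k → ℝ)) :=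
    (MeasurePreserving.id (volume : Measure ℝ)).prod (PiLp.volume_preserving_ofLp (Fin k))
  have h3 := (PiLp.volume_preserving_toLp (Fin (k + 1))).comp (h1.comp h2)
  convert h3 using 1
  funext p
  ext i
  refine Fin.cases ?_ (fun j => ?_) i <;>
    simp [consEquiv, MeasurableEquiv.piFinSuccAbove, Fin.insertNthEquiv]

/-- `ℝ^(k+1)`-valued families, split into first and remaining coordinates. -/
lemma measurePreserving_consFamily (ι : Type*) [Fintype ι] (k : ℕ) :
    MeasurePreserving (fun p : (ι → ℝ) × (ι → Euc k) => fun i => consE (p.1 i) (p.2 i)) := by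
  have h1 := (volume_measurePreserving_arrowProdEquivProdArrow ℝ (Euc k) ι).symm
  have h2 := volume_preserving_pi (fun _ : ι => measurePreserving_consEquiv k)
  exact h2.comp h1

lemma lintegral_consFamily {ι : Type*} [Fintype ι] {k : ℕ} {f : (ι → Euc (k + 1)) → ℝ≥0∞}
    (hf : Measurable f) :
    ∫⁻ X, f X = ∫⁻ Y : ι → Euc k, ∫⁻ s : ι → ℝ, f fun i => consE (s i) (Y i) := by
  have h := measurePreserving_consFamily ι k
  rw [← h.lintegral_comp hf, Measure.volume_eq_prod, lintegral_prod_symm']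
  exact hf.comp h.measurable

lemma lintegral_consE {k : ℕ} {f : Euc (k + 1) → ℝ≥0∞} (hf : Measurable f) :
    ∫⁻ x, f x = ∫⁻ y : Euc k, ∫⁻ s : ℝ, f (consE s y) := by
  have h := measurePreserving_consEquiv k
  rw [← h.lintegral_comp hf, Measure.volume_eq_prod, lintegral_prod_symm']
  · rfl
  · exact hf.comp h.measurable

lemma volume_consE {k : ℕ} {L : Set (Euc (k + 1))} (hL : MeasurableSet L) :
    volume L = ∫⁻ y : Euc k, volume {s : ℝ | consE s y ∈ L} := by
  rw [← lintegral_indicator_one hL, lintegral_consE (measurable_one.indicator hL)]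
  refine lintegral_congr fun y => ?_
  rw [← lintegral_indicator_one]
  · rfl
  · exact (continuous_consE.comp (Continuous.prodMk_left y)).measurable hL

lemma measurable_volume_consE {k : ℕ} {L : Set (Euc (k + 1))} (hL : MeasurableSet L) :
    Measurable fun y : Euc k => volume {s : ℝ | consE s y ∈ L} :=
  measurable_measure_prodMk_right (continuous_consE.measurable hL)

/-! ### The determinant functional -/

/-- The determinant of `m` vectors of `ℝ^m`. -/
def detE {m : ℕ} (X : Fin m → Euc m) : ℝ := Matrix.det (Matrix.of fun i j => X i j)

lemma continuous_detE {m : ℕ} : Continuous (detE : (Fin m → Euc m) → ℝ) := by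
  unfold detE
  refine Continuous.matrix_det (continuous_matrix fun i j => ?_)
  simp only [Matrix.of_apply]
  fun_prop

lemma detE_comp {m : ℕ} (N : Euc m →ₗ[ℝ] Euc m) (X : Fin m → Euc m) :
    detE (fun i => N (X i)) = LinearMap.det N * detE X := by
  have key : ∀ Y : Fin m → Euc m,
      detE Y = (EuclideanSpace.basisFun (Fin m) ℝ).toBasis.det Y := by
    intro Y
    rw [Module.Basis.det_apply, detE, ← Matrix.det_transpose]
    congr 1
  rw [key, key]
  exact Module.Basis.det_comp _ N X

/-- The integral of `|det|` over `m`-tuples of points of `L`. -/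
def detInt {m : ℕ} (L : Set (Euc m)) : ℝ≥0∞ :=
  ∫⁻ X in univ.pi fun _ : Fin m => L, ‖detE X‖ₑ

lemma detInt_mono {m : ℕ} {L L' : Set (Euc m)} (h : L ⊆ L') : detInt L ≤ detInt L' :=
  lintegral_mono_set (Set.pi_mono fun _ _ => h)

lemma measurable_enorm_detE {m : ℕ} : Measurable fun X : Fin m → Euc m => ‖detE X‖ₑ :=
  continuous_detE.measurable.enorm

lemma detInt_eq {m : ℕ} {L : Set (Euc m)} (hL : MeasurableSet L) :
    detInt L = ∫⁻ X, (univ.pi fun _ : Fin m => L).indicator (fun X => ‖detE X‖ₑ) X :=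
  (lintegral_indicator (MeasurableSet.univ_pi fun _ => hL) _).symm

lemma detInt_preimage {m : ℕ} {N : Euc m →ₗ[ℝ] Euc m} (hN : LinearMap.det N ≠ 0)
    {L : Set (Euc m)} (hL : MeasurableSet L) :
    detInt L = ‖LinearMap.det N‖ₑ ^ (m + 1) * detInt (N ⁻¹' L) := by
  set d := LinearMap.det N with hd
  let P : (Fin m → Euc m) →ₗ[ℝ] (Fin m → Euc m) :=
    LinearMap.pi fun i => N.comp (LinearMap.proj i)
  have hP : LinearMap.det P = d ^ m := by
    simpa [P] using LinearMap.det_pi (fun _ : Fin m => N)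
  have hP0 : LinearMap.det P ≠ 0 := by rw [hP]; exact pow_ne_zero _ hN
  have hmap := Measure.map_linearMap_addHaar_eq_smul_addHaar
    (volume : Measure (Fin m → Euc m)) hP0
  have hPm : Measurable P := P.continuous_of_finiteDimensional.measurable
  have hNm : Measurable N := N.continuous_of_finiteDimensional.measurable
  have hd0 : ‖d‖ₑ ≠ 0 := by simpa using hN
  have hg : Measurable ((univ.pi fun _ : Fin m => L).indicator fun X => ‖detE X‖ₑ) :=
    measurable_enorm_detE.indicator (MeasurableSet.univ_pi fun _ => hL)
  have h1 : ∫⁻ X, (univ.pi fun _ : Fin m => L).indicator (fun X => ‖detE X‖ₑ) (P X)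
      = ‖d‖ₑ * detInt (N ⁻¹' L) := by
    rw [detInt_eq (hNm hL), ← lintegral_const_mul]
    · refine lintegral_congr fun X => ?_
      have hmem : P X ∈ (univ.pi fun _ : Fin m => L) ↔
          X ∈ (univ.pi fun _ : Fin m => N ⁻¹' L) := by simp [P]
      by_cases hX : X ∈ (univ.pi fun _ : Fin m => N ⁻¹' L)
      · rw [indicator_of_mem hX, indicator_of_mem (hmem.2 hX), ← enorm_mul, ← detE_comp]
        rfl
      · rw [indicator_of_notMem hX, indicator_of_notMem (mt hmem.1 hX), mul_zero]
    · exact measurable_enorm_detE.indicator (MeasurableSet.univ_pi fun _ => hNm hL)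
  rw [← lintegral_map hg hPm, hmap, lintegral_smul_measure, ← detInt_eq hL, hP] at h1
  have h2 : ENNReal.ofReal |(d ^ m)⁻¹| = (‖d‖ₑ ^ m)⁻¹ := by
    rw [← Real.enorm_eq_ofReal_abs, enorm_inv (pow_ne_zero _ hN), enorm_pow]
  rw [h2, smul_eq_mul] at h1
  rw [pow_succ, mul_assoc, ← h1, ← mul_assoc, ENNReal.mul_inv_cancel (pow_ne_zero _ hd0)
    (ENNReal.pow_ne_top enorm_ne_top), one_mul]

/-- The normalized value of `detInt` on balls. -/
def ballConst (m : ℕ) : ℝ≥0∞ :=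
  detInt (ball (0 : Euc m) 1) / volume (ball (0 : Euc m) 1) ^ (m + 1)

lemma detInt_ellipsoid {m : ℕ} {N : Euc m →ₗ[ℝ] Euc m} (hN : LinearMap.det N ≠ 0) :
    detInt (N ⁻¹' ball 0 1) = ballConst m * volume (N ⁻¹' ball 0 1) ^ (m + 1) := by
  have hd0 : ‖LinearMap.det N‖ₑ ≠ 0 := by simpa using hN
  have hv : volume (N ⁻¹' ball 0 1) = ‖LinearMap.det N‖ₑ⁻¹ * volume (ball (0 : Euc m) 1) := by
    rw [Measure.addHaar_preimage_linearMap _ hN, ← Real.enorm_eq_ofReal_abs, enorm_inv hN]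
  have hb0 : volume (ball (0 : Euc m) 1) ≠ 0 := (measure_ball_pos _ _ one_pos).ne'
  have hb1 : volume (ball (0 : Euc m) 1) ≠ ∞ := measure_ball_lt_top.ne
  rw [ballConst, detInt_preimage hN measurableSet_ball, hv, mul_pow, ← ENNReal.inv_pow]
  set a := ‖LinearMap.det N‖ₑ ^ (m + 1)
  have ha0 : a ≠ 0 := pow_ne_zero _ hd0
  have ha1 : a ≠ ∞ := ENNReal.pow_ne_top enorm_ne_top
  set b := volume (ball (0 : Euc m) 1) ^ (m + 1)
  have hb0' : b ≠ 0 := pow_ne_zero _ hb0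
  have hb1' : b ≠ ∞ := ENNReal.pow_ne_top hb1
  set F := detInt (N ⁻¹' ball 0 1)
  calc F = (a * a⁻¹) * (b * b⁻¹) * F := by
        rw [ENNReal.mul_inv_cancel ha0 ha1, ENNReal.mul_inv_cancel hb0' hb1', one_mul, one_mul]
    _ = a * F / b * (a⁻¹ * b) := by rw [div_eq_mul_inv]; ring

lemma detInt_ball {m : ℕ} {r : ℝ} (hr : 0 < r) :
    detInt (ball (0 : Euc m) r) = ballConst m * volume (ball (0 : Euc m) r) ^ (m + 1) := by
  have h : ball (0 : Euc m) r = (r⁻¹ • (LinearMap.id : Euc m →ₗ[ℝ] Euc m)) ⁻¹' ball 0 1 := by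
    ext x
    simp [norm_smul, abs_of_pos hr, inv_mul_lt_iff₀ hr]
  rw [h]
  exact detInt_ellipsoid (by simp [hr.ne'])

lemma detInt_isometry {m : ℕ} (U : Euc m ≃ₗᵢ[ℝ] Euc m) {L : Set (Euc m)}
    (hL : MeasurableSet L) : detInt (U ⁻¹' L) = detInt L := by
  have hd : |LinearMap.det (U.toLinearEquiv : Euc m →ₗ[ℝ] Euc m)| = 1 := by
    rw [← LinearMap.normDet_eq_abs_det]
    exact U.toLinearIsometry.normDet_eq_one
  have hd0 : LinearMap.det (U.toLinearEquiv : Euc m →ₗ[ℝ] Euc m) ≠ 0 := by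
    intro h; simp [h] at hd
  rw [detInt_preimage hd0 hL, Real.enorm_eq_ofReal_abs, hd]
  simp

/-! ### Steiner symmetrization with respect to the first coordinate -/

/-- The Steiner symmetral of a convex set with respect to the first coordinate. -/
def steiner {k : ℕ} (L : Set (Euc (k + 1))) : Set (Euc (k + 1)) :=
  {x | ∃ d : ℝ, consE (d + x 0) (tailE x) ∈ L ∧ consE (d - x 0) (tailE x) ∈ L}

lemma isOpen_steiner {k : ℕ} {L : Set (Euc (k + 1))} (hL : IsOpen L) : IsOpen (steiner L) := by
  have hc0 : Continuous fun x : Euc (k + 1) => x 0 := by fun_prop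
  have : steiner L = ⋃ d : ℝ, (fun x : Euc (k + 1) => consE (d + x 0) (tailE x)) ⁻¹' L ∩
      (fun x : Euc (k + 1) => consE (d - x 0) (tailE x)) ⁻¹' L := by
    ext x; simp [steiner]
  rw [this]
  refine isOpen_iUnion fun d => (hL.preimage ?_).inter (hL.preimage ?_)
  · exact continuous_consE.comp ((continuous_const.add hc0).prodMk continuous_tailE)
  · exact continuous_consE.comp ((continuous_const.sub hc0).prodMk continuous_tailE)

lemma tailE_add {k : ℕ} (x y : Euc (k + 1)) : tailE (x + y) = tailE x + tailE y := by
  ext i; simp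

lemma tailE_smul {k : ℕ} (c : ℝ) (x : Euc (k + 1)) : tailE (c • x) = c • tailE x := by
  ext i; simp

lemma convex_steiner {k : ℕ} {L : Set (Euc (k + 1))} (hL : Convex ℝ L) :
    Convex ℝ (steiner L) := by
  rintro x ⟨d, hx1, hx2⟩ y ⟨e, hy1, hy2⟩ a b ha hb hab
  refine ⟨a * d + b * e, ?_, ?_⟩
  · have := hL hx1 hy1 ha hb hab
    rw [smul_consE, smul_consE, consE_add] at this
    convert this using 2
    · simp; ring
    · rw [tailE_add, tailE_smul, tailE_smul]
  · have := hL hx2 hy2 ha hb hab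
    rw [smul_consE, smul_consE, consE_add] at this
    convert this using 2
    · simp; ring
    · rw [tailE_add, tailE_smul, tailE_smul]

lemma steiner_subset_ball {k : ℕ} {L : Set (Euc (k + 1))} {R : ℝ} (hR : 0 < R)
    (hL : L ⊆ ball 0 R) : steiner L ⊆ ball 0 R := by
  rintro x ⟨d, h1, h2⟩
  have h1' := hL h1
  have h2' := hL h2
  rw [mem_ball_zero_iff] at *
  have e1 := norm_consE_sq (d + x 0) (tailE x)
  have e2 := norm_consE_sq (d - x 0) (tailE x)
  have e3 := norm_consE_sq (x 0) (tailE x)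
  rw [consE_tailE] at e3
  have i1 : ‖consE (d + x 0) (tailE x)‖ ^ 2 < R ^ 2 := by gcongr
  have i2 : ‖consE (d - x 0) (tailE x)‖ ^ 2 < R ^ 2 := by gcongr
  refine lt_of_pow_lt_pow_left₀ 2 hR.le ?_
  nlinarith [sq_nonneg d]

lemma exists_eq_Ioo_of_isOpen_convex {I : Set ℝ} (ho : IsOpen I) (hc : Convex ℝ I)
    (hb : Bornology.IsBounded I) : ∃ c h : ℝ, 0 ≤ h ∧ I = Ioo (c - h) (c + h) := by
  rcases I.eq_empty_or_nonempty with rfl | hne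
  · exact ⟨0, 0, le_rfl, by simp⟩
  have hbb := hb.bddBelow
  have hba := hb.bddAbove
  have hle : sInf I ≤ sSup I := csInf_le_csSup hne hbb hba
  refine ⟨(sInf I + sSup I) / 2, (sSup I - sInf I) / 2, by linarith, ?_⟩
  have e1 : (sInf I + sSup I) / 2 - (sSup I - sInf I) / 2 = sInf I := by ring
  have e2 : (sInf I + sSup I) / 2 + (sSup I - sInf I) / 2 = sSup I := by ring
  rw [e1, e2]
  refine Subset.antisymm (fun x hx => ?_)
    (IsConnected.Ioo_csInf_csSup_subset ⟨hne, hc.isPreconnected⟩ hbb hba)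
  obtain ⟨ε, hε, hball⟩ := Metric.isOpen_iff.1 ho x hx
  have m1 : x - ε / 2 ∈ I := hball (by
    rw [Metric.mem_ball, Real.dist_eq, abs_lt]; constructor <;> linarith)
  have m2 : x + ε / 2 ∈ I := hball (by
    rw [Metric.mem_ball, Real.dist_eq, abs_lt]; constructor <;> linarith)
  have := csInf_le hbb m1
  have := le_csSup hba m2
  constructor <;> linarith

lemma fiber_steiner {k : ℕ} {L : Set (Euc (k + 1))} (ho : IsOpen L) (hc : Convex ℝ L) {R : ℝ}
    (hL : L ⊆ ball 0 R) (y : Euc k) :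
    ∃ c h : ℝ, 0 ≤ h ∧ {s | consE s y ∈ L} = Ioo (c - h) (c + h) ∧
      {s | consE s y ∈ steiner L} = Ioo (-h) h := by
  have hbound : Bornology.IsBounded {s | consE s y ∈ L} := by
    refine (Metric.isBounded_ball (x := (0 : ℝ)) (r := R)).subset fun s hs => ?_
    have h1 := hL hs
    rw [mem_ball_zero_iff] at *
    refine lt_of_le_of_lt ?_ h1
    refine abs_le_of_sq_le_sq ?_ (norm_nonneg _)
    have := norm_consE_sq s y
    nlinarith [sq_nonneg ‖y‖]
  have hopen : IsOpen {s | consE s y ∈ L} :=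
    ho.preimage (continuous_consE.comp (Continuous.prodMk_left y))
  have hconv : Convex ℝ {s | consE s y ∈ L} := by
    intro s hs t ht a b ha hb hab
    have := hc hs ht ha hb hab
    rw [smul_consE, smul_consE, consE_add, ← add_smul, hab, one_smul] at this
    exact this
  obtain ⟨c, h, h0, hI⟩ := exists_eq_Ioo_of_isOpen_convex hopen hconv hbound
  refine ⟨c, h, h0, hI, ?_⟩
  have hmem : ∀ s, consE s y ∈ L ↔ s ∈ Ioo (c - h) (c + h) := fun s => by rw [← hI]; rfl
  ext s
  simp only [steiner, mem_ofPred_eq, consE_zero, tailE_consE, hmem, mem_Ioo]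
  constructor
  · rintro ⟨d, ⟨h1, h2⟩, h3, h4⟩
    constructor <;> linarith
  · rintro ⟨h1, h2⟩
    exact ⟨c, ⟨by linarith, by linarith⟩, by linarith, by linarith⟩

lemma volume_steiner {k : ℕ} {L : Set (Euc (k + 1))} (ho : IsOpen L) (hc : Convex ℝ L) {R : ℝ}
    (hL : L ⊆ ball 0 R) : volume (steiner L) = volume L := by
  rw [volume_consE ho.measurableSet, volume_consE (isOpen_steiner ho).measurableSet]
  refine lintegral_congr fun y => ?_
  obtain ⟨c, h, -, h1, h2⟩ := fiber_steiner ho hc hL y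
  rw [h1, h2, Real.volume_Ioo, Real.volume_Ioo]
  congr 1; ring

lemma fiber_ball {k : ℕ} {r : ℝ} (hr : 0 < r) (y : Euc k) :
    ∃ ρ : ℝ, 0 ≤ ρ ∧ {s | consE s y ∈ ball (0 : Euc (k + 1)) r} = Ioo (-ρ) ρ := by
  refine ⟨√(r ^ 2 - ‖y‖ ^ 2), Real.sqrt_nonneg _, ?_⟩
  ext s
  rw [mem_ofPred_eq, mem_ball_zero_iff, mem_Ioo, ← abs_lt, Real.lt_sqrt (abs_nonneg s), sq_abs,
    ← pow_lt_pow_iff_left₀ (norm_nonneg _) hr.le two_ne_zero, norm_consE_sq]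
  constructor <;> intro h <;> linarith

/-- Symmetrization increases the overlap with a centered ball, with a gain controlled by the part
of `L` outside the ball which a translation moves to the part of the ball outside `L`. -/
lemma volume_inter_ball_steiner {k : ℕ} {L : Set (Euc (k + 1))} (ho : IsOpen L)
    (hc : Convex ℝ L) {R : ℝ} (hL : L ⊆ ball 0 R) {r : ℝ} (hr : 0 < r) (τ : ℝ) :
    volume (L ∩ ball 0 r) + volume {x | x ∈ L \ ball 0 r ∧ x - consE τ 0 ∈ ball 0 r \ L}
      ≤ volume (steiner L ∩ ball 0 r) := by
  set B : Set (Euc (k + 1)) := ball 0 r with hB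
  have hBm : MeasurableSet B := measurableSet_ball
  have hLm : MeasurableSet L := ho.measurableSet
  have hPm : MeasurableSet {x | x ∈ L \ B ∧ x - consE τ 0 ∈ B \ L} :=
    (hLm.diff hBm).inter ((measurable_id.sub_const _) (hBm.diff hLm))
  rw [volume_consE (hLm.inter hBm), volume_consE hPm,
    volume_consE ((isOpen_steiner ho).measurableSet.inter hBm),
    ← lintegral_add_left (measurable_volume_consE (hLm.inter hBm))]
  refine lintegral_mono fun y => ?_
  obtain ⟨c, h, h0, h1, h2⟩ := fiber_steiner ho hc hL y
  obtain ⟨ρ, hρ0, hρ⟩ := fiber_ball hr y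
  have hmc : Measurable fun s : ℝ => consE s y :=
    (continuous_consE.comp (Continuous.prodMk_left y)).measurable
  have e : {s | consE s y ∈ steiner L ∩ B} = Ioo (-(min h ρ)) (min h ρ) := by
    have : {s | consE s y ∈ steiner L ∩ B} =
        {s | consE s y ∈ steiner L} ∩ {s | consE s y ∈ B} := rfl
    rw [this, h2, hρ, Ioo_inter_Ioo, max_neg_neg]
  have hmin : volume {s | consE s y ∈ steiner L ∩ B} =
      min (volume {s | consE s y ∈ L}) (volume {s | consE s y ∈ B}) := by
    rw [e, h1, hρ, Real.volume_Ioo, Real.volume_Ioo, Real.volume_Ioo, ← ENNReal.ofReal_min]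
    congr 1
    rcases le_total h ρ with hh | hh
    · rw [min_eq_left hh, min_eq_left (by linarith)]; ring
    · rw [min_eq_right hh, min_eq_right (by linarith)]
  have hPf : MeasurableSet {s | consE s y ∈ {x | x ∈ L \ B ∧ x - consE τ 0 ∈ B \ L}} := hmc hPm
  have hDf : MeasurableSet {s | consE s y ∈ B \ L} := hmc (hBm.diff hLm)
  rw [hmin, le_min_iff]
  constructor
  · rw [← measure_union _ hPf]
    · refine measure_mono ?_
      rintro s (hs | hs)
      exacts [hs.1, hs.1.1]
    · rw [Set.disjoint_left]
      exact fun s hs hs' => hs'.1.2 hs.2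
  · have ht : volume {s | consE s y ∈ {x | x ∈ L \ B ∧ x - consE τ 0 ∈ B \ L}} ≤
        volume {s | consE s y ∈ B \ L} := by
      rw [← measure_preimage_add_right volume (-τ) {s | consE s y ∈ B \ L}]
      refine measure_mono fun s hs => ?_
      have h3 : consE s y - consE τ 0 = consE (s + -τ) y := by
        ext i; refine Fin.cases ?_ (fun j => ?_) i <;> simp [sub_eq_add_neg]
      have h4 := hs.2
      rw [h3] at h4
      exact h4
    refine (add_le_add_right ht _).trans ?_
    rw [← measure_union _ hDf]
    · refine measure_mono ?_
      rintro s (hs | hs)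
      exacts [hs.2, hs.1]
    · rw [Set.disjoint_left]
      exact fun s hs hs' => hs'.2 hs.1

lemma exists_detE_consE_eq_sum {k : ℕ} (Y : Fin (k + 1) → Euc k) :
    ∃ D : Fin (k + 1) → ℝ, ∀ s : Fin (k + 1) → ℝ,
      detE (fun i => consE (s i) (Y i)) = ∑ i, s i * D i := by
  refine ⟨fun i => (-1) ^ (i : ℕ) *
    Matrix.det (Matrix.of fun a b => Y (i.succAbove a) b), fun s => ?_⟩
  rw [detE, Matrix.det_succ_column_zero]
  refine Finset.sum_congr rfl fun i _ => ?_
  simp only [Matrix.of_apply, consE_zero]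
  have : (Matrix.of fun i j => consE (s i) (Y i) j).submatrix i.succAbove Fin.succ =
      Matrix.of fun a b => Y (i.succAbove a) b := by
    ext a b; simp
  rw [this]; ring

/-- The integral of `|ℓ|` for a linear form `ℓ` over translates of a symmetric set is minimal for
the symmetric set itself. -/
lemma lintegral_abs_linear_le {ι : Type*} [Fintype ι] (D : ι → ℝ) {Q : Set (ι → ℝ)}
    (hQm : MeasurableSet Q) (hQ : ∀ s, s ∈ Q ↔ -s ∈ Q) (b : ℝ) :
    ∫⁻ s in Q, ‖∑ i, s i * D i‖ₑ ≤ ∫⁻ s in Q, ‖(∑ i, s i * D i) + b‖ₑ := by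
  have hm : ∀ b : ℝ, Measurable fun s : ι → ℝ => ‖(∑ i, s i * D i) + b‖ₑ := fun b => by
    fun_prop
  have hneg : ∫⁻ s in Q, ‖(∑ i, s i * D i) + b‖ₑ = ∫⁻ s in Q, ‖(∑ i, s i * D i) + -b‖ₑ := by
    rw [← lintegral_indicator hQm, ← lintegral_indicator hQm,
      ← (Measure.measurePreserving_neg (volume : Measure (ι → ℝ))).lintegral_comp
        ((hm b).indicator hQm)]
    refine lintegral_congr fun s => ?_
    by_cases hs : s ∈ Q
    · rw [indicator_of_mem hs, indicator_of_mem ((hQ s).1 hs), ← enorm_neg]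
      congr 1
      simp only [Pi.neg_apply, neg_mul, Finset.sum_neg_distrib]
      ring
    · rw [indicator_of_notMem hs, indicator_of_notMem (mt (hQ s).2 hs)]
  have h2 : 2 * ∫⁻ s in Q, ‖∑ i, s i * D i‖ₑ ≤ 2 * ∫⁻ s in Q, ‖(∑ i, s i * D i) + b‖ₑ := by
    calc 2 * ∫⁻ s in Q, ‖∑ i, s i * D i‖ₑ
        = ∫⁻ s in Q, 2 * ‖∑ i, s i * D i‖ₑ := by
          rw [lintegral_const_mul _ (by simpa using hm 0)]
      _ ≤ ∫⁻ s in Q, (‖(∑ i, s i * D i) + b‖ₑ + ‖(∑ i, s i * D i) + -b‖ₑ) := by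
          refine lintegral_mono fun s => ?_
          refine le_trans (le_of_eq ?_) (enorm_add_le _ _)
          rw [show (∑ i, s i * D i) + b + ((∑ i, s i * D i) + -b) = 2 * ∑ i, s i * D i by ring,
            enorm_mul]
          congr 1
          simp [Real.enorm_eq_ofReal_abs]
      _ = 2 * ∫⁻ s in Q, ‖(∑ i, s i * D i) + b‖ₑ := by
          rw [lintegral_add_left (hm b), ← hneg, two_mul]
  exact (ENNReal.mul_le_mul_iff_right two_ne_zero ENNReal.ofNat_ne_top).1 h2

lemma detInt_steiner_le {k : ℕ} {L : Set (Euc (k + 1))} (ho : IsOpen L) (hc : Convex ℝ L)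
    {R : ℝ} (hL : L ⊆ ball 0 R) : detInt (steiner L) ≤ detInt L := by
  have hLm := ho.measurableSet
  have hSm := (isOpen_steiner ho).measurableSet
  rw [detInt_eq hLm, detInt_eq hSm,
    lintegral_consFamily (measurable_enorm_detE.indicator (MeasurableSet.univ_pi fun _ => hLm)),
    lintegral_consFamily (measurable_enorm_detE.indicator (MeasurableSet.univ_pi fun _ => hSm))]
  refine lintegral_mono fun Y => ?_
  obtain ⟨D, hD⟩ := exists_detE_consE_eq_sum Y
  choose c h h0 h1 h2 using fun i => fiber_steiner ho hc hL (Y i)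
  set Q : Set (Fin (k + 1) → ℝ) := univ.pi fun i => Ioo (-h i) (h i) with hQ
  have hQm : MeasurableSet Q := MeasurableSet.univ_pi fun _ => measurableSet_Ioo
  have hQs : ∀ s, s ∈ Q ↔ -s ∈ Q := by
    intro s
    simp only [hQ, mem_univ_pi, mem_Ioo, Pi.neg_apply, neg_lt_neg_iff]
    refine forall_congr' fun i => ⟨fun h => ⟨h.2, by linarith [h.1]⟩,
      fun h => ⟨by linarith [h.2], h.1⟩⟩
  have e1 : ∀ s : Fin (k + 1) → ℝ,
      (univ.pi fun _ => steiner L).indicator (fun X => ‖detE X‖ₑ) (fun i => consE (s i) (Y i))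
        = Q.indicator (fun s => ‖∑ i, s i * D i‖ₑ) s := by
    intro s
    have hm : (fun i => consE (s i) (Y i)) ∈ (univ.pi fun _ => steiner L) ↔ s ∈ Q := by
      simp only [mem_univ_pi, hQ, ← h2, mem_ofPred_eq]
    by_cases hs : s ∈ Q
    · rw [indicator_of_mem hs, indicator_of_mem (hm.2 hs), hD]
    · rw [indicator_of_notMem hs, indicator_of_notMem (mt hm.1 hs)]
  have e2 : ∀ s : Fin (k + 1) → ℝ,
      (univ.pi fun _ => L).indicator (fun X => ‖detE X‖ₑ) (fun i => consE ((s + c) i) (Y i))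
        = Q.indicator (fun s => ‖(∑ i, s i * D i) + ∑ i, c i * D i‖ₑ) s := by
    intro s
    have hm : (fun i => consE ((s + c) i) (Y i)) ∈ (univ.pi fun _ => L) ↔ s ∈ Q := by
      simp only [mem_univ_pi, hQ]
      refine forall_congr' fun i => ?_
      have : consE ((s + c) i) (Y i) ∈ L ↔ (s + c) i ∈ Ioo (c i - h i) (c i + h i) := by
        rw [← h1]; rfl
      rw [this, mem_Ioo, mem_Ioo, Pi.add_apply]
      constructor <;> rintro ⟨h3, h4⟩ <;> constructor <;> linarith
    by_cases hs : s ∈ Q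
    · rw [indicator_of_mem hs, indicator_of_mem (hm.2 hs), hD, ← Finset.sum_add_distrib]
      simp only [Pi.add_apply, add_mul]
    · rw [indicator_of_notMem hs, indicator_of_notMem (mt hm.1 hs)]
  rw [lintegral_congr e1, ← lintegral_add_right_eq_self (fun s : Fin (k + 1) → ℝ =>
      (univ.pi fun _ => L).indicator (fun X => ‖detE X‖ₑ) fun i => consE (s i) (Y i)) c,
    lintegral_congr e2, lintegral_indicator hQm, lintegral_indicator hQm]
  exact lintegral_abs_linear_le D hQm hQs _

/-! ### The random simplex inequality -/

lemma lintegral_volume_inter_translate {m : ℕ} {A D : Set (Euc m)} (hA : MeasurableSet A)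
    (hD : MeasurableSet D) :
    ∫⁻ v : Euc m, volume {x | x ∈ A ∧ x - v ∈ D} = volume A * volume D := by
  have h1 : ∀ v : Euc m, volume {x | x ∈ A ∧ x - v ∈ D} =
      ∫⁻ x, A.indicator 1 x * D.indicator 1 (x - v) := by
    intro v
    have hm : MeasurableSet {x | x ∈ A ∧ x - v ∈ D} := hA.inter ((measurable_id.sub_const v) hD)
    rw [← lintegral_indicator_one hm]
    refine lintegral_congr fun x => ?_
    by_cases ha : x ∈ A <;> by_cases hd : x - v ∈ D <;> simp [ha, hd, indicator]
  have hmeas : Measurable fun p : Euc m × Euc m =>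
      A.indicator (1 : Euc m → ℝ≥0∞) p.2 * D.indicator (1 : Euc m → ℝ≥0∞) (p.2 - p.1) :=
    ((measurable_one.indicator hA).comp measurable_snd).mul
      ((measurable_one.indicator hD).comp (measurable_snd.sub measurable_fst))
  rw [lintegral_congr h1, lintegral_lintegral_swap hmeas.aemeasurable]
  have h2 : ∀ x : Euc m, ∫⁻ v, A.indicator 1 x * D.indicator 1 (x - v) =
      A.indicator 1 x * volume D := by
    intro x
    have hm : Measurable fun v => D.indicator (1 : Euc m → ℝ≥0∞) (x - v) :=
      (measurable_one.indicator hD).comp (measurable_const.sub measurable_id)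
    rw [lintegral_const_mul _ hm, lintegral_sub_left_eq_self (D.indicator (1 : Euc m → ℝ≥0∞)) x,
      lintegral_indicator_one hD]
  rw [lintegral_congr h2, lintegral_mul_const _ (measurable_one.indicator hA),
    lintegral_indicator_one hA]

lemma volume_mul_volume_le_of_translate {m : ℕ} {A D : Set (Euc m)} (hA : MeasurableSet A)
    (hD : MeasurableSet D) {R : ℝ} (hAR : A ⊆ ball 0 R) (hDR : D ⊆ ball 0 R) {η : ℝ≥0∞}
    (h : ∀ v, volume {x | x ∈ A ∧ x - v ∈ D} ≤ η) :
    volume A * volume D ≤ η * volume (ball (0 : Euc m) (2 * R)) := by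
  rw [← lintegral_volume_inter_translate hA hD, ← setLIntegral_const,
    ← lintegral_indicator measurableSet_ball]
  refine lintegral_mono fun v => ?_
  by_cases hv : v ∈ ball (0 : Euc m) (2 * R)
  · rw [indicator_of_mem hv]; exact h v
  · have : {x | x ∈ A ∧ x - v ∈ D} = ∅ := by
      refine eq_empty_of_forall_notMem fun x hx => hv ?_
      have h1 := hAR hx.1
      have h2 := hDR hx.2
      rw [mem_ball_zero_iff] at *
      calc ‖v‖ = ‖x - (x - v)‖ := by congr 1; abel
        _ ≤ ‖x‖ + ‖x - v‖ := norm_sub_le _ _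
        _ < 2 * R := by linarith
    simp [this]

lemma exists_linearIsometryEquiv_apply_eq {m : ℕ} {v w : Euc m} (h : ‖v‖ = ‖w‖) :
    ∃ U : Euc m ≃ₗᵢ[ℝ] Euc m, U v = w :=
  ⟨Submodule.reflection (ℝ ∙ (v - w))ᗮ, Submodule.reflection_sub h⟩

lemma exists_symmetral {k : ℕ} {L : Set (Euc (k + 1))} (ho : IsOpen L) (hc : Convex ℝ L)
    {R : ℝ} (hR : 0 < R) (hL : L ⊆ ball 0 R) {r : ℝ} (hr : 0 < r) (v : Euc (k + 1)) :
    ∃ L' : Set (Euc (k + 1)), IsOpen L' ∧ Convex ℝ L' ∧ L' ⊆ ball 0 R ∧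
      volume L' = volume L ∧ detInt L' ≤ detInt L ∧
      volume (L ∩ ball 0 r) + volume {x | x ∈ L \ ball 0 r ∧ x - v ∈ ball 0 r \ L}
        ≤ volume (L' ∩ ball 0 r) := by
  obtain ⟨U, hU⟩ := exists_linearIsometryEquiv_apply_eq (v := consE ‖v‖ 0) (w := v) (by
    rw [← sq_eq_sq₀ (norm_nonneg _) (norm_nonneg _), norm_consE_sq]; simp)
  have hball : ∀ ρ : ℝ, U ⁻¹' ball 0 ρ = ball 0 ρ := fun ρ => by ext x; simp
  have ho1 : IsOpen (U ⁻¹' L) := ho.preimage U.continuous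
  have hc1 : Convex ℝ (U ⁻¹' L) := hc.linear_preimage U.toLinearEquiv.toLinearMap
  have hL1 : U ⁻¹' L ⊆ ball 0 R := by rw [← hball R]; exact preimage_mono hL
  have hvol : ∀ {S : Set (Euc (k + 1))}, MeasurableSet S → volume (U ⁻¹' S) = volume S :=
    fun hS => U.measurePreserving.measure_preimage hS.nullMeasurableSet
  refine ⟨steiner (U ⁻¹' L), isOpen_steiner ho1, convex_steiner hc1, steiner_subset_ball hR hL1,
    ?_, ?_, ?_⟩
  · rw [volume_steiner ho1 hc1 hL1, hvol ho.measurableSet]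
  · exact (detInt_steiner_le ho1 hc1 hL1).trans_eq (detInt_isometry U ho.measurableSet)
  · refine le_trans (le_of_eq ?_) (volume_inter_ball_steiner ho1 hc1 hL1 hr ‖v‖)
    have hBm : MeasurableSet (ball (0 : Euc (k + 1)) r) := measurableSet_ball
    have hPm : MeasurableSet {x | x ∈ L \ ball 0 r ∧ x - v ∈ ball 0 r \ L} :=
      (ho.measurableSet.diff hBm).inter ((measurable_id.sub_const _) (hBm.diff ho.measurableSet))
    rw [← hvol (ho.measurableSet.inter hBm), ← hvol hPm]
    congr 2
    · rw [preimage_inter, hball]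
    · ext x
      have hx : U x - v = U (x - consE ‖v‖ 0) := by rw [map_sub, hU]
      simp only [mem_preimage, mem_ofPred_eq, mem_sdiff, hx, mem_ball_zero_iff, U.norm_map]

lemma exists_detInt_ball_le {m : ℕ} (r : ℝ) : ∃ C : ℝ≥0∞, C ≠ ∞ ∧ ∀ L : Set (Euc m),
    MeasurableSet L →
      detInt (ball (0 : Euc m) r) ≤ detInt L + C * volume (ball (0 : Euc m) r \ L) := by
  set B : Set (Euc m) := ball 0 r with hB
  have hBm : MeasurableSet B := measurableSet_ball
  obtain ⟨M, hM⟩ : ∃ M : ℝ≥0, ∀ X ∈ univ.pi fun _ : Fin m => B, ‖detE X‖ₑ ≤ M := by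
    have hcomp : IsCompact (univ.pi fun _ : Fin m => closedBall (0 : Euc m) r) :=
      isCompact_univ_pi fun _ => isCompact_closedBall _ _
    obtain ⟨M, hM⟩ := hcomp.exists_bound_of_continuousOn continuous_detE.continuousOn
    refine ⟨M.toNNReal, fun X hX => ?_⟩
    have := hM X (fun i hi => ball_subset_closedBall (hX i hi))
    rw [← ofReal_norm]
    exact ENNReal.ofReal_le_ofReal this
  refine ⟨m * (M * volume B ^ (m - 1)), ENNReal.mul_ne_top (ENNReal.natCast_ne_top m)
    (ENNReal.mul_ne_top ENNReal.coe_ne_top (ENNReal.pow_ne_top measure_ball_lt_top.ne)),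
    fun L hL => ?_⟩
  let T : Fin m → Set (Fin m → Euc m) := fun i => univ.pi (Function.update (fun _ => B) i (B \ L))
  have hT : ∀ i, volume (T i) = volume (B \ L) * volume B ^ (m - 1) := by
    intro i
    rw [volume_pi_pi, ← Finset.mul_prod_erase _ _ (Finset.mem_univ i), Function.update_self]
    congr 1
    rw [Finset.prod_congr rfl (g := fun _ => volume B)]
    · simp
    · intro j hj
      rw [Function.update_of_ne (Finset.ne_of_mem_erase hj)]
  have hTB : ∀ i, T i ⊆ univ.pi fun _ => B := by
    intro i X hX j _
    have := hX j (mem_univ j)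
    by_cases hj : j = i
    · subst hj; rw [Function.update_self] at this; exact this.1
    · rwa [Function.update_of_ne hj] at this
  have hTm : ∀ i, MeasurableSet (T i) := by
    intro i
    refine MeasurableSet.univ_pi fun j => ?_
    by_cases hj : j = i
    · subst hj; rw [Function.update_self]; exact hBm.diff hL
    · rwa [Function.update_of_ne hj]
  have hsub : (univ.pi fun _ : Fin m => B) ⊆ (univ.pi fun _ => L) ∪ ⋃ i, T i := by
    intro X hX
    by_cases hXL : ∀ i, X i ∈ L
    · exact Or.inl fun i _ => hXL i
    · push Not at hXL
      obtain ⟨i, hi⟩ := hXL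
      refine Or.inr (mem_iUnion.2 ⟨i, fun j _ => ?_⟩)
      by_cases hj : j = i
      · subst hj; rw [Function.update_self]; exact ⟨hX j (mem_univ j), hi⟩
      · rw [Function.update_of_ne hj]; exact hX j (mem_univ j)
  calc detInt B ≤ ∫⁻ X in (univ.pi fun _ => L) ∪ ⋃ i, T i, ‖detE X‖ₑ := lintegral_mono_set hsub
    _ ≤ detInt L + ∫⁻ X in ⋃ i, T i, ‖detE X‖ₑ := lintegral_union_le _ _ _
    _ ≤ detInt L + ∑ i, ∫⁻ X in T i, ‖detE X‖ₑ := by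
        gcongr
        exact (lintegral_iUnion_le _ _).trans_eq (tsum_fintype _)
    _ ≤ detInt L + ∑ _i : Fin m, M * (volume (B \ L) * volume B ^ (m - 1)) := by
        gcongr with i _
        rw [← hT i, ← setLIntegral_const]
        exact setLIntegral_mono' (hTm i) fun X hX => hM X (hTB i hX)
    _ = detInt L + m * (M * volume B ^ (m - 1)) * volume (B \ L) := by
        rw [Finset.sum_const, Finset.card_univ, Fintype.card_fin, nsmul_eq_mul]
        ring

/-- Among bounded open convex sets of given volume, `detInt` is minimal for the ball. -/
lemma detInt_ball_le {k : ℕ} {L : Set (Euc (k + 1))} (ho : IsOpen L) (hc : Convex ℝ L)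
    (hb : Bornology.IsBounded L) {r : ℝ} (hr : 0 < r)
    (hv : volume L = volume (ball (0 : Euc (k + 1)) r)) :
    detInt (ball (0 : Euc (k + 1)) r) ≤ detInt L := by
  set B : Set (Euc (k + 1)) := ball 0 r with hB
  have hBm : MeasurableSet B := measurableSet_ball
  have hBfin : volume B ≠ ∞ := measure_ball_lt_top.ne
  obtain ⟨R, hR, hLR, hBR⟩ : ∃ R, 0 < R ∧ L ⊆ ball 0 R ∧ B ⊆ ball 0 R := by
    obtain ⟨R, hR⟩ := hb.subset_ball 0
    exact ⟨max R r, lt_max_of_lt_right hr, hR.trans (ball_subset_ball (le_max_left _ _)),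
      ball_subset_ball (le_max_right _ _)⟩
  obtain ⟨C, hC, hCL⟩ := exists_detInt_ball_le (m := k + 1) r
  let 𝒞 : Set (Set (Euc (k + 1))) := {M | IsOpen M ∧ Convex ℝ M ∧ M ⊆ ball 0 R ∧
    volume M = volume B ∧ detInt M ≤ detInt L}
  have hL𝒞 : L ∈ 𝒞 := ⟨ho, hc, hLR, hv, le_rfl⟩
  set S : ℝ≥0∞ := ⨆ M ∈ 𝒞, volume (M ∩ B) with hS
  have hSfin : S ≠ ∞ :=
    ne_top_of_le_ne_top hBfin (iSup₂_le fun M _ => measure_mono inter_subset_right)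
  set W := volume (ball (0 : Euc (k + 1)) (2 * R)) with hW
  have hWfin : W ≠ ∞ := measure_ball_lt_top.ne
  have hW0 : W ≠ 0 := (measure_ball_pos _ _ (by positivity)).ne'
  have key : ∀ ε : ℝ≥0∞, ε ≠ 0 → ε ≠ ∞ → detInt B ≤ detInt L + C * ε := by
    intro ε hε0 hε1
    obtain ⟨M, hM𝒞, hM⟩ : ∃ M ∈ 𝒞, S ≤ volume (M ∩ B) + ε * ε / W := by
      by_contra! hcon
      have hη : ε * ε / W ≠ 0 := by simp [hε0, hWfin]
      have h0 : S - ε * ε / W < S := by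
        refine ENNReal.sub_lt_self hSfin (fun h => ?_) hη
        have := hcon L hL𝒞
        simp [h] at this
      obtain ⟨M, hM⟩ := lt_iSup_iff.1 h0
      obtain ⟨hM𝒞, hM⟩ := lt_iSup_iff.1 hM
      exact absurd (tsub_le_iff_right.1 le_rfl |>.trans (add_le_add_left hM.le _))
        (not_le.2 (hcon M hM𝒞))
    obtain ⟨hMo, hMc, hMR, hMv, hMd⟩ := hM𝒞
    have hMm := hMo.measurableSet
    have hgain : ∀ v, volume {x | x ∈ M \ B ∧ x - v ∈ B \ M} ≤ ε * ε / W := by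
      intro v
      obtain ⟨M', h1, h2, h3, h4, h5, h6⟩ := exists_symmetral hMo hMc hR hMR hr v
      have hM' : volume (M' ∩ B) ≤ S :=
        le_iSup₂_of_le M' ⟨h1, h2, h3, h4.trans hMv, h5.trans hMd⟩ le_rfl
      have hfin : volume (M ∩ B) ≠ ∞ :=
        ne_top_of_le_ne_top hBfin (measure_mono inter_subset_right)
      exact (ENNReal.add_le_add_iff_left hfin).1 (h6.trans (hM'.trans hM))
    have hprod := volume_mul_volume_le_of_translate (hMm.diff hBm) (hBm.diff hMm)
      (sdiff_subset.trans hMR) (sdiff_subset.trans hBR) hgain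
    rw [← hW, ENNReal.div_mul_cancel hW0 hWfin] at hprod
    have hMB : volume (M \ B) = volume (B \ M) := by
      have e1 := measure_inter_add_sdiff M hBm (μ := volume)
      have e2 := measure_inter_add_sdiff B hMm (μ := volume)
      rw [hMv, ← e2, inter_comm] at e1
      exact (ENNReal.add_right_inj
        (ne_top_of_le_ne_top hBfin (measure_mono inter_subset_left))).1 e1
    rw [hMB] at hprod
    have hle : volume (B \ M) ≤ ε := by
      by_contra! hlt
      exact absurd hprod (not_le.2 (ENNReal.mul_lt_mul hlt hlt))
    calc detInt B ≤ detInt M + C * volume (B \ M) := hCL M hMm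
      _ ≤ detInt L + C * ε := by gcongr
  have hlim : Filter.Tendsto (fun n : ℕ => detInt L + C * (n + 1 : ℝ≥0∞)⁻¹) Filter.atTop
      (nhds (detInt L + C * 0)) := by
    refine Filter.Tendsto.const_add _ (ENNReal.Tendsto.const_mul ?_ (Or.inr hC))
    have := (Filter.tendsto_add_atTop_iff_nat 1).2 ENNReal.tendsto_inv_nat_nhds_zero
    simpa using this
  have := ge_of_tendsto' hlim fun n => key (n + 1 : ℝ≥0∞)⁻¹ 
    (ENNReal.inv_ne_zero.2 (by finiteness)) (by simp)
  simpa using this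

/-- The random simplex inequality of Busemann. -/
lemma ballConst_mul_le_detInt {k : ℕ} {L : Set (Euc (k + 1))} (hc : Convex ℝ L)
    (hb : Bornology.IsBounded L) :
    ballConst (k + 1) * volume L ^ (k + 1 + 1) ≤ detInt L := by
  by_cases h0 : volume L = 0
  · simp [h0]
  have hint : volume (interior L) = volume L := by
    refine le_antisymm (measure_mono interior_subset) ?_
    calc volume L ≤ volume (closure L) := measure_mono subset_closure
      _ = volume (interior L ∪ frontier L) := by rw [closure_eq_interior_union_frontier]
      _ ≤ volume (interior L) + volume (frontier L) := measure_union_le _ _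
      _ = volume (interior L) := by rw [hc.addHaar_frontier volume, add_zero]
  set V := volume (ball (0 : Euc (k + 1)) 1) with hV
  have hV0 : V ≠ 0 := (measure_ball_pos _ _ one_pos).ne'
  have hV1 : V ≠ ∞ := measure_ball_lt_top.ne
  have hL1 : volume L ≠ ∞ := hb.measure_lt_top.ne
  set r : ℝ := (volume L / V).toReal ^ ((k + 1 : ℝ)⁻¹) with hr
  have hq : 0 < (volume L / V).toReal :=
    ENNReal.toReal_pos (by simp [h0, hV1]) (ENNReal.div_ne_top hL1 hV0)
  have hr0 : 0 < r := Real.rpow_pos_of_pos hq _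
  have hrv : volume (ball (0 : Euc (k + 1)) r) = volume L := by
    rw [Measure.addHaar_ball_of_pos _ _ hr0, finrank_euclideanSpace_fin]
    have : r ^ (k + 1) = (volume L / V).toReal := by
      rw [hr, ← Real.rpow_natCast, ← Real.rpow_mul hq.le]
      push_cast
      rw [inv_mul_cancel₀ (by positivity), Real.rpow_one]
    rw [this, ENNReal.ofReal_toReal (ENNReal.div_ne_top hL1 hV0), ENNReal.div_mul_cancel hV0 hV1]
  rw [← hrv, ← detInt_ball hr0]
  exact (detInt_ball_le isOpen_interior hc.interior (hb.subset interior_subset) hr0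
    (hint.trans hrv.symm)).trans (detInt_mono interior_subset)

/-! ### Integration over hyperplane sections parametrized as graphs -/

lemma volume_detE_eq_zero (m : ℕ) : volume {X : Fin m → Euc m | detE X = 0} = 0 := by
  set A : Set (Fin m → Euc m) := {X | detE X = 0} with hA
  let J : Fin m → Euc m := fun i => EuclideanSpace.single i 1
  have hAm : MeasurableSet A := continuous_detE.measurable (measurableSet_singleton 0)
  let S : Set (ℝ × (Fin m → Euc m)) := {p | p.2 + p.1 • J ∈ A}
  have hSm : MeasurableSet S := by
    have : Continuous fun p : ℝ × (Fin m → Euc m) => p.2 + p.1 • J := by fun_prop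
    exact this.measurable hAm
  have hfin : ∀ X, volume ((fun t => (t, X)) ⁻¹' S) = 0 := by
    intro X
    let M : Matrix (Fin m) (Fin m) ℝ := Matrix.of fun i j => X i j
    have hroot : ((fun t => (t, X)) ⁻¹' S) ⊆ {t | (-M).charpoly.IsRoot t} := by
      intro t ht
      have h1 : detE (X + t • J) = 0 := ht
      have h2 : (Matrix.of fun i j => (X + t • J) i j) = Matrix.scalar (Fin m) t - -M := by
        ext i j
        simp [J, M, Matrix.diagonal_apply, eq_comm, add_comm]
      rw [mem_ofPred_eq, Polynomial.IsRoot, Matrix.eval_charpoly, ← h2]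
      exact h1
    exact ((Polynomial.finite_setOfPred_isRoot (Matrix.charpoly_monic _).ne_zero).subset
      hroot).measure_zero _
  have h0 : (volume.prod volume) S = 0 := by
    rw [Measure.prod_apply_symm hSm]
    simp [hfin]
  have h1 := Measure.ae_ae_of_ae_prod (measure_eq_zero_iff_ae_notMem.1 h0)
  obtain ⟨t, ht⟩ := h1.exists
  have h2 := measure_preimage_add_right (volume : Measure (Fin m → Euc m)) (t • J) A
  rw [← h2]
  exact measure_eq_zero_iff_ae_notMem.2 ht

/-- The projection to the last `m` coordinates of the section of `K` by the graph of `⟪w, ·⟫`. -/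
def graphSec {m : ℕ} (K : Set (Euc (m + 1))) (w : Euc m) : Set (Euc m) :=
  {x | consE ⟪w, x⟫ x ∈ K}

lemma continuous_graph {m : ℕ} :
    Continuous fun p : Euc m × Euc m => consE ⟪p.1, p.2⟫ p.2 :=
  continuous_consE.comp (by fun_prop : Continuous fun p : Euc m × Euc m => (⟪p.1, p.2⟫, p.2))

lemma measurableSet_graphSec {m : ℕ} {K : Set (Euc (m + 1))} (hK : MeasurableSet K) (w : Euc m) :
    MeasurableSet (graphSec K w) :=
  (continuous_graph.comp (Continuous.prodMk_right w)).measurable hK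

lemma measurable_volume_graphSec {m : ℕ} {K : Set (Euc (m + 1))} (hK : MeasurableSet K) :
    Measurable fun w => volume (graphSec K w) :=
  measurable_measure_prodMk_left (continuous_graph.measurable hK)

lemma lintegral_inner_family {m : ℕ} {Y : Fin m → Euc m} (hY : detE Y ≠ 0)
    {g : (Fin m → ℝ) → ℝ≥0∞} (hg : Measurable g) :
    ∫⁻ s, g s = ‖detE Y‖ₑ * ∫⁻ w : Euc m, g fun i => ⟪w, Y i⟫ := by
  have h0 : ‖detE Y‖ₑ ≠ 0 := by simpa using hY
  have hmap := Real.map_matrix_volume_pi_eq_smul_volume_pi hY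
  have hm : Measurable (Matrix.toLin' (Matrix.of fun i j => Y i j)) :=
    (LinearMap.continuous_of_finiteDimensional _).measurable
  have h1 : ∫⁻ w : Euc m, g (fun i => ⟪w, Y i⟫) =
      ∫⁻ v : Fin m → ℝ, g (Matrix.toLin' (Matrix.of fun i j => Y i j) v) := by
    have := (PiLp.volume_preserving_ofLp (Fin m)).lintegral_comp (hg.comp hm)
    simp only [Function.comp_apply] at this
    rw [← this]
    refine lintegral_congr fun w => congrArg g (funext fun i => ?_)
    simp [PiLp.inner_apply, Matrix.mulVec, dotProduct]
  rw [h1, ← lintegral_map hg hm, hmap, lintegral_smul_measure, ← Real.enorm_eq_ofReal_abs]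
  change _ = ‖detE Y‖ₑ * (‖(detE Y)⁻¹‖ₑ * _)
  rw [enorm_inv hY, ← mul_assoc]
  rw [ENNReal.mul_inv_cancel h0 enorm_ne_top, one_mul]

/-- The linear Blaschke–Petkantschin formula. -/
lemma volume_pow_eq_lintegral_detInt {m : ℕ} {K : Set (Euc (m + 1))} (hK : MeasurableSet K) :
    volume K ^ m = ∫⁻ w : Euc m, detInt (graphSec K w) := by
  have hP : MeasurableSet (univ.pi fun _ : Fin m => K) := MeasurableSet.univ_pi fun _ => hK
  have h1 : volume K ^ m = volume (univ.pi fun _ : Fin m => K) := by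
    rw [volume_pi_pi]; simp
  have hcont : Continuous fun p : Euc m × (Fin m → Euc m) =>
      fun i => consE ⟪p.1, p.2 i⟫ (p.2 i) :=
    continuous_pi fun i => continuous_graph.comp
      (by fun_prop : Continuous fun p : Euc m × (Fin m → Euc m) => (p.1, p.2 i))
  have hmeas : Measurable fun p : Euc m × (Fin m → Euc m) =>
      (univ.pi fun _ : Fin m => K).indicator (1 : (Fin m → Euc (m + 1)) → ℝ≥0∞)
        (fun i => consE ⟪p.1, p.2 i⟫ (p.2 i)) * ‖detE p.2‖ₑ :=
    ((measurable_one.indicator hP).comp hcont.measurable).mul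
      (measurable_enorm_detE.comp measurable_snd)
  have h2 : ∀ w : Euc m, detInt (graphSec K w) = ∫⁻ Y : Fin m → Euc m,
      (univ.pi fun _ : Fin m => K).indicator (1 : (Fin m → Euc (m + 1)) → ℝ≥0∞)
        (fun i => consE ⟪w, Y i⟫ (Y i)) * ‖detE Y‖ₑ := by
    intro w
    rw [detInt_eq (measurableSet_graphSec hK w)]
    refine lintegral_congr fun Y => ?_
    have hm : (fun i => consE ⟪w, Y i⟫ (Y i)) ∈ (univ.pi fun _ : Fin m => K) ↔
      Y ∈ univ.pi fun _ : Fin m => graphSec K w := by simp [graphSec]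
    by_cases hY : Y ∈ univ.pi fun _ : Fin m => graphSec K w
    · rw [indicator_of_mem hY, indicator_of_mem (hm.2 hY), Pi.one_apply, one_mul]
    · rw [indicator_of_notMem hY, indicator_of_notMem (mt hm.1 hY), zero_mul]
  rw [h1, ← lintegral_indicator_one hP, lintegral_consFamily (measurable_one.indicator hP),
    lintegral_congr h2]
  refine Eq.trans ?_ (lintegral_lintegral_swap hmeas.aemeasurable).symm
  refine lintegral_congr_ae ?_
  filter_upwards [measure_eq_zero_iff_ae_notMem.1 (volume_detE_eq_zero m)] with Y hY
  have hsec : Measurable fun s : Fin m → ℝ => fun i => consE (s i) (Y i) :=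
    (continuous_pi fun i => continuous_consE.comp
      (by fun_prop : Continuous fun s : Fin m → ℝ => (s i, Y i))).measurable
  have hg := (measurable_one.indicator hP : Measurable
    ((univ.pi fun _ : Fin m => K).indicator (1 : (Fin m → Euc (m + 1)) → ℝ≥0∞))).comp hsec
  rw [lintegral_mul_const', mul_comm]
  · exact lintegral_inner_family hY hg
  · exact enorm_ne_top

/-- The linear parametrization of the hyperplane that is the graph of `⟪w, ·⟫`. -/
def graphMap {m : ℕ} (w : Euc m) : Euc m →ₗ[ℝ] Euc (m + 1) where
  toFun x := consE ⟪w, x⟫ x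
  map_add' x y := by rw [inner_add_right, consE_add]
  map_smul' c x := by rw [inner_smul_right, RingHom.id_apply, smul_consE]

lemma graphMap_injective {m : ℕ} (w : Euc m) : Function.Injective (graphMap w) :=
  fun _ _ h => (consE_inj h).2

lemma exists_linearMap_norm_eq {m : ℕ} {V : Type*} [NormedAddCommGroup V] [InnerProductSpace ℝ V]
    (G : Euc m →ₗ[ℝ] V) (hG : Function.Injective G) :
    ∃ N : Euc m →ₗ[ℝ] Euc m, LinearMap.det N ≠ 0 ∧ ∀ x, ‖N x‖ = ‖G x‖ := by
  have hr : Module.finrank ℝ (LinearMap.range G) = m := by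
    rw [LinearMap.finrank_range_of_inj hG, finrank_euclideanSpace_fin]
  let b := (stdOrthonormalBasis ℝ (LinearMap.range G)).reindex (finCongr hr)
  let N : Euc m →ₗ[ℝ] Euc m := b.repr.toLinearEquiv.toLinearMap ∘ₗ G.rangeRestrict
  have hN : ∀ x, ‖N x‖ = ‖G x‖ := fun x => b.repr.norm_map _
  refine ⟨N, fun h0 => ?_, hN⟩
  obtain ⟨x, hx, hx0⟩ := (Submodule.ne_bot_iff _).1 (LinearMap.bot_lt_ker_of_det_eq_zero h0).ne'
  refine hx0 (hG ?_)
  rw [map_zero, ← norm_eq_zero, ← hN, LinearMap.mem_ker.1 hx, norm_zero]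

lemma volume_ellipsoid_pow {m : ℕ} (T : Euc (m + 1) ≃ₗ[ℝ] Euc (m + 1)) :
    volume (T '' closedBall 0 1) ^ m ≤
      ballConst m * ∫⁻ w, volume (graphSec (T '' closedBall 0 1) w) ^ (m + 1) := by
  have hT : volume (T '' closedBall 0 1) = volume (T '' ball 0 1) := by
    have h : ∀ s, volume (T '' s) = _ :=
      Measure.addHaar_image_linearMap (volume : Measure (Euc (m + 1))) T.toLinearMap
    rw [h, h, Measure.addHaar_closedBall_eq_addHaar_ball]
  have hTo : MeasurableSet (T '' ball 0 1) := by
    exact (T.toContinuousLinearEquiv.toHomeomorph.isOpenMap _ isOpen_ball).measurableSet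
  have h1 : ∀ w, detInt (graphSec (T '' ball 0 1) w) =
      ballConst m * volume (graphSec (T '' ball 0 1) w) ^ (m + 1) := by
    intro w
    obtain ⟨N, hN, hNn⟩ := exists_linearMap_norm_eq (T.symm.toLinearMap ∘ₗ graphMap w)
      (T.symm.injective.comp (graphMap_injective w))
    have : graphSec (T '' ball 0 1) w = N ⁻¹' ball 0 1 := by
      ext x
      have hx : x ∈ graphSec (T '' ball 0 1) w ↔ T.symm (graphMap w x) ∈ ball 0 1 := by
        constructor
        · rintro ⟨y, hy, hyx⟩
          have : y = T.symm (graphMap w x) := (T.eq_symm_apply).2 hyx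
          rwa [← this]
        · exact fun h => ⟨_, h, T.apply_symm_apply _⟩
      rw [hx, mem_preimage, mem_ball_zero_iff, mem_ball_zero_iff, hNn]
      rfl
    rw [this, detInt_ellipsoid hN]
  rw [hT, volume_pow_eq_lintegral_detInt hTo, lintegral_congr h1,
    lintegral_const_mul _ ((measurable_volume_graphSec hTo).pow_const _)]
  gcongr with w
  exact fun x hx => image_mono ball_subset_closedBall hx

lemma isBounded_graphSec {m : ℕ} {K : Set (Euc (m + 1))} (hK : Bornology.IsBounded K) (w : Euc m) :
    Bornology.IsBounded (graphSec K w) := by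
  obtain ⟨R, hR⟩ := hK.subset_closedBall 0
  refine isBounded_closedBall.subset (s := graphSec K w) (t := closedBall 0 R) fun x hx => ?_
  have h1 := mem_closedBall_zero_iff.1 (hR hx)
  have h2 := norm_consE_sq ⟪w, x⟫ x
  rw [mem_closedBall_zero_iff]
  refine le_trans ?_ h1
  rw [← sq_le_sq₀ (norm_nonneg _) (norm_nonneg _), h2]
  nlinarith [sq_nonneg ⟪w, x⟫]

lemma lintegral_volume_graphSec_pow_le {k : ℕ} {K : Set (Euc (k + 1 + 1))} (hc : Convex ℝ K)
    (hK : IsCompact K) :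
    ballConst (k + 1) * ∫⁻ w, volume (graphSec K w) ^ (k + 1 + 1) ≤ volume K ^ (k + 1) := by
  rw [volume_pow_eq_lintegral_detInt hK.measurableSet,
    ← lintegral_const_mul _ ((measurable_volume_graphSec hK.measurableSet).pow_const _)]
  exact lintegral_mono fun w => ballConst_mul_le_detInt (hc.linear_preimage (graphMap w))
    (isBounded_graphSec hK.isBounded w)

/-! ### Hausdorff measure of central sections -/

lemma normDet_graphMap {m : ℕ} (w : Euc m) : (graphMap w).normDet = √(1 + ‖w‖ ^ 2) := by
  have h := (graphMap w).normDet_sq_eq_det_gram (EuclideanSpace.basisFun (Fin m) ℝ)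
  have hg : Matrix.gram ℝ (fun i => graphMap w (EuclideanSpace.basisFun (Fin m) ℝ i)) =
      1 + Matrix.replicateCol Unit w.ofLp * Matrix.replicateRow Unit w.ofLp := by
    ext i j
    simp [graphMap, inner_consE, Matrix.one_apply, Matrix.mul_apply,
      EuclideanSpace.inner_single_right, eq_comm, add_comm]
  rw [hg, Matrix.det_one_add_replicateCol_mul_replicateRow] at h
  rw [← Real.sqrt_sq (LinearMap.normDet_nonneg _)]
  congr 1
  rw [EuclideanSpace.real_norm_sq_eq]
  simpa [dotProduct, sq] using h

/-- The normalization of `m`-dimensional Hausdorff measure with respect to Lebesgue measure. -/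
def hausConst (m : ℕ) : ℝ≥0∞ :=
  (Measure.addHaarScalarFactor (volume : Measure (Euc m)) μH[m] : ℝ≥0∞)⁻¹

lemma hausConst_ne_zero (m : ℕ) : hausConst m ≠ 0 := by simp [hausConst]

lemma hausConst_ne_top (m : ℕ) : hausConst m ≠ ∞ := by
  simpa [hausConst] using Measure.addHaarScalarFactor_volume_hausdorffMeasure_ne_zero m

lemma hausdorffMeasure_eq_hausConst_mul {m : ℕ} (L : Set (Euc m)) :
    μH[m] L = hausConst m * volume L := by
  have h := EuclideanSpace.euclideanHausdorffMeasure_eq_volume m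
  rw [← h, Measure.euclideanHausdorffMeasure_def, Measure.smul_apply, hausConst, ENNReal.smul_def,
    smul_eq_mul, ← mul_assoc, ENNReal.inv_mul_cancel _ ENNReal.coe_ne_top, one_mul]
  simpa using Measure.addHaarScalarFactor_volume_hausdorffMeasure_ne_zero m

/-- The slope of the graph `θ^⊥`. -/
def graphSlope {m : ℕ} (θ : Euc (m + 1)) : Euc m := -(θ 0)⁻¹ • tailE θ

/-- The area of the section of `K` by the graph of `⟪w, ·⟫`. -/
def graphArea {m : ℕ} (K : Set (Euc (m + 1))) (w : Euc m) : ℝ≥0∞ :=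
  hausConst m * (ENNReal.ofReal √(1 + ‖w‖ ^ 2) * volume (graphSec K w))

lemma sectionVol_eq_graphArea {m : ℕ} (K : Set (Euc (m + 1))) {θ : Euc (m + 1)} (hθ : θ 0 ≠ 0) :
    sectionVol (m + 1) K θ = graphArea K (graphSlope θ) := by
  have himg : K ∩ {x : Euc (m + 1) | ⟪x, θ⟫ = 0} =
      graphMap (graphSlope θ) '' graphSec K (graphSlope θ) := by
    have hper : ∀ (a : ℝ) (y : Euc m), ⟪consE a y, θ⟫ = 0 ↔ a = ⟪graphSlope θ, y⟫ := by
      intro a y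
      have h1 : ⟪consE a y, θ⟫ = a * θ 0 + ⟪y, tailE θ⟫ := by
        rw [← inner_consE, consE_tailE]
      rw [h1, graphSlope, inner_smul_left, real_inner_comm]
      simp only [conj_trivial]
      constructor
      · intro h
        field_simp
        linarith
      · rintro rfl
        field_simp
        ring
    ext x
    constructor
    · rintro ⟨hx, hxθ⟩
      rw [← consE_tailE x] at hx hxθ
      have h2 := (hper _ _).1 hxθ
      refine ⟨tailE x, ?_, ?_⟩
      · change consE _ _ ∈ K
        rwa [← h2]
      · change consE _ _ = x
        rw [← h2, consE_tailE]
    · rintro ⟨y, hy, rfl⟩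
      exact ⟨hy, (hper _ _).2 rfl⟩
  have h2 := (graphMap (graphSlope θ)).hausdorffMeasure_image (graphSec K (graphSlope θ))
  rw [finrank_euclideanSpace_fin, normDet_graphMap, hausdorffMeasure_eq_hausConst_mul] at h2
  have h3 : ((m + 1 : ℕ) : ℝ) - 1 = m := by push_cast; ring
  rw [sectionVol, h3, himg, h2, graphArea, mul_left_comm]

/-! ### Rotation invariant measures on the sphere -/

instance continuousStar_euc (n : ℕ) : ContinuousStar (Euc n →L[ℝ] Euc n) :=
  ⟨(ContinuousLinearMap.adjoint : (Euc n →L[ℝ] Euc n) ≃ₗᵢ⋆[ℝ] (Euc n →L[ℝ] Euc n)).continuous⟩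

instance compactSpace_unitary_euc (n : ℕ) : CompactSpace (unitary (Euc n →L[ℝ] Euc n)) := by
  refine isCompact_iff_compactSpace.1
    (Metric.isCompact_of_isClosed_isBounded isClosed_unitary ?_)
  refine (isBounded_closedBall (x := (0 : Euc n →L[ℝ] Euc n)) (r := 1)).subset fun u hu => ?_
  rw [mem_closedBall_zero_iff]
  exact ContinuousLinearMap.opNorm_le_bound _ zero_le_one fun x => by
    rw [ContinuousLinearMap.norm_map_of_mem_unitary hu, one_mul]

/-- Rotation invariant finite measures on the sphere are proportional. -/
lemma exists_eq_mul_of_rotation_invariant {n : ℕ} {e : Euc n} (he : ‖e‖ = 1) :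
    ∃ c : Set (Euc n) → ℝ≥0∞, ∀ (μ : Measure (Euc n)) [IsFiniteMeasure μ],
      (∀ (U : Euc n ≃ₗᵢ[ℝ] Euc n) (A : Set (Euc n)), MeasurableSet A → μ (U ⁻¹' A) = μ A) →
      (∀ᵐ x ∂μ, ‖x‖ = 1) → ∀ A, MeasurableSet A → μ A = c A * μ univ := by
  let G := unitary (Euc n →L[ℝ] Euc n)
  let haar : Measure G := Measure.haarMeasure ⊤
  let act : G × Euc n → Euc n := fun p => ((p.1⁻¹ : G) : Euc n →L[ℝ] Euc n) p.2
  have hact : Continuous act :=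
    (continuous_subtype_val.comp (continuous_inv.comp continuous_fst)).clm_apply continuous_snd
  have huniv : haar univ = 1 := Measure.haarMeasure_self
  refine ⟨fun A => haar {g | act (g, e) ∈ A}, fun μ _ hμ hμ1 A hA => ?_⟩
  have hm : MeasurableSet (act ⁻¹' A) := hact.measurable hA
  have h1 : ∀ g : G, μ {x | act (g, x) ∈ A} = μ A := fun g =>
    hμ (Unitary.linearIsometryEquiv g⁻¹) A hA
  have h2 : ∀ x, ‖x‖ = 1 → haar {g | act (g, x) ∈ A} = haar {g | act (g, e) ∈ A} := by
    intro x hx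
    obtain ⟨U, hU⟩ := exists_linearIsometryEquiv_apply_eq (he.trans hx.symm)
    let h : G := Unitary.linearIsometryEquiv.symm U
    have hh : (h : Euc n →L[ℝ] Euc n) e = x := hU
    rw [← measure_preimage_mul haar h⁻¹ {g | act (g, e) ∈ A}]
    congr 1
    ext g
    have : act (h⁻¹ * g, e) = act (g, x) := by
      have hi : (h⁻¹ * g)⁻¹ = g⁻¹ * h := by rw [mul_inv_rev, inv_inv]
      change (((h⁻¹ * g)⁻¹ : G) : Euc n →L[ℝ] Euc n) e = _
      rw [hi, ← hh]
      rfl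
    simp only [mem_preimage, mem_ofPred_eq, this]
  calc μ A = ∫⁻ g, μ {x | act (g, x) ∈ A} ∂haar := by
        rw [lintegral_congr h1, lintegral_const, huniv, mul_one]
    _ = (haar.prod μ) (act ⁻¹' A) := (Measure.prod_apply hm).symm
    _ = ∫⁻ x, haar {g | act (g, x) ∈ A} ∂μ := Measure.prod_apply_symm hm
    _ = ∫⁻ _, haar {g | act (g, e) ∈ A} ∂μ := lintegral_congr_ae (hμ1.mono h2)
    _ = haar {g | act (g, e) ∈ A} * μ univ := lintegral_const _

lemma norm_normalize_sub_le {V : Type*} [NormedAddCommGroup V] [NormedSpace ℝ V] {x y : V}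
    (hx : 1 ≤ ‖x‖) (hy : 1 ≤ ‖y‖) : ‖‖x‖⁻¹ • x - ‖y‖⁻¹ • y‖ ≤ 2 * ‖x - y‖ := by
  have hx0 : 0 < ‖x‖ := by linarith
  have hy0 : 0 < ‖y‖ := by linarith
  have h1 : ‖x‖⁻¹ • x - ‖y‖⁻¹ • y = ‖x‖⁻¹ • (x - y) + (‖x‖⁻¹ - ‖y‖⁻¹) • y := by
    rw [smul_sub, sub_smul]; abel
  have h2 : ‖(‖x‖⁻¹ - ‖y‖⁻¹) • y‖ = ‖x‖⁻¹ * |‖y‖ - ‖x‖| := by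
    rw [norm_smul, Real.norm_eq_abs, inv_sub_inv hx0.ne' hy0.ne', abs_div,
      abs_of_pos (mul_pos hx0 hy0)]
    field_simp
  have h3 : |‖y‖ - ‖x‖| ≤ ‖x - y‖ := by rw [abs_sub_comm]; exact abs_norm_sub_norm_le x y
  have h4 : ‖x‖⁻¹ ≤ 1 := inv_le_one_of_one_le₀ hx
  rw [h1]
  refine (norm_add_le _ _).trans ?_
  rw [h2, norm_smul, norm_inv, norm_norm]
  nlinarith [norm_nonneg (x - y), abs_nonneg (‖y‖ - ‖x‖), inv_pos.2 hx0]

lemma hausdorffMeasure_cap_lt_top (m : ℕ) :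
    μH[m] {θ : Euc (m + 1) | ‖θ‖ = 1 ∧ 1 / 2 < θ 0} < ∞ := by
  let g : Euc m → Euc (m + 1) := fun y => ‖consE 1 y‖⁻¹ • consE 1 y
  have hone : ∀ y : Euc m, 1 ≤ ‖consE 1 y‖ := by
    intro y
    rw [← sq_le_sq₀ zero_le_one (norm_nonneg _), norm_consE_sq]
    nlinarith [sq_nonneg ‖y‖]
  have hg : LipschitzWith 2 g := by
    refine LipschitzWith.of_dist_le_mul fun y z => ?_
    rw [dist_eq_norm, dist_eq_norm]
    refine (norm_normalize_sub_le (hone y) (hone z)).trans (le_of_eq ?_)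
    have h1 : consE 1 y - consE 1 z = consE 0 (y - z) := by
      rw [sub_eq_iff_eq_add, consE_add]; simp
    have h2 : ‖consE 0 (y - z)‖ = ‖y - z‖ := by
      rw [← sq_eq_sq₀ (norm_nonneg _) (norm_nonneg _), norm_consE_sq]; simp
    rw [h1, h2]
    rfl
  have hsub : {θ : Euc (m + 1) | ‖θ‖ = 1 ∧ 1 / 2 < θ 0} ⊆ g '' closedBall 0 2 := by
    rintro θ ⟨h1, h2⟩
    have h0 : 0 < θ 0 := by linarith
    have hc : consE 1 ((θ 0)⁻¹ • tailE θ) = (θ 0)⁻¹ • θ := by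
      have h3 := smul_consE (θ 0)⁻¹ (θ 0) (tailE θ)
      rw [consE_tailE, inv_mul_cancel₀ h0.ne'] at h3
      exact h3.symm
    refine ⟨(θ 0)⁻¹ • tailE θ, ?_, ?_⟩
    · rw [mem_closedBall_zero_iff, norm_smul, norm_inv, Real.norm_eq_abs, abs_of_pos h0,
        inv_mul_le_iff₀ h0]
      have h3 := norm_consE_sq (θ 0) (tailE θ)
      rw [consE_tailE, h1] at h3
      nlinarith [norm_nonneg (tailE θ)]
    · simp only [g, hc, norm_smul, norm_inv, Real.norm_eq_abs, abs_of_pos h0, h1, mul_one, inv_inv]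
      rw [smul_smul, mul_inv_cancel₀ h0.ne', one_smul]
  refine (measure_mono hsub).trans_lt ((hg.hausdorffMeasure_image_le m.cast_nonneg _).trans_lt ?_)
  rw [hausdorffMeasure_eq_hausConst_mul]
  exact ENNReal.mul_lt_top (by simp) (ENNReal.mul_lt_top (hausConst_ne_top m).lt_top
    measure_closedBall_lt_top)

lemma hausdorffMeasure_sphere_lt_top (m : ℕ) : μH[m] (sphere (0 : Euc (m + 1)) 1) < ∞ := by
  have hcomp : IsCompact (sphere (0 : Euc (m + 1)) 1) := isCompact_sphere _ _
  refine hcomp.measure_lt_top_of_nhdsWithin fun x hx => ?_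
  rw [mem_sphere_zero_iff_norm] at hx
  have he : ‖(consE 1 0 : Euc (m + 1))‖ = 1 := by
    rw [← sq_eq_sq₀ (norm_nonneg _) zero_le_one, norm_consE_sq]; simp
  obtain ⟨U, hU⟩ := exists_linearIsometryEquiv_apply_eq (hx.trans he.symm)
  have hcont : Continuous fun y : Euc (m + 1) => U y 0 := by fun_prop
  refine ⟨sphere 0 1 ∩ {y | 1 / 2 < U y 0}, inter_mem_nhdsWithin _
    ((isOpen_lt continuous_const hcont).mem_nhds ?_), ?_⟩
  · simp only [mem_ofPred_eq, hU, consE_zero]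
    norm_num
  · have hset : sphere 0 1 ∩ {y | 1 / 2 < U y 0} =
        U.toIsometryEquiv ⁻¹' {θ : Euc (m + 1) | ‖θ‖ = 1 ∧ 1 / 2 < θ 0} := by
      ext y; simp
    rw [hset, IsometryEquiv.hausdorffMeasure_preimage]
    exact hausdorffMeasure_cap_lt_top m

lemma hausdorffMeasure_sphere_ne_zero (m : ℕ) : μH[m] (sphere (0 : Euc (m + 1)) 1) ≠ 0 := by
  have hl : LipschitzWith 1 (tailE : Euc (m + 1) → Euc m) := by
    refine LipschitzWith.of_dist_le_mul fun x y => ?_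
    rw [dist_eq_norm, dist_eq_norm, NNReal.coe_one, one_mul, ← sq_le_sq₀ (norm_nonneg _)
      (norm_nonneg _)]
    have h1 := norm_consE_sq ((x - y) 0) (tailE (x - y))
    rw [consE_tailE] at h1
    have h2 : tailE (x - y) = tailE x - tailE y := rfl
    rw [h1, h2]
    nlinarith [sq_nonneg ((x - y) 0)]
  have hsub : ball 0 1 ⊆ tailE '' sphere (0 : Euc (m + 1)) 1 := by
    intro y hy
    rw [mem_ball_zero_iff] at hy
    refine ⟨consE √(1 - ‖y‖ ^ 2) y, ?_, tailE_consE _ _⟩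
    rw [mem_sphere_zero_iff_norm, ← sq_eq_sq₀ (norm_nonneg _) zero_le_one, norm_consE_sq,
      Real.sq_sqrt (by nlinarith [norm_nonneg y])]
    ring
  intro h0
  have h1 := (measure_mono hsub).trans (hl.hausdorffMeasure_image_le m.cast_nonneg _)
  rw [h0, mul_zero, hausdorffMeasure_eq_hausConst_mul] at h1
  exact mul_ne_zero (hausConst_ne_zero m) (measure_ball_pos _ _ one_pos).ne' (le_zero_iff.1 h1)

/-! ### The distribution of central sections in graph coordinates -/

/-- Surface measure on the sphere is a multiple of the cone measure. -/
lemma exists_hausdorffMeasure_inter_sphere_eq (m : ℕ) :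
    ∃ κ : ℝ≥0∞, κ ≠ 0 ∧ κ ≠ ∞ ∧ ∀ A : Set (Euc (m + 1)), MeasurableSet A →
      μH[m] (A ∩ sphere 0 1) = κ * volume.restrict (ball 0 1) {x | ‖x‖⁻¹ • x ∈ A} := by
  let N : Euc (m + 1) → Euc (m + 1) := fun x => ‖x‖⁻¹ • x
  have hN : Measurable N := by fun_prop
  let μ : Measure (Euc (m + 1)) := μH[m].restrict (sphere 0 1)
  let ν : Measure (Euc (m + 1)) := (volume.restrict (ball 0 1)).map N
  have hb0 : volume (ball (0 : Euc (m + 1)) 1) ≠ 0 := (measure_ball_pos _ _ one_pos).ne'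
  have hbt : volume (ball (0 : Euc (m + 1)) 1) ≠ ∞ := measure_ball_lt_top.ne
  have : IsFiniteMeasure μ := ⟨by simpa [μ] using hausdorffMeasure_sphere_lt_top m⟩
  have : IsFiniteMeasure (volume.restrict (ball (0 : Euc (m + 1)) 1)) :=
    ⟨by simpa using hbt.lt_top⟩
  have : IsFiniteMeasure ν := Measure.isFiniteMeasure_map _ _
  have hμU : μ univ = μH[m] (sphere (0 : Euc (m + 1)) 1) := by simp [μ]
  have hνU : ν univ = volume (ball (0 : Euc (m + 1)) 1) := by
    simp [ν, Measure.map_apply hN MeasurableSet.univ]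
  have he : ‖(consE 1 0 : Euc (m + 1))‖ = 1 := by
    rw [← sq_eq_sq₀ (norm_nonneg _) zero_le_one, norm_consE_sq]; simp
  obtain ⟨c, hc⟩ := exists_eq_mul_of_rotation_invariant he
  have hμc := hc μ
    (fun U A hA => by
      rw [Measure.restrict_apply (U.continuous.measurable hA), Measure.restrict_apply hA]
      have : U ⁻¹' A ∩ sphere 0 1 = U.toIsometryEquiv ⁻¹' (A ∩ sphere 0 1) := by
        ext x; simp
      rw [this, IsometryEquiv.hausdorffMeasure_preimage])
    (by
      filter_upwards [ae_restrict_mem isClosed_sphere.measurableSet] with x hx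
      exact mem_sphere_zero_iff_norm.1 hx)
  have hνc := hc ν
    (fun U A hA => by
      have hU : MeasurePreserving U (volume.restrict (ball 0 1)) (volume.restrict (ball 0 1)) := by
        have := U.measurePreserving.restrict_preimage (s := ball 0 1) isOpen_ball.measurableSet
        rwa [LinearIsometryEquiv.preimage_ball, map_zero] at this
      rw [Measure.map_apply hN (U.continuous.measurable hA), Measure.map_apply hN hA,
        ← hU.measure_preimage (hN hA).nullMeasurableSet]
      congr 1
      ext x
      simp [N])
    (by
      refine (ae_map_iff hN.aemeasurable (measurableSet_eq_fun measurable_norm measurable_const)).2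
        (ae_restrict_of_ae ?_)
      have h0 : ∀ᵐ x : Euc (m + 1), x ≠ 0 := by simp [ae_iff]
      filter_upwards [h0] with x hx
      rw [norm_smul, norm_inv, norm_norm, inv_mul_cancel₀ (norm_ne_zero_iff.2 hx)])
  refine ⟨μ univ / ν univ, ?_, ?_, fun A hA => ?_⟩
  · rw [hμU, hνU]
    exact (ENNReal.div_pos (hausdorffMeasure_sphere_ne_zero m) hbt).ne'
  · rw [hνU]
    exact ENNReal.div_ne_top (measure_ne_top _ _) hb0
  · have h1 := hνc A hA
    rw [Measure.map_apply hN hA] at h1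
    change _ = _ * volume.restrict (ball 0 1) (N ⁻¹' A)
    rw [h1, ← Measure.restrict_apply hA, hμc A hA, mul_left_comm, ENNReal.div_mul_cancel]
    · rw [hνU]; exact hb0
    · exact measure_ne_top _ _

lemma measurable_graphSlope {m : ℕ} : Measurable (graphSlope : Euc (m + 1) → Euc m) :=
  ((by fun_prop : Measurable fun x : Euc (m + 1) => x 0).inv.neg).smul
    continuous_tailE.measurable

lemma measurable_graphArea {m : ℕ} {K : Set (Euc (m + 1))} (hK : MeasurableSet K) :
    Measurable (graphArea K) :=
  (((by fun_prop : Measurable fun w : Euc m => ENNReal.ofReal √(1 + ‖w‖ ^ 2))).mul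
    (measurable_volume_graphSec hK)).const_mul _

lemma graphArea_ne_top {m : ℕ} {K : Set (Euc (m + 1))} (hK : Bornology.IsBounded K) (w : Euc m) :
    graphArea K w ≠ ∞ :=
  ENNReal.mul_ne_top (hausConst_ne_top m)
    (ENNReal.mul_ne_top ENNReal.ofReal_ne_top (isBounded_graphSec hK w).measure_lt_top.ne)

lemma graphSlope_smul {m : ℕ} {c : ℝ} (hc : c ≠ 0) (x : Euc (m + 1)) :
    graphSlope (c • x) = graphSlope x := by
  have h : tailE (c • x) = c • tailE x := rfl
  rw [graphSlope, graphSlope, h, smul_smul, PiLp.smul_apply, smul_eq_mul]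
  congr 1
  rw [mul_inv]
  field_simp

lemma ae_coord_zero_ne {m : ℕ} : ∀ᵐ x : Euc (m + 1), x 0 ≠ 0 := by
  rw [ae_iff]
  simp only [not_not]
  have hm : MeasurableSet {x : Euc (m + 1) | x 0 = 0} :=
    (isClosed_eq (by fun_prop) continuous_const).measurableSet
  rw [volume_consE hm]
  simp

/-- The distribution function of the areas of central sections in terms of cone measure. -/
lemma exists_Sdist_eq (m : ℕ) :
    ∃ κ : ℝ≥0∞, κ ≠ 0 ∧ κ ≠ ∞ ∧ ∀ K : Set (Euc (m + 1)), MeasurableSet K → ∀ t : ℝ,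
      Sdist (m + 1) K t =
        κ * volume.restrict (ball 0 1) {x | ENNReal.ofReal t ≤ graphArea K (graphSlope x)} := by
  obtain ⟨κ, hκ0, hκt, hκ⟩ := exists_hausdorffMeasure_inter_sphere_eq m
  refine ⟨κ / μH[m] (sphere (0 : Euc (m + 1)) 1),
    (ENNReal.div_pos hκ0 (hausdorffMeasure_sphere_lt_top m).ne).ne',
    ENNReal.div_ne_top hκt (hausdorffMeasure_sphere_ne_zero m), fun K hK t => ?_⟩
  let A : Set (Euc (m + 1)) :=
    {θ | θ 0 ≠ 0} ∩ {θ | ENNReal.ofReal t ≤ graphArea K (graphSlope θ)}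
  have hZ : MeasurableSet {θ : Euc (m + 1) | θ 0 = 0} :=
    (isClosed_eq (by fun_prop) continuous_const).measurableSet
  have hA : MeasurableSet A := hZ.compl.inter
    (measurableSet_le measurable_const ((measurable_graphArea hK).comp measurable_graphSlope))
  have hcoord : ∀ x : Euc (m + 1), x 0 ≠ 0 → ‖x‖⁻¹ ≠ 0 := fun x hx =>
    inv_ne_zero (norm_ne_zero_iff.2 fun h => hx (by rw [h]; rfl))
  have hZ0 : μH[m] ({θ : Euc (m + 1) | θ 0 = 0} ∩ sphere 0 1) = 0 := by
    rw [hκ _ hZ]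
    refine mul_eq_zero.2 (Or.inr ?_)
    have h1 : ∀ᵐ x ∂volume.restrict (ball (0 : Euc (m + 1)) 1),
        x ∉ {x : Euc (m + 1) | ‖x‖⁻¹ • x ∈ {θ : Euc (m + 1) | θ 0 = 0}} := by
      filter_upwards [ae_restrict_of_ae ae_coord_zero_ne] with x hx
      have hx0 : x ≠ 0 := fun h => hx (by rw [h]; rfl)
      simpa [hx] using hx0
    exact measure_eq_zero_iff_ae_notMem.2 h1
  have h1 : μH[m] ({θ | ENNReal.ofReal t ≤ sectionVol (m + 1) K θ} ∩ sphere 0 1) =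
      μH[m] (A ∩ sphere 0 1) := by
    refine le_antisymm ?_ (measure_mono ?_)
    · calc _ ≤ μH[m] (A ∩ sphere 0 1 ∪ {θ : Euc (m + 1) | θ 0 = 0} ∩ sphere 0 1) := by
            refine measure_mono ?_
            rintro θ ⟨h2, h3⟩
            by_cases h0 : θ 0 = 0
            · exact Or.inr ⟨h0, h3⟩
            · refine Or.inl ⟨⟨h0, ?_⟩, h3⟩
              rw [mem_ofPred_eq, sectionVol_eq_graphArea K h0] at h2
              exact h2
        _ ≤ _ := (measure_union_le _ _).trans (by rw [hZ0, add_zero])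
    · rintro θ ⟨⟨h0, h2⟩, h3⟩
      refine ⟨?_, h3⟩
      rw [mem_ofPred_eq, sectionVol_eq_graphArea K h0]
      exact h2
  have h2 : volume.restrict (ball (0 : Euc (m + 1)) 1) {x | ‖x‖⁻¹ • x ∈ A} =
      volume.restrict (ball 0 1) {x | ENNReal.ofReal t ≤ graphArea K (graphSlope x)} := by
    refine measure_congr ?_
    filter_upwards [ae_restrict_of_ae ae_coord_zero_ne] with x hx
    have h3 : ‖x‖⁻¹ • x ∈ A ↔ ENNReal.ofReal t ≤ graphArea K (graphSlope x) := by
      simp only [A, mem_inter_iff, mem_ofPred_eq, graphSlope_smul (hcoord x hx)]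
      refine and_iff_right ?_
      rw [PiLp.smul_apply, smul_eq_mul]
      exact mul_ne_zero (hcoord x hx) hx
    exact propext h3
  have h3 : ((m + 1 : ℕ) : ℝ) - 1 = m := by push_cast; ring
  rw [Sdist, sphHaar, h3, h1, hκ A hA, h2, ENNReal.mul_div_right_comm]

lemma lintegral_eq_mul_lintegral_comp_smul {V : Type*} [NormedAddCommGroup V] [NormedSpace ℝ V]
    [FiniteDimensional ℝ V] [MeasurableSpace V] [BorelSpace V] (μ : Measure V)
    [μ.IsAddHaarMeasure] {f : V → ℝ≥0∞} (hf : Measurable f) {r : ℝ} (hr : r ≠ 0) :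
    ∫⁻ x, f x ∂μ = ENNReal.ofReal |r| ^ Module.finrank ℝ V * ∫⁻ x, f (r • x) ∂μ := by
  rw [← lintegral_map hf (measurable_const_smul r), Measure.map_addHaar_smul μ hr,
    lintegral_smul_measure, smul_eq_mul, ← mul_assoc,
    ← ENNReal.ofReal_pow (abs_nonneg r), ← abs_pow, ← ENNReal.ofReal_mul (abs_nonneg _),
    ← abs_mul, mul_inv_cancel₀ (pow_ne_zero _ hr), abs_one, ENNReal.ofReal_one, one_mul]

/-- Integration over the unit ball of a function of the slope. -/
lemma exists_lintegral_ball_graphSlope (m : ℕ) :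
    ∃ C : ℝ≥0∞, C ≠ 0 ∧ C ≠ ∞ ∧ ∀ F : Euc m → ℝ≥0∞, Measurable F →
      ∫⁻ x in ball 0 1, F (graphSlope x) =
        C * ∫⁻ w, F w / ENNReal.ofReal √(1 + ‖w‖ ^ 2) ^ (m + 1) := by
  let J : ℝ → ℝ≥0∞ := (ball (0 : ℝ) 1).indicator fun s => ENNReal.ofReal |s| ^ m
  have hJ : Measurable J :=
    (by fun_prop : Measurable fun s : ℝ => ENNReal.ofReal |s| ^ m).indicator
      isOpen_ball.measurableSet
  refine ⟨∫⁻ s, J s, fun h0 => ?_, ?_, fun F hF => ?_⟩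
  · rw [lintegral_eq_zero_iff hJ] at h0
    have h1 : ∀ᵐ s : ℝ, s ≠ 0 := by simp [ae_iff]
    refine (measure_ball_pos volume (0 : ℝ) one_pos).ne' (measure_eq_zero_iff_ae_notMem.2 ?_)
    filter_upwards [h0, h1] with s hs hs0 hsb
    simp only [J, indicator_of_mem hsb, Pi.zero_apply] at hs
    have h2 := eq_zero_of_pow_eq_zero hs
    rw [ENNReal.ofReal_eq_zero] at h2
    exact hs0 (abs_nonpos_iff.1 h2)
  · refine ne_top_of_le_ne_top (measure_ball_lt_top (μ := volume) (x := (0 : ℝ)) (r := 1)).ne ?_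
    rw [← lintegral_indicator_one isOpen_ball.measurableSet]
    refine lintegral_mono fun s => indicator_le_indicator' fun hs => ?_
    refine pow_le_one₀ zero_le ?_
    rw [ENNReal.ofReal_le_one]
    simpa using (mem_ball_zero_iff.1 hs).le
  let r : Euc m → ℝ := fun w => √(1 + ‖w‖ ^ 2)
  have hr : ∀ w, 0 < r w := fun w => Real.sqrt_pos.2 (by positivity)
  have hrm : Measurable r := by fun_prop
  have hr0 : ∀ w, ENNReal.ofReal (r w) ≠ 0 := fun w => (ENNReal.ofReal_pos.2 (hr w)).ne'
  let g : Euc (m + 1) → ℝ≥0∞ := (ball 0 1).indicator fun x => F (graphSlope x)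
  have hg : Measurable g :=
    (hF.comp measurable_graphSlope).indicator isOpen_ball.measurableSet
  have hslice : ∀ s : ℝ, s ≠ 0 → ∫⁻ y, g (consE s y) =
      ∫⁻ w, F w / ENNReal.ofReal (r w) ^ m * J (r w * s) := by
    intro s hs
    have hgs : Measurable fun y : Euc m => g (consE s y) :=
      hg.comp (continuous_consE.comp (Continuous.prodMk_right s)).measurable
    rw [lintegral_eq_mul_lintegral_comp_smul volume hgs (neg_ne_zero.2 hs), abs_neg,
      finrank_euclideanSpace_fin,
      ← lintegral_const_mul (μ := volume) (f := fun w => g (consE s (-s • w))) _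
        (hgs.comp (measurable_const_smul (-s)))]
    refine lintegral_congr fun w => ?_
    have h1 : consE s (-s • w) ∈ ball 0 1 ↔ r w * s ∈ ball (0 : ℝ) 1 := by
      rw [mem_ball_zero_iff, mem_ball_zero_iff, ← sq_lt_sq₀ (norm_nonneg _) zero_le_one,
        ← sq_lt_sq₀ (norm_nonneg (r w * s)) zero_le_one, norm_consE_sq, norm_smul,
        norm_mul, mul_pow, mul_pow, Real.norm_eq_abs, Real.norm_eq_abs, Real.norm_eq_abs,
        sq_abs, sq_abs, sq_abs, Real.sq_sqrt (by positivity)]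
      ring_nf
    have h2 : graphSlope (consE s (-s • w)) = w := by
      rw [graphSlope, consE_zero, tailE_consE, smul_smul, neg_mul_neg, inv_mul_cancel₀ hs, one_smul]
    by_cases h3 : r w * s ∈ ball (0 : ℝ) 1
    · simp only [g, J, indicator_of_mem h3, indicator_of_mem (h1.2 h3), h2]
      rw [abs_mul, abs_of_pos (hr w), ENNReal.ofReal_mul (hr w).le, mul_pow, ← mul_assoc,
        ENNReal.div_mul_cancel (pow_ne_zero _ (hr0 w)) (ENNReal.pow_ne_top ENNReal.ofReal_ne_top),
        mul_comm]
    · simp only [g, J, indicator_of_notMem h3, indicator_of_notMem (mt h1.1 h3), mul_zero]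
  have hmul : Measurable fun p : ℝ × Euc m => r p.2 * p.1 :=
    (hrm.comp measurable_snd).mul measurable_fst
  have hquot : Measurable fun w : Euc m => F w / ENNReal.ofReal (r w) ^ m :=
    hF.div (hrm.ennreal_ofReal.pow_const m)
  have hs0 : ∀ᵐ s : ℝ, s ≠ 0 := by simp [ae_iff]
  calc ∫⁻ x in ball 0 1, F (graphSlope x) = ∫⁻ x, g x :=
        (lintegral_indicator isOpen_ball.measurableSet _).symm
    _ = ∫⁻ s, ∫⁻ y, g (consE s y) := by
        rw [lintegral_consE hg]
        exact lintegral_lintegral_swap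
          (hg.comp (continuous_consE.measurable.comp measurable_swap)).aemeasurable
    _ = ∫⁻ s, ∫⁻ w, F w / ENNReal.ofReal (r w) ^ m * J (r w * s) :=
        lintegral_congr_ae (hs0.mono hslice)
    _ = ∫⁻ w, ∫⁻ s, F w / ENNReal.ofReal (r w) ^ m * J (r w * s) :=
        lintegral_lintegral_swap
          ((hquot.comp measurable_snd).mul (hJ.comp hmul)).aemeasurable
    _ = ∫⁻ w, (∫⁻ s, J s) * (F w / ENNReal.ofReal (r w) ^ (m + 1)) := by
        refine lintegral_congr fun w => ?_
        rw [lintegral_const_mul (f := fun s => J (r w * s)) _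
            (hJ.comp (measurable_const_mul (r w))),
          lintegral_eq_mul_lintegral_comp_smul volume hJ (hr w).ne', abs_of_pos (hr w),
          Module.finrank_self, pow_one, pow_succ, ENNReal.div_eq_inv_mul, ENNReal.div_eq_inv_mul,
          ENNReal.mul_inv (Or.inr ENNReal.ofReal_ne_top) (Or.inr (hr0 w))]
        simp only [smul_eq_mul]
        calc _ = (ENNReal.ofReal (r w) * (ENNReal.ofReal (r w))⁻¹) *
              ((ENNReal.ofReal (r w) ^ m)⁻¹ * F w * ∫⁻ s, J (r w * s)) := by
              rw [ENNReal.mul_inv_cancel (hr0 w) ENNReal.ofReal_ne_top, one_mul]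
          _ = _ := by ring
    _ = _ := lintegral_const_mul _ (hF.div (hrm.ennreal_ofReal.pow_const _))

/-- Domination of section area distributions passes to power integrals. -/
lemma lintegral_volume_graphSec_pow_le_of_Sdist_le {m : ℕ} {E K : Set (Euc (m + 1))}
    (hE : IsCompact E) (hK : IsCompact K)
    (h : ∀ t : ℝ, 0 ≤ t → Sdist (m + 1) E t ≤ Sdist (m + 1) K t) :
    ∫⁻ w, volume (graphSec E w) ^ (m + 1) ≤ ∫⁻ w, volume (graphSec K w) ^ (m + 1) := by
  obtain ⟨κ, hκ0, hκt, hκ⟩ := exists_Sdist_eq m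
  obtain ⟨C, hC0, hCt, hC⟩ := exists_lintegral_ball_graphSlope m
  let μ : Measure (Euc (m + 1)) := volume.restrict (ball 0 1)
  have hcake : ∀ L : Set (Euc (m + 1)), IsCompact L →
      ∫⁻ x in ball 0 1, graphArea L (graphSlope x) ^ (m + 1) =
        ENNReal.ofReal ((m + 1 : ℕ) : ℝ) *
          ∫⁻ t in Ioi 0, μ {x | ENNReal.ofReal t ≤ graphArea L (graphSlope x)} *
            ENNReal.ofReal (t ^ (((m + 1 : ℕ) : ℝ) - 1)) := by
    intro L hL
    have hfin := graphArea_ne_top hL.isBounded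
    have h1 := lintegral_rpow_eq_lintegral_meas_le_mul μ
      (f := fun x => (graphArea L (graphSlope x)).toReal)
      (Filter.Eventually.of_forall fun x => ENNReal.toReal_nonneg)
      ((measurable_graphArea hL.measurableSet).comp
        measurable_graphSlope).ennreal_toReal.aemeasurable
      (p := ((m + 1 : ℕ) : ℝ)) (by positivity)
    rw [← lintegral_congr fun x => ?_, h1]
    · congr 1
      refine setLIntegral_congr_fun measurableSet_Ioi fun t _ => ?_
      simp only [ENNReal.ofReal_le_iff_le_toReal (hfin _)]
    · rw [Real.rpow_natCast, ENNReal.ofReal_pow ENNReal.toReal_nonneg,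
        ENNReal.ofReal_toReal (hfin _)]
  have hint : ∀ L : Set (Euc (m + 1)), IsCompact L →
      ∫⁻ x in ball 0 1, graphArea L (graphSlope x) ^ (m + 1) =
        C * (hausConst m ^ (m + 1) * ∫⁻ w, volume (graphSec L w) ^ (m + 1)) := by
    intro L hL
    rw [hC (fun w => graphArea L w ^ (m + 1))
      ((measurable_graphArea hL.measurableSet).pow_const _),
      ← lintegral_const_mul _ ((measurable_volume_graphSec hL.measurableSet).pow_const _)]
    congr 1
    refine lintegral_congr fun w => ?_
    have hr : ENNReal.ofReal √(1 + ‖w‖ ^ 2) ≠ 0 :=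
      (ENNReal.ofReal_pos.2 (Real.sqrt_pos.2 (by positivity))).ne'
    rw [graphArea, mul_pow, mul_pow, mul_left_comm, mul_comm,
      ENNReal.mul_div_cancel_right (pow_ne_zero _ hr) (ENNReal.pow_ne_top ENNReal.ofReal_ne_top)]
  have hle : ∫⁻ x in ball 0 1, graphArea E (graphSlope x) ^ (m + 1) ≤
      ∫⁻ x in ball 0 1, graphArea K (graphSlope x) ^ (m + 1) := by
    rw [hcake E hE, hcake K hK]
    refine mul_le_mul_right ?_ _
    refine setLIntegral_mono' measurableSet_Ioi fun t ht => ?_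
    refine mul_le_mul_left ?_ _
    have h1 := h t (mem_Ioi.1 ht).le
    rwa [hκ E hE.measurableSet, hκ K hK.measurableSet, ENNReal.mul_le_mul_iff_right hκ0 hκt] at h1
  rw [hint E hE, hint K hK, ENNReal.mul_le_mul_iff_right hC0 hCt,
    ENNReal.mul_le_mul_iff_right (pow_ne_zero _ (hausConst_ne_zero m))
      (ENNReal.pow_ne_top (hausConst_ne_top m))] at hle
  exact hle

/-- If a centered ellipsoid `E = T(B₂ⁿ)` and a convex body `K` (with the
origin in its interior) satisfy `S_E(t) ≤ S_K(t)` for all `t ≥ 0`, then `|E| ≤ |K|`. -/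
theorem stmt_14 (n : ℕ) (hn : 2 ≤ n) (K : Set (Euc n)) (hK : IsConvexBody K)
    (hK0 : (0 : Euc n) ∈ interior K)
    (T : Euc n ≃ₗ[ℝ] Euc n) (E : Set (Euc n))
    (hE : E = (T : Euc n → Euc n) '' closedBall (0 : Euc n) 1)
    (h : ∀ t : ℝ, 0 ≤ t → Sdist n E t ≤ Sdist n K t) :
    volume E ≤ volume K := by
  obtain ⟨k, rfl⟩ : ∃ k, n = k + 1 + 1 := ⟨n - 2, by omega⟩
  obtain ⟨hKc, hKk, -⟩ := hK
  have hEk : IsCompact E := by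
    rw [hE]
    exact (isCompact_closedBall _ _).image T.toContinuousLinearEquiv.continuous
  have h1 := volume_ellipsoid_pow T
  rw [← hE] at h1
  have h2 := lintegral_volume_graphSec_pow_le_of_Sdist_le hEk hKk h
  have h3 := lintegral_volume_graphSec_pow_le hKc hKk
  refine (ENNReal.pow_le_pow_left_iff k.succ_ne_zero).1 ?_
  exact h1.trans ((mul_le_mul_right h2 _).trans h3)
end
end

section
/- Let n ≥ 2, let K be a convex body in R^n, and let E = T(B₂ⁿ) be a centered ellipsoid in R^n (the image of the Euclidean unit ball under an invertible linear map T). If Π_K(t) ≤ Π_E(t) for all t ≥ 0, then |K| ≤ |E|. -/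
open MeasureTheory Metric Set
open scoped RealInnerProductSpace ENNReal NNReal

noncomputable section

section Petty

open Filter TopologicalSpace
open scoped Pointwise Topology

set_option linter.unusedSectionVars false

variable {V : Type*} [NormedAddCommGroup V] [InnerProductSpace ℝ V]

/-- The parameters of the points of `A` on the line through `z` with direction `u`. -/
def lineSection (A : Set V) (u z : V) : Set ℝ := {t | z + t • u ∈ A}

lemma lineSection_isCompact {A : Set V} (hA : IsCompact A) {u : V} (hu : ‖u‖ = 1) (z : V) :
    IsCompact (lineSection A u z) := by
  have : Topology.IsClosedEmbedding fun t : ℝ => z + t • u := by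
    refine Isometry.isClosedEmbedding ?_
    refine Isometry.of_dist_eq fun s t => ?_
    rw [dist_add_left, dist_eq_norm, ← sub_smul, norm_smul, hu, mul_one, Real.dist_eq, Real.norm_eq_abs]
  exact this.isCompact_preimage hA

lemma lineSection_convex {A : Set V} (hA : Convex ℝ A) (u z : V) :
    Convex ℝ (lineSection A u z) := by
  intro s hs t ht a b ha hb hab
  have := hA hs ht ha hb hab
  simp only [lineSection, mem_ofPred_eq] at *
  convert this using 1
  rw [smul_add, smul_add, add_add_add_comm, ← add_smul, hab, one_smul]
  module

section Real

lemma IsCompact.exists_eq_Icc {X : Set ℝ} (hX : IsCompact X) (hc : Convex ℝ X) (hne : X.Nonempty) :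
    ∃ a b, a ≤ b ∧ X = Icc a b := by
  have := eq_Icc_of_connected_compact ⟨hne, hc.isPreconnected⟩ hX
  refine ⟨_, _, ?_, this⟩
  rw [this] at hne
  exact nonempty_Icc.1 hne

lemma volume_half_smul_sub {X Y : Set ℝ} (hX : IsCompact X) (hXc : Convex ℝ X) (hXne : X.Nonempty)
    (hY : IsCompact Y) (hYc : Convex ℝ Y) (hYne : Y.Nonempty) :
    volume ((2⁻¹ : ℝ) • (X - Y)) = 2⁻¹ * (volume X + volume Y) := by
  obtain ⟨a, b, hab, rfl⟩ := hX.exists_eq_Icc hXc hXne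
  obtain ⟨c, d, hcd, rfl⟩ := hY.exists_eq_Icc hYc hYne
  have : Icc a b - Icc c d = Icc (a - d) (b - c) := by
    rw [sub_eq_add_neg, neg_Icc, Icc_add_Icc hab (by linarith)]
    rfl
  rw [this, Measure.addHaar_smul, Real.volume_Icc, Real.volume_Icc, Real.volume_Icc,
    ← ENNReal.ofReal_add (by linarith) (by linarith)]
  simp only [Module.finrank_self, pow_one]
  rw [abs_of_pos (by norm_num), ENNReal.ofReal_inv_of_pos (by norm_num), ENNReal.ofReal_ofNat]
  congr 2
  ring

lemma volume_le_volume_half_smul_sub_self {X : Set ℝ} (hX : IsCompact X) :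
    volume X ≤ volume ((2⁻¹ : ℝ) • (X - X)) := by
  rcases X.eq_empty_or_nonempty with rfl | hne
  · simp
  obtain ⟨M, hM⟩ := hX.exists_isGreatest hne
  obtain ⟨m, hm⟩ := hX.exists_isLeast hne
  have h1 : volume X + volume X ≤ volume (X - X) := by
    have e1 : volume ((fun x => x - M) '' X) = volume X := by
      simp [sub_eq_add_neg]
    have e2 : volume ((fun x => x - m) '' X) = volume X := by
      simp [sub_eq_add_neg]
    have hd : AEDisjoint volume ((fun x => x - M) '' X) ((fun x => x - m) '' X) := by
      refine measure_mono_null (t := {0}) ?_ (by simp)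
      rintro _ ⟨⟨x, hx, rfl⟩, ⟨y, hy, h⟩⟩
      have := hM.2 hx
      have := hm.2 hy
      simp only [mem_singleton_iff] at *
      linarith
    calc volume X + volume X
        = volume ((fun x => x - M) '' X ∪ (fun x => x - m) '' X) := by
          rw [measure_union₀ _ hd, e1, e2]
          exact (hX.image (by fun_prop)).measurableSet.nullMeasurableSet
      _ ≤ _ := by
          refine measure_mono (union_subset ?_ ?_)
          · rintro _ ⟨x, hx, rfl⟩; exact sub_mem_sub hx hM.1
          · rintro _ ⟨x, hx, rfl⟩; exact sub_mem_sub hx hm.1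
  rw [Measure.addHaar_smul]
  simp only [Module.finrank_self, pow_one]
  rw [abs_of_pos (by norm_num), ENNReal.ofReal_inv_of_pos (by norm_num), ENNReal.ofReal_ofNat,
    ← ENNReal.div_eq_inv_mul, ENNReal.le_div_iff_mul_le (by simp) (by simp), mul_two]
  exact h1

end Real

section Steiner

/-- The set of midpoints of `x` and the mirror image of `y` in the hyperplane `uᗮ`, where
`x ∈ A` and `y ∈ B` lie on a common line with direction `u`. For a convex body `A = B` this is the
Steiner symmetral. -/
def steinerComb (u : V) (A B : Set V) : Set V :=
  (fun p : V × V => (2⁻¹ : ℝ) • (p.1 + (ℝ ∙ u)ᗮ.reflection p.2)) ''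
    ((A ×ˢ B) ∩ {p | p.1 - p.2 ∈ ℝ ∙ u})

lemma steinerComb_isCompact (u : V) {A B : Set V} (hA : IsCompact A) (hB : IsCompact B) :
    IsCompact (steinerComb u A B) := by
  refine IsCompact.image ((hA.prod hB).inter_right ?_) (by fun_prop)
  exact (Submodule.closed_of_finiteDimensional (ℝ ∙ u)).preimage
    (continuous_fst.sub continuous_snd)

lemma steinerComb_convex (u : V) {A B : Set V} (hA : Convex ℝ A) (hB : Convex ℝ B) :
    Convex ℝ (steinerComb u A B) := by
  let f : V × V →ₗ[ℝ] V := (2⁻¹ : ℝ) • (LinearMap.fst ℝ V V +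
    (ℝ ∙ u)ᗮ.reflection.toLinearEquiv.toLinearMap ∘ₗ LinearMap.snd ℝ V V)
  have : steinerComb u A B = f '' ((A ×ˢ B) ∩
      ((ℝ ∙ u).comap (LinearMap.fst ℝ V V - LinearMap.snd ℝ V V) : Set (V × V))) := rfl
  rw [this]
  exact Convex.linear_image ((hA.prod hB).inter (Submodule.convex _)) f

lemma reflection_orthogonal_span_singleton_self (u : V) : (ℝ ∙ u)ᗮ.reflection u = -u :=
  Submodule.reflection_orthogonalComplement_singleton_eq_neg u

lemma lineSection_steinerComb {u : V} (hu : ‖u‖ = 1) (A B : Set V) {z : V} (hz : z ∈ (ℝ ∙ u)ᗮ) :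
    lineSection (steinerComb u A B) u z =
      (2⁻¹ : ℝ) • (lineSection A u z - lineSection B u z) := by
  have hR : ∀ t : ℝ, (ℝ ∙ u)ᗮ.reflection (z + t • u) = z - t • u := fun t => by
    rw [map_add, map_smul, reflection_orthogonal_span_singleton_self,
      Submodule.reflection_mem_subspace_eq_self hz]
    module
  have huu : ⟪u, u⟫ = 1 := by rw [real_inner_self_eq_norm_sq, hu, one_pow]
  have hzu : ⟪u, z⟫ = 0 := Submodule.mem_orthogonal_singleton_iff_inner_right.1 hz
  ext t
  constructor
  · rintro ⟨⟨x, y⟩, ⟨⟨hx, hy⟩, hxy⟩, h⟩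
    obtain ⟨c, hc⟩ := Submodule.mem_span_singleton.1 hxy
    simp only at hc h hx hy
    have hx' : x = y + c • u := by rw [hc]; abel
    subst hx'
    set s := ⟪u, y⟫ with hs
    have hw : y - s • u ∈ (ℝ ∙ u)ᗮ := by
      rw [Submodule.mem_orthogonal_singleton_iff_inner_right, inner_sub_right, inner_smul_right, huu]
      simp [hs]
    have hRy : (ℝ ∙ u)ᗮ.reflection y = y - (2 * s) • u := by
      have : y = (y - s • u) + s • u := by abel
      conv_lhs => rw [this, map_add, map_smul, reflection_orthogonal_span_singleton_self,
        Submodule.reflection_mem_subspace_eq_self hw]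
      module
    rw [hRy] at h
    have h2 := congrArg (fun v => ⟪u, v⟫) h
    simp only [inner_add_right, inner_sub_right, inner_smul_right, huu, hzu, ← hs] at h2
    have ht : t = c / 2 := by linarith
    have hy' : y = z + s • u := by
      have : y = (2⁻¹ : ℝ) • (y + c • u + (y - (2 * s) • u)) + (s - c / 2) • u := by module
      rw [this, h, ht]; module
    refine ⟨(s + c) - s, sub_mem_sub (a := s + c) (b := s) ?_ ?_, ?_⟩
    · simp only [lineSection, mem_ofPred_eq]
      convert hx using 1
      rw [hy']; module
    · simp only [lineSection, mem_ofPred_eq]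
      rwa [← hy']
    · simp [ht]; ring
  · rintro ⟨_, ⟨a, ha, b, hb, rfl⟩, rfl⟩
    refine ⟨(z + a • u, z + b • u), ⟨⟨ha, hb⟩, ?_⟩, ?_⟩
    · simp only [mem_ofPred_eq]
      refine Submodule.mem_span_singleton.2 ⟨a - b, by module⟩
    · simp only [hR, smul_eq_mul]
      module

/-- The orthogonal projection of `A` to the hyperplane `uᗮ`. -/
def shadow (A : Set V) (u : V) : Set (ℝ ∙ u)ᗮ := (ℝ ∙ u)ᗮ.orthogonalProjectionOnto '' A

lemma lineSection_nonempty_iff (A : Set V) (u : V) (z : (ℝ ∙ u)ᗮ) :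
    (lineSection A u (z : V)).Nonempty ↔ z ∈ shadow A u := by
  constructor
  · rintro ⟨t, ht⟩
    refine ⟨_, ht, ?_⟩
    rw [map_add, map_smul, Submodule.orthogonalProjectionOnto_mem_subspace_eq_self]
    simp
  · rintro ⟨x, hx, rfl⟩
    have h := (ℝ ∙ u).starProjection_add_starProjection_orthogonal x
    obtain ⟨c, hc⟩ := Submodule.mem_span_singleton.1 ((ℝ ∙ u).starProjection_apply_mem x)
    refine ⟨c, ?_⟩
    simp only [lineSection, mem_ofPred_eq, hc]
    rw [add_comm]
    convert hx using 1
    exact h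

lemma shadow_isCompact {A : Set V} (hA : IsCompact A) (u : V) : IsCompact (shadow A u) :=
  hA.image (by fun_prop)

lemma lineSection_add_segment {u : V} (A : Set V) {r : ℝ} (hr : 0 ≤ r) (z : V) :
    lineSection (A + segment ℝ 0 (r • u)) u z = lineSection A u z + Icc 0 r := by
  ext t
  constructor
  · rintro ⟨a, ha, b, hb, h⟩
    rw [segment_eq_image] at hb
    obtain ⟨s, hs, rfl⟩ := hb
    refine ⟨t - s * r, ?_, s * r, ⟨mul_nonneg hs.1 hr, mul_le_of_le_one_left hr hs.2⟩, by simp⟩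
    simp only [lineSection, mem_ofPred_eq]
    convert ha using 1
    simp only at h
    rw [sub_smul, ← add_sub_assoc, ← h]
    module
  · rintro ⟨s, hs, c, hc, rfl⟩
    refine ⟨_, hs, c • u, ?_, by simp only; module⟩
    rw [segment_eq_image]
    rcases hr.eq_or_lt with rfl | hr
    · exact ⟨0, by simp, by simp [le_antisymm hc.2 hc.1]⟩
    · refine ⟨c / r, ⟨div_nonneg hc.1 hr.le, div_le_one_of_le₀ hc.2 hr.le⟩, ?_⟩
      simp only [smul_zero, zero_add, smul_smul]
      rw [div_mul_cancel₀ _ hr.ne']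

lemma isCompact_segment (x y : V) : IsCompact (segment ℝ x y) := by
  rw [segment_eq_image_lineMap]
  exact isCompact_Icc.image AffineMap.lineMap_continuous

variable [FiniteDimensional ℝ V] [MeasurableSpace V] [BorelSpace V]

lemma volume_slice_eq_volume_lineSection {u : V} (hu : ‖u‖ = 1) {A : Set V} (hA : MeasurableSet A)
    (z : (ℝ ∙ u)ᗮ) :
    volume ((fun x => (x, z)) ⁻¹' (((ℝ ∙ u).measurableEquivProd (0 : V)).symm ⁻¹' A)) =
      volume (lineSection A u (z : V)) := by
  rw [← (LinearIsometryEquiv.toSpanUnitSingleton (𝕜 := ℝ) u hu).measurePreserving.measure_preimage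
    (((MeasurableEquiv.measurable _) hA).preimage (by fun_prop)).nullMeasurableSet]
  congr 1
  ext t
  simp [lineSection, add_comm]

lemma volume_eq_lintegral_lineSection {u : V} (hu : ‖u‖ = 1) {A : Set V} (hA : MeasurableSet A) :
    volume A = ∫⁻ z : (ℝ ∙ u)ᗮ, volume (lineSection A u (z : V)) := by
  have h1 := (ℝ ∙ u).measurePreserving_measurableEquivProd (0 : V)
  rw [InnerProductSpace.euclideanHausdorffMeasure_eq_volume] at h1
  rw [← h1.symm.measure_preimage hA.nullMeasurableSet, Measure.volume_eq_prod,
    Measure.prod_apply_symm ((MeasurableEquiv.measurable _) hA)]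
  exact lintegral_congr fun z => volume_slice_eq_volume_lineSection hu hA z

lemma measurable_volume_lineSection {u : V} (hu : ‖u‖ = 1) {A : Set V} (hA : MeasurableSet A) :
    Measurable fun z : (ℝ ∙ u)ᗮ => volume (lineSection A u (z : V)) := by
  simp_rw [← volume_slice_eq_volume_lineSection hu hA]
  exact measurable_measure_prodMk_right ((MeasurableEquiv.measurable _) hA)

lemma volume_steinerComb_le {u : V} (hu : ‖u‖ = 1) {A B : Set V}
    (hA : IsCompact A) (hAc : Convex ℝ A) (hB : IsCompact B) (hBc : Convex ℝ B) :
    volume (steinerComb u A B) ≤ 2⁻¹ * (volume A + volume B) := by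
  rw [volume_eq_lintegral_lineSection hu (steinerComb_isCompact u hA hB).measurableSet,
    volume_eq_lintegral_lineSection hu hA.measurableSet,
    volume_eq_lintegral_lineSection hu hB.measurableSet]
  refine (lintegral_mono (g := fun z : (ℝ ∙ u)ᗮ => 2⁻¹ * (volume (lineSection A u (z : V)) +
    volume (lineSection B u (z : V)))) fun z => ?_).trans ?_
  · simp only [lineSection_steinerComb hu A B z.2]
    rcases (lineSection A u (z : V)).eq_empty_or_nonempty with h | h
    · simp [h]
    rcases (lineSection B u (z : V)).eq_empty_or_nonempty with h' | h'
    · simp [h']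
    exact (volume_half_smul_sub (lineSection_isCompact hA hu _) (lineSection_convex hAc u _) h
      (lineSection_isCompact hB hu _) (lineSection_convex hBc u _) h').le
  · rw [lintegral_const_mul' _ _ (by simp)]
    rw [lintegral_add_left (measurable_volume_lineSection hu hA.measurableSet)]

lemma volume_le_volume_steinerComb_self {u : V} (hu : ‖u‖ = 1) {A : Set V} (hA : IsCompact A) :
    volume A ≤ volume (steinerComb u A A) := by
  rw [volume_eq_lintegral_lineSection hu (steinerComb_isCompact u hA hA).measurableSet,
    volume_eq_lintegral_lineSection hu hA.measurableSet]
  refine lintegral_mono fun z => ?_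
  rw [lineSection_steinerComb hu A A z.2]
  exact volume_le_volume_half_smul_sub_self (lineSection_isCompact hA hu _)

/-- The volume swept out by a convex body moving in a fixed direction. -/
lemma volume_add_segment {u : V} (hu : ‖u‖ = 1) {A : Set V} (hA : IsCompact A)
    (hAc : Convex ℝ A) {r : ℝ} (hr : 0 ≤ r) :
    volume (A + segment ℝ 0 (r • u)) = volume A + ENNReal.ofReal r * volume (shadow A u) := by
  rw [volume_eq_lintegral_lineSection hu (hA.add (isCompact_segment _ _)).measurableSet,
    volume_eq_lintegral_lineSection hu hA.measurableSet,
    ← lintegral_indicator_const (shadow_isCompact hA u).measurableSet,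
    ← lintegral_add_left (measurable_volume_lineSection hu hA.measurableSet)]
  refine lintegral_congr fun z => ?_
  rw [lineSection_add_segment A hr]
  by_cases hz : z ∈ shadow A u
  · obtain ⟨a, b, hab, h⟩ := (lineSection_isCompact hA hu (z : V)).exists_eq_Icc
      (lineSection_convex hAc u _) ((lineSection_nonempty_iff A u z).2 hz)
    rw [h, Icc_add_Icc hab hr, indicator_of_mem hz, Real.volume_Icc, Real.volume_Icc,
      ← ENNReal.ofReal_add (by linarith) hr]
    congr 1; ring
  · rw [indicator_of_notMem hz, not_nonempty_iff_eq_empty.1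
      (mt (lineSection_nonempty_iff A u z).1 hz)]
    simp

lemma volume_le_mul_volume_shadow {u : V} (hu : ‖u‖ = 1) {A : Set V} (hA : IsCompact A)
    {R : ℝ} (hAR : A ⊆ closedBall 0 R) :
    volume A ≤ ENNReal.ofReal (2 * R) * volume (shadow A u) := by
  rw [volume_eq_lintegral_lineSection hu hA.measurableSet,
    ← lintegral_indicator_const (shadow_isCompact hA u).measurableSet]
  refine lintegral_mono fun z => ?_
  by_cases hz : z ∈ shadow A u
  · rw [indicator_of_mem hz]
    have : lineSection A u z ⊆ Icc (-R) R := by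
      intro t ht
      have h1 := mem_closedBall_zero_iff.1 (hAR ht)
      have h2 : ⟪u, (z : V) + t • u⟫ = t := by
        rw [inner_add_right, inner_smul_right, real_inner_self_eq_norm_sq, hu,
          Submodule.mem_orthogonal_singleton_iff_inner_right.1 z.2]
        ring
      have h3 := abs_real_inner_le_norm u ((z : V) + t • u)
      rw [h2, hu, one_mul] at h3
      exact abs_le.1 (h3.trans h1)
    refine (measure_mono this).trans_eq ?_
    rw [Real.volume_Icc]
    congr 1; ring
  · rw [indicator_of_notMem hz, not_nonempty_iff_eq_empty.1
      (mt (lineSection_nonempty_iff A u z).1 hz)]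
    simp

end Steiner

section HausdorffTendsto

/-- Convergence of sets in the Hausdorff distance. -/
def HausdorffTendsto (K : ℕ → Set V) (L : Set V) : Prop :=
  ∀ ε > 0, ∀ᶠ i in atTop, K i ⊆ thickening ε L ∧ L ⊆ thickening ε (K i)

lemma HausdorffTendsto.refl (L : Set V) : HausdorffTendsto (fun _ => L) L := fun _ hε =>
  Eventually.of_forall fun _ => ⟨self_subset_thickening hε L, self_subset_thickening hε L⟩

lemma thickening_add_thickening_subset (δ ε : ℝ) (A B : Set V) :
    thickening δ A + thickening ε B ⊆ thickening (δ + ε) (A + B) := by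
  rintro _ ⟨x, hx, y, hy, rfl⟩
  obtain ⟨a, ha, hxa⟩ := mem_thickening_iff.1 hx
  obtain ⟨b, hb, hyb⟩ := mem_thickening_iff.1 hy
  exact mem_thickening_iff.2 ⟨a + b, add_mem_add ha hb,
    (dist_add_add_le _ _ _ _).trans_lt (add_lt_add hxa hyb)⟩

lemma HausdorffTendsto.add {K K' : ℕ → Set V} {L L' : Set V} (h : HausdorffTendsto K L)
    (h' : HausdorffTendsto K' L') : HausdorffTendsto (fun i => K i + K' i) (L + L') := by
  intro ε hε
  filter_upwards [h (ε / 2) (half_pos hε), h' (ε / 2) (half_pos hε)] with i hi hi'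
  have H := fun A B : Set V => thickening_add_thickening_subset (ε / 2) (ε / 2) A B
  simp_rw [add_halves] at H
  exact ⟨(add_subset_add hi.1 hi'.1).trans (H _ _), (add_subset_add hi.2 hi'.2).trans (H _ _)⟩

lemma hausdorffTendsto_segment {v : ℕ → V} {w : V} (h : Tendsto v atTop (𝓝 w)) :
    HausdorffTendsto (fun i => segment ℝ 0 (v i)) (segment ℝ 0 w) := by
  intro ε hε
  have key : ∀ x y : V, dist x y < ε → segment ℝ 0 x ⊆ thickening ε (segment ℝ 0 y) := by
    intro x y hxy z hz
    rw [segment_eq_image] at hz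
    obtain ⟨t, ht, rfl⟩ := hz
    refine mem_thickening_iff.2 ⟨t • y, ?_, ?_⟩
    · rw [segment_eq_image]
      exact ⟨t, ht, by simp⟩
    · simp only [smul_zero, zero_add]
      rw [dist_smul₀, Real.norm_eq_abs, abs_of_nonneg ht.1]
      exact (mul_le_of_le_one_left dist_nonneg ht.2).trans_lt hxy
  filter_upwards [h.eventually (ball_mem_nhds w hε)] with i hi
  exact ⟨key _ _ hi, key _ _ (by rwa [dist_comm])⟩

lemma hausdorffTendsto_of_tendsto {K : ℕ → NonemptyCompacts V} {L : NonemptyCompacts V}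
    (h : Tendsto K atTop (𝓝 L)) : HausdorffTendsto (fun i => (K i : Set V)) L := by
  intro ε hε
  filter_upwards [h.eventually (ball_mem_nhds L hε)] with i hi
  rw [NonemptyCompacts.dist_eq] at hi
  have hfin : hausdorffEDist (K i : Set V) L ≠ ⊤ :=
    hausdorffEDist_ne_top_of_nonempty_of_bounded (K i).nonempty L.nonempty
      (K i).isCompact.isBounded L.isCompact.isBounded
  refine ⟨fun x hx => ?_, fun x hx => ?_⟩
  · obtain ⟨y, hy, hxy⟩ := exists_dist_lt_of_hausdorffDist_lt hx hi hfin
    exact mem_thickening_iff.2 ⟨y, hy, hxy⟩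
  · rw [hausdorffDist_comm] at hi
    rw [hausdorffEDist_comm] at hfin
    obtain ⟨y, hy, hxy⟩ := exists_dist_lt_of_hausdorffDist_lt hx hi hfin
    exact mem_thickening_iff.2 ⟨y, hy, hxy⟩

lemma HausdorffTendsto.convex {K : ℕ → Set V} {L : Set V} (h : HausdorffTendsto K L)
    (hK : ∀ i, Convex ℝ (K i)) (hL : IsClosed L) : Convex ℝ L := by
  intro x hx y hy a b ha hb hab
  rw [← hL.closure_eq, closure_eq_iInter_thickening]
  refine mem_iInter₂.2 fun ε hε => ?_
  obtain ⟨i, hi⟩ := (h (ε / 2) (half_pos hε)).exists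
  have h1 := (hK i).thickening (ε / 2) (hi.2 hx) (hi.2 hy) ha hb hab
  have h2 := thickening_mono le_rfl _ h1
  have h3 := thickening_subset_of_subset (ε / 2) hi.1 h1
  have h4 := thickening_thickening_subset (ε / 2) (ε / 2) L h3
  rwa [add_halves] at h4

variable [FiniteDimensional ℝ V]

/-- Strict separation of a point from a nonempty closed convex set, with a unit normal. -/
lemma exists_norm_eq_one_forall_inner_lt {K : Set V} (hK : Convex ℝ K) (hKc : IsClosed K)
    (hne : K.Nonempty) {x : V} (hx : x ∉ K) :
    ∃ (u : V) (s : ℝ), ‖u‖ = 1 ∧ (∀ y ∈ K, ⟪u, y⟫ < s) ∧ s < ⟪u, x⟫ := by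
  have : CompleteSpace V := FiniteDimensional.complete ℝ V
  obtain ⟨f, s, hfs, hfx⟩ := geometric_hahn_banach_closed_point hK hKc hx
  obtain ⟨w, rfl⟩ := (InnerProductSpace.toDual ℝ V).surjective f
  simp only [InnerProductSpace.toDual_apply_apply] at hfs hfx
  have hw : w ≠ 0 := by
    rintro rfl
    obtain ⟨y, hy⟩ := hne
    have := hfs y hy
    simp only [inner_zero_left] at this hfx
    linarith
  have hw' : 0 < ‖w‖⁻¹ := inv_pos.2 (norm_pos_iff.2 hw)
  refine ⟨‖w‖⁻¹ • w, ‖w‖⁻¹ * s, norm_smul_inv_norm hw, fun y hy => ?_, ?_⟩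
  · rw [real_inner_smul_left]
    exact mul_lt_mul_of_pos_left (hfs y hy) hw'
  · rw [real_inner_smul_left]
    exact mul_lt_mul_of_pos_left hfx hw'

lemma HausdorffTendsto.eventually_mem_of_mem_interior {K : ℕ → Set V} {L : Set V}
    (h : HausdorffTendsto K L) (hK : ∀ i, Convex ℝ (K i)) (hKc : ∀ i, IsClosed (K i))
    {x : V} (hx : x ∈ interior L) : ∀ᶠ i in atTop, x ∈ K i := by
  obtain ⟨r, hr, hxr⟩ := nhds_basis_closedBall.mem_iff.1 (mem_interior_iff_mem_nhds.1 hx)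
  filter_upwards [h r hr] with i hi
  by_contra hxi
  have hne : (K i).Nonempty := by
    obtain ⟨y, hy, -⟩ := mem_thickening_iff.1 (hi.2 (interior_subset hx))
    exact ⟨y, hy⟩
  obtain ⟨u, s, hu, hs, hsx⟩ := exists_norm_eq_one_forall_inner_lt (hK i) (hKc i) hne hxi
  have hy : x + r • u ∈ L := hxr (by simp [norm_smul, hu, abs_of_pos hr])
  obtain ⟨z, hz, hyz⟩ := mem_thickening_iff.1 (hi.2 hy)
  have h1 := hs z hz
  have h2 : ⟪u, x + r • u - z⟫ ≤ ‖x + r • u - z‖ := by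
    simpa [hu] using real_inner_le_norm u (x + r • u - z)
  rw [← dist_eq_norm, inner_sub_right, inner_add_right, inner_smul_right,
    real_inner_self_eq_norm_sq, hu] at h2
  linarith

lemma HausdorffTendsto.eventually_notMem {K : ℕ → Set V} {L : Set V}
    (h : HausdorffTendsto K L) (hL : IsClosed L) {x : V} (hx : x ∉ L) :
    ∀ᶠ i in atTop, x ∉ K i := by
  rw [← hL.closure_eq, closure_eq_iInter_thickening] at hx
  simp only [mem_iInter, not_forall] at hx
  obtain ⟨ε, hε, hx⟩ := hx
  filter_upwards [h ε hε] with i hi hxi using hx (hi.1 hxi)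

variable [MeasurableSpace V] [BorelSpace V]

lemma HausdorffTendsto.tendsto_volume {K : ℕ → Set V} {L : Set V} (h : HausdorffTendsto K L)
    (hK : ∀ i, Convex ℝ (K i)) (hKc : ∀ i, IsCompact (K i)) (hL : IsCompact L) :
    Tendsto (fun i => volume (K i)) atTop (𝓝 (volume L)) := by
  have hLc := h.convex hK hL.isClosed
  refine tendsto_measure_of_ae_tendsto_indicator atTop hL.measurableSet
    (fun i => (hKc i).measurableSet) (B := cthickening 1 L) isClosed_cthickening.measurableSet
    hL.cthickening.measure_ne_top ?_ ?_
  · filter_upwards [h 1 one_pos] with i hi using hi.1.trans (thickening_subset_cthickening _ _)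
  · have h0 := hLc.addHaar_frontier volume
    filter_upwards [measure_eq_zero_iff_ae_notMem.1 h0] with x hx
    by_cases hxL : x ∈ L
    · have : x ∈ interior L := by
        by_contra h1
        exact hx ⟨subset_closure hxL, h1⟩
      filter_upwards [h.eventually_mem_of_mem_interior hK (fun i => (hKc i).isClosed) this] with i hi
      exact iff_of_true hi hxL
    · filter_upwards [h.eventually_notMem hL.isClosed hxL] with i hi
      exact iff_of_false hi hxL

end HausdorffTendsto

/-- A reverse Fatou lemma for the upper limit of a sequence of sets. -/
lemma le_measure_of_frequently_mem {α : Type*} [MeasurableSpace α] {μ : Measure α}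
    {A : ℕ → Set α} {B L : Set α} {c : ℝ≥0∞} (hA : ∀ i, MeasurableSet (A i))
    (hAB : ∀ i, A i ⊆ B) (hB : μ B ≠ ∞) (hc : ∀ i, c ≤ μ (A i))
    (hL : ∀ x, (∃ᶠ i in atTop, x ∈ A i) → x ∈ L) : c ≤ μ L := by
  let C : ℕ → Set α := fun n => ⋃ i ≥ n, A i
  have hC : Antitone C := fun m n hmn => biUnion_subset_biUnion_left fun i hi => hmn.trans hi
  have hCL : ⋂ n, C n ⊆ L := fun x hx => hL x <| frequently_atTop.2 fun n => by
    simpa [C] using mem_iInter.1 hx n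
  refine le_trans ?_ (measure_mono hCL)
  refine ge_of_tendsto (tendsto_measure_iInter_atTop (fun n => ?_) hC ⟨0, ?_⟩)
    (Eventually.of_forall fun n => (hc n).trans (measure_mono ?_))
  · exact (MeasurableSet.biUnion (to_countable _) fun i _ => hA i).nullMeasurableSet
  · exact ne_top_of_le_ne_top hB (measure_mono (iUnion₂_subset fun i _ => hAB i))
  · exact subset_biUnion_of_mem (u := A) (mem_ofPred_eq ▸ le_refl n : n ∈ {i | i ≥ n})

section PolarProj

variable [FiniteDimensional ℝ V] [MeasurableSpace V] [BorelSpace V]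

/-- The polar projection body of a convex body `K`, described by the volume swept out by
translating `K` along a vector. -/
def polarProj (K : Set V) : Set V := {v | volume (K + segment ℝ 0 v) ≤ volume K + 1}

lemma polarProj_isClosed {K : Set V} (hK : IsCompact K) (hKc : Convex ℝ K) :
    IsClosed (polarProj K) := by
  refine IsSeqClosed.isClosed fun v w hv hw => ?_
  refine le_of_tendsto (((HausdorffTendsto.refl K).add (hausdorffTendsto_segment hw)).tendsto_volume
    (fun i => hKc.add (convex_segment _ _)) (fun i => hK.add (isCompact_segment _ _))
    (hK.add (isCompact_segment _ _))) (Eventually.of_forall hv)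

lemma mem_polarProj_smul_iff {K : Set V} (hK : IsCompact K) (hKc : Convex ℝ K) {u : V}
    (hu : ‖u‖ = 1) {r : ℝ} (hr : 0 ≤ r) :
    r • u ∈ polarProj K ↔ ENNReal.ofReal r * volume (shadow K u) ≤ 1 := by
  rw [polarProj, mem_ofPred_eq, volume_add_segment hu hK hKc hr,
    ENNReal.add_le_add_iff_left hK.measure_ne_top]

lemma ofReal_norm_mul_volume_le {K : Set V} (hK : IsCompact K) (hKc : Convex ℝ K) {R : ℝ}
    (hKR : K ⊆ closedBall 0 R) {v : V} (hv : v ∈ polarProj K) :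
    ENNReal.ofReal ‖v‖ * volume K ≤ ENNReal.ofReal (2 * R) := by
  rcases eq_or_ne v 0 with rfl | hv0
  · simp
  have hu : ‖‖v‖⁻¹ • v‖ = 1 := norm_smul_inv_norm hv0
  have hvu : v = ‖v‖ • (‖v‖⁻¹ • v) := by
    rw [smul_inv_smul₀ (norm_ne_zero_iff.2 hv0)]
  rw [hvu, mem_polarProj_smul_iff hK hKc hu (norm_nonneg v)] at hv
  calc ENNReal.ofReal ‖v‖ * volume K
      ≤ ENNReal.ofReal ‖v‖ * (ENNReal.ofReal (2 * R) * volume (shadow K (‖v‖⁻¹ • v))) := by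
        gcongr
        exact volume_le_mul_volume_shadow hu hK hKR
    _ = ENNReal.ofReal (2 * R) * (ENNReal.ofReal ‖v‖ * volume (shadow K (‖v‖⁻¹ • v))) := by ring
    _ ≤ ENNReal.ofReal (2 * R) := by simpa using mul_le_mul_right hv (ENNReal.ofReal (2 * R))

lemma polarProj_subset_closedBall {K : Set V} (hK : IsCompact K) (hKc : Convex ℝ K) {R : ℝ}
    (hR : 0 ≤ R) (hKR : K ⊆ closedBall 0 R) (h0 : volume K ≠ 0) :
    polarProj K ⊆ closedBall 0 (2 * R / volume.real K) := by
  intro v hv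
  have h := ofReal_norm_mul_volume_le hK hKc hKR hv
  have hpos : 0 < volume.real K := ENNReal.toReal_pos h0 hK.measure_ne_top
  rw [mem_closedBall_zero_iff, le_div_iff₀ hpos]
  rw [← ENNReal.ofReal_toReal hK.measure_ne_top, ← ENNReal.ofReal_mul (norm_nonneg v),
    ENNReal.ofReal_le_ofReal_iff (by positivity)] at h
  exact h

lemma exists_subset_closedBall {K : Set V} (hK : IsCompact K) : ∃ R, 0 ≤ R ∧ K ⊆ closedBall 0 R := by
  obtain ⟨R, hR⟩ := hK.isBounded.subset_closedBall 0
  exact ⟨max R 0, le_max_right _ _, hR.trans (closedBall_subset_closedBall (le_max_left _ _))⟩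

lemma polarProj_isCompact {K : Set V} (hK : IsCompact K) (hKc : Convex ℝ K) (h0 : volume K ≠ 0) :
    IsCompact (polarProj K) := by
  obtain ⟨R, hR, hKR⟩ := exists_subset_closedBall hK
  exact (isCompact_closedBall _ _).of_isClosed_subset (polarProj_isClosed hK hKc)
    (polarProj_subset_closedBall hK hKc hR hKR h0)

lemma HausdorffTendsto.le_volume_polarProj {K : ℕ → Set V} {L : Set V} (h : HausdorffTendsto K L)
    (hK : ∀ i, Convex ℝ (K i)) (hKc : ∀ i, IsCompact (K i)) (hL : IsCompact L) {R : ℝ} (hR : 0 ≤ R)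
    (hKR : ∀ i, K i ⊆ closedBall 0 R) {m : ℝ≥0∞} (hm : m ≠ 0) (hKm : ∀ i, volume (K i) = m)
    {c : ℝ≥0∞} (hc : ∀ i, c ≤ volume (polarProj (K i))) : c ≤ volume (polarProj L) := by
  have hball : ∀ i, polarProj (K i) ⊆ closedBall 0 (2 * R / m.toReal) := fun i => by
    have := polarProj_subset_closedBall (hKc i) (hK i) hR (hKR i) (hKm i ▸ hm)
    rwa [Measure.real, hKm] at this
  refine le_measure_of_frequently_mem
    (fun i => (polarProj_isClosed (hKc i) (hK i)).measurableSet) hball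
    (isCompact_closedBall _ _).measure_ne_top hc fun v hv => ?_
  refine le_of_tendsto_of_tendsto_of_frequently
    ((h.add (HausdorffTendsto.refl (segment ℝ 0 v))).tendsto_volume
    (fun i => (hK i).add (convex_segment _ _)) (fun i => (hKc i).add (isCompact_segment _ _))
    (hL.add (isCompact_segment _ _)))
    ((h.tendsto_volume hK hKc hL).add_const 1) hv

lemma steinerComb_polarProj_subset {K : Set V} (hK : IsCompact K) (hKc : Convex ℝ K) {u : V}
    (hu : ‖u‖ = 1) (hvol : volume (steinerComb u K K) = volume K) :
    steinerComb u (polarProj K) (polarProj K) ⊆ polarProj (steinerComb u K K) := by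
  rintro _ ⟨⟨v, w⟩, ⟨⟨hv, hw⟩, hvw⟩, rfl⟩
  simp only [mem_ofPred_eq] at hvw
  have hsub : steinerComb u K K + segment ℝ 0 ((2⁻¹ : ℝ) • (v + (ℝ ∙ u)ᗮ.reflection w)) ⊆
      steinerComb u (K + segment ℝ 0 v) (K + segment ℝ 0 w) := by
    rintro _ ⟨_, ⟨⟨x, y⟩, ⟨⟨hx, hy⟩, hxy⟩, rfl⟩, z, hz, rfl⟩
    rw [segment_eq_image] at hz
    obtain ⟨t, ht, rfl⟩ := hz
    refine ⟨(x + t • v, y + t • w), ⟨⟨?_, ?_⟩, ?_⟩, ?_⟩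
    · refine add_mem_add hx ?_
      rw [segment_eq_image]
      exact ⟨t, ht, by simp⟩
    · refine add_mem_add hy ?_
      rw [segment_eq_image]
      exact ⟨t, ht, by simp⟩
    · have := (ℝ ∙ u).add_mem hxy ((ℝ ∙ u).smul_mem t hvw)
      simp only [mem_ofPred_eq]
      convert this using 1
      simp only [smul_sub]
      abel
    · simp only [map_add, map_smul]
      module
  have hcs := fun v : V => hK.add (isCompact_segment 0 v)
  have hcc := fun v : V => hKc.add (convex_segment (𝕜 := ℝ) 0 v)
  calc _ ≤ _ := measure_mono hsub
    _ ≤ _ := volume_steinerComb_le hu (hcs v) (hcc v) (hcs w) (hcc w)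
    _ ≤ 2⁻¹ * ((volume K + 1) + (volume K + 1)) := by gcongr <;> assumption
    _ = volume (steinerComb u K K) + 1 := by
      rw [hvol, ← two_mul, ← mul_assoc, ENNReal.inv_mul_cancel two_ne_zero ENNReal.ofNat_ne_top,
        one_mul]

lemma volume_steinerComb_self {K : Set V} (hK : IsCompact K) (hKc : Convex ℝ K) {u : V}
    (hu : ‖u‖ = 1) : volume (steinerComb u K K) = volume K := by
  refine le_antisymm ((volume_steinerComb_le hu hK hKc hK hKc).trans_eq ?_)
    (volume_le_volume_steinerComb_self hu hK)
  rw [← two_mul, ← mul_assoc, ENNReal.inv_mul_cancel two_ne_zero ENNReal.ofNat_ne_top, one_mul]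

lemma volume_polarProj_le_steinerComb {K : Set V} (hK : IsCompact K) (hKc : Convex ℝ K)
    (h0 : volume K ≠ 0) {u : V} (hu : ‖u‖ = 1) :
    volume (polarProj K) ≤ volume (polarProj (steinerComb u K K)) :=
  (volume_le_volume_steinerComb_self hu (polarProj_isCompact hK hKc h0)).trans
    (measure_mono (steinerComb_polarProj_subset hK hKc hu (volume_steinerComb_self hK hKc hu)))

end PolarProj

section SupportFunction

/-- The support function of a set. -/
def supportFun (K : Set V) (v : V) : ℝ := sSup ((fun y => ⟪v, y⟫) '' K)

lemma bddAbove_inner_image {K : Set V} (hK : IsCompact K) (v : V) :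
    BddAbove ((fun y => ⟪v, y⟫) '' K) :=
  (hK.image (by fun_prop)).bddAbove

lemma inner_le_supportFun {K : Set V} (hK : IsCompact K) (v : V) {y : V} (hy : y ∈ K) :
    ⟪v, y⟫ ≤ supportFun K v :=
  le_csSup (bddAbove_inner_image hK v) (mem_image_of_mem _ hy)

lemma supportFun_le {K : Set V} (hne : K.Nonempty) {v : V} {c : ℝ} (h : ∀ y ∈ K, ⟪v, y⟫ ≤ c) :
    supportFun K v ≤ c :=
  csSup_le (hne.image _) (forall_mem_image.2 h)

lemma supportFun_smul {K : Set V} {r : ℝ} (hr : 0 ≤ r) (v : V) :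
    supportFun K (r • v) = r * supportFun K v := by
  rw [supportFun, supportFun, ← smul_eq_mul, ← Real.sSup_smul_of_nonneg hr]
  congr 1
  ext x
  simp [mem_smul_set, real_inner_smul_left]

lemma supportFun_le_add_norm_mul {K : Set V} (hK : IsCompact K) (hne : K.Nonempty) {R : ℝ}
    (hKR : K ⊆ closedBall 0 R) (v w : V) : supportFun K v ≤ supportFun K w + ‖v - w‖ * R := by
  refine supportFun_le hne fun y hy => ?_
  have h1 := inner_le_supportFun hK w hy
  have h2 := (real_inner_le_norm (v - w) y).trans
    (mul_le_mul_of_nonneg_left (mem_closedBall_zero_iff.1 (hKR hy)) (norm_nonneg _))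
  rw [inner_sub_left] at h2
  linarith

lemma continuous_supportFun {K : Set V} (hK : IsCompact K) (hne : K.Nonempty) :
    Continuous (supportFun K) := by
  obtain ⟨R, hR⟩ := hK.isBounded.subset_closedBall 0
  refine LipschitzWith.continuous (K := R.toNNReal) (LipschitzWith.of_le_add_mul _ fun v w => ?_)
  refine (supportFun_le_add_norm_mul hK hne hR v w).trans ?_
  rw [dist_eq_norm, mul_comm]
  gcongr
  exact Real.le_coe_toNNReal R

lemma supportFun_le_of_subset_thickening {K L : Set V} (hne : K.Nonempty) (hL : IsCompact L)
    {ε : ℝ} (h : K ⊆ thickening ε L) (v : V) : supportFun K v ≤ supportFun L v + ‖v‖ * ε := by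
  refine supportFun_le hne fun y hy => ?_
  obtain ⟨z, hz, hyz⟩ := mem_thickening_iff.1 (h hy)
  have h1 := inner_le_supportFun hL v hz
  have h2 := (real_inner_le_norm v (y - z)).trans
    (mul_le_mul_of_nonneg_left ((dist_eq_norm y z) ▸ hyz.le) (norm_nonneg _))
  rw [inner_sub_right] at h2
  linarith

lemma HausdorffTendsto.tendsto_supportFun {K : ℕ → Set V} {L : Set V} (h : HausdorffTendsto K L)
    (hKc : ∀ i, IsCompact (K i)) (hKne : ∀ i, (K i).Nonempty) (hL : IsCompact L)
    (hLne : L.Nonempty) (v : V) :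
    Tendsto (fun i => supportFun (K i) v) atTop (𝓝 (supportFun L v)) := by
  rw [Metric.tendsto_nhds]
  intro ε hε
  have hpos : 0 < ‖v‖ + 1 := by positivity
  filter_upwards [h (ε / (‖v‖ + 1)) (by positivity)] with i hi
  have h1 := supportFun_le_of_subset_thickening (hKne i) hL hi.1 v
  have h2 := supportFun_le_of_subset_thickening hLne (hKc i) hi.2 v
  have h3 : ‖v‖ * (ε / (‖v‖ + 1)) < ε := by
    rw [mul_div_assoc', div_lt_iff₀ hpos]
    nlinarith
  rw [Real.dist_eq, abs_lt]
  constructor <;> linarith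

lemma supportFun_steinerComb_le (u : V) {K : Set V} (hK : IsCompact K)
    (hne : (steinerComb u K K).Nonempty) (v : V) :
    supportFun (steinerComb u K K) v ≤
      (supportFun K v + supportFun K ((ℝ ∙ u)ᗮ.reflection v)) / 2 := by
  refine supportFun_le hne ?_
  rintro _ ⟨⟨x, y⟩, ⟨⟨hx, hy⟩, -⟩, rfl⟩
  have h1 := inner_le_supportFun hK v hx
  have h2 := inner_le_supportFun hK ((ℝ ∙ u)ᗮ.reflection v) hy
  have h3 : ⟪v, (ℝ ∙ u)ᗮ.reflection y⟫ = ⟪(ℝ ∙ u)ᗮ.reflection v, y⟫ := by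
    rw [← LinearIsometryEquiv.inner_map_map (ℝ ∙ u)ᗮ.reflection, Submodule.reflection_reflection]
  simp only [inner_smul_right, inner_add_right, h3] at *
  linarith

variable [FiniteDimensional ℝ V]

lemma subset_of_supportFun_le {K L : Set V} (hK : IsCompact K) (hL : IsCompact L)
    (hLc : Convex ℝ L) (hne : L.Nonempty) (h : ∀ v, supportFun K v ≤ supportFun L v) : K ⊆ L := by
  intro x hx
  by_contra hxL
  obtain ⟨u, s, -, hs, hsx⟩ := exists_norm_eq_one_forall_inner_lt hLc hL.isClosed hne hxL
  have h1 := inner_le_supportFun hK u hx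
  have h2 := supportFun_le hne fun y hy => (hs y hy).le
  linarith [h u]

variable [MeasurableSpace V] [BorelSpace V]

/-- The integral of the exponential of the support function over the unit ball. -/
def expWidth (K : Set V) : ℝ := ∫ v in ball (0 : V) 1, Real.exp (supportFun K v)

lemma supportFun_le_of_norm_le_one {K : Set V} (hne : K.Nonempty) {R : ℝ}
    (hKR : K ⊆ closedBall 0 R) {v : V} (hv : ‖v‖ ≤ 1) : supportFun K v ≤ R :=
  supportFun_le hne fun y hy => by
    have h1 := mem_closedBall_zero_iff.1 (hKR hy)
    have h2 := real_inner_le_norm v y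
    nlinarith [norm_nonneg v, norm_nonneg y]

lemma integrableOn_ball_of_continuous {f : V → ℝ} (hf : Continuous f) :
    IntegrableOn f (ball (0 : V) 1) :=
  (hf.continuousOn.integrableOn_compact (isCompact_closedBall (0 : V) 1)).mono_set
    ball_subset_closedBall

lemma continuous_exp_supportFun {K : Set V} (hK : IsCompact K) (hne : K.Nonempty) :
    Continuous fun v => Real.exp (supportFun K v) :=
  Real.continuous_exp.comp (continuous_supportFun hK hne)

lemma HausdorffTendsto.tendsto_expWidth {K : ℕ → Set V} {L : Set V} (h : HausdorffTendsto K L)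
    (hKc : ∀ i, IsCompact (K i)) (hKne : ∀ i, (K i).Nonempty) (hL : IsCompact L)
    (hLne : L.Nonempty) {R : ℝ} (hKR : ∀ i, K i ⊆ closedBall 0 R) :
    Tendsto (fun i => expWidth (K i)) atTop (𝓝 (expWidth L)) := by
  refine tendsto_integral_of_dominated_convergence (fun _ => Real.exp R)
    (fun i => (continuous_exp_supportFun (hKc i) (hKne i)).aestronglyMeasurable)
    (integrableOn_ball_of_continuous continuous_const) (fun i => ?_) ?_
  · filter_upwards [ae_restrict_mem measurableSet_ball] with v hv
    rw [Real.norm_eq_abs, Real.abs_exp, Real.exp_le_exp]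
    exact supportFun_le_of_norm_le_one (hKne i) (hKR i) (mem_ball_zero_iff.1 hv).le
  · exact Eventually.of_forall fun v => (Real.continuous_exp.tendsto _).comp
      (h.tendsto_supportFun hKc hKne hL hLne v)

lemma supportFun_comp_reflection_eq_of_expWidth_le (u : V) {K : Set V} (hK : IsCompact K)
    (hne : K.Nonempty) (hSne : (steinerComb u K K).Nonempty)
    (h : expWidth K ≤ expWidth (steinerComb u K K)) (v : V) :
    supportFun K ((ℝ ∙ u)ᗮ.reflection v) = supportFun K v := by
  set ρ := (ℝ ∙ u)ᗮ.reflection with hρ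
  have hint : ∫ v in ball (0 : V) 1, Real.exp (supportFun K (ρ v)) = expWidth K := by
    have h1 := ρ.measurePreserving.setIntegral_preimage_emb
      ρ.toHomeomorph.measurableEmbedding (fun v => Real.exp (supportFun K v)) (ball (0 : V) 1)
    have h2 : ρ ⁻¹' ball (0 : V) 1 = ball (0 : V) 1 := by
      ext x; simp
    rw [h2] at h1
    exact h1
  have hcont := continuous_exp_supportFun hK hne
  have hcont' : Continuous fun v => Real.exp (supportFun K (ρ v)) := hcont.comp ρ.continuous
  let g : V → ℝ := fun v =>
    (Real.exp (supportFun K v / 2) - Real.exp (supportFun K (ρ v) / 2)) ^ 2 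
  have hgc : Continuous g := by
    have := continuous_supportFun hK hne
    have h2 := this.comp ρ.continuous
    simp only [g]
    fun_prop
  have hSc := continuous_exp_supportFun (steinerComb_isCompact u hK hK) hSne
  have hgle : ∀ v, g v ≤ Real.exp (supportFun K v) + Real.exp (supportFun K (ρ v))
      - 2 * Real.exp (supportFun (steinerComb u K K) v) := by
    intro v
    have h1 := Real.exp_le_exp.2 (supportFun_steinerComb_le u hK hSne v)
    rw [add_div, Real.exp_add] at h1
    have h2 : ∀ x : ℝ, Real.exp x = Real.exp (x / 2) ^ 2 := fun x => by
      rw [← Real.exp_nat_mul]; congr 1; push_cast; ring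
    simp only [g]
    rw [h2 (supportFun K v), h2 (supportFun K (ρ v))]
    nlinarith
  have hg0 : ∫ v in ball (0 : V) 1, g v = 0 := by
    refine le_antisymm ?_ (integral_nonneg fun v => sq_nonneg _)
    calc ∫ v in ball (0 : V) 1, g v ≤ ∫ v in ball (0 : V) 1, (Real.exp (supportFun K v) +
          Real.exp (supportFun K (ρ v)) - 2 * Real.exp (supportFun (steinerComb u K K) v)) :=
        integral_mono (integrableOn_ball_of_continuous hgc) (integrableOn_ball_of_continuous
          (by fun_prop)) hgle
      _ = expWidth K + expWidth K - 2 * expWidth (steinerComb u K K) := by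
        rw [integral_sub (integrableOn_ball_of_continuous (by fun_prop))
          (integrableOn_ball_of_continuous (by fun_prop)),
          integral_add (integrableOn_ball_of_continuous (by fun_prop))
          (integrableOn_ball_of_continuous (by fun_prop)), integral_const_mul, hint]
        rfl
      _ ≤ 0 := by linarith
  have hg0' : ∀ v ∈ ball (0 : V) 1, g v = 0 := by
    rw [integral_eq_zero_iff_of_nonneg (fun v => sq_nonneg _)
      (integrableOn_ball_of_continuous hgc)] at hg0
    exact Measure.eqOn_open_of_ae_eq hg0 isOpen_ball hgc.continuousOn continuousOn_const
  have hball : ∀ v ∈ ball (0 : V) 1, supportFun K (ρ v) = supportFun K v := by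
    intro v hv
    have h1 := pow_eq_zero_iff (two_ne_zero) |>.1 (hg0' v hv)
    have h2 := Real.exp_injective (sub_eq_zero.1 h1)
    linarith
  have hr : 0 < (‖v‖ + 1)⁻¹ := by positivity
  have h1 := hball ((‖v‖ + 1)⁻¹ • v) (by
    rw [mem_ball_zero_iff, norm_smul, Real.norm_eq_abs, abs_of_pos hr, inv_mul_lt_iff₀ (by positivity)]
    linarith)
  rw [map_smul, supportFun_smul hr.le, supportFun_smul hr.le] at h1
  exact mul_left_cancel₀ hr.ne' h1

end SupportFunction

section Petty

lemma steinerComb_subset_closedBall (u : V) {A B : Set V} {R : ℝ} (hA : A ⊆ closedBall 0 R)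
    (hB : B ⊆ closedBall 0 R) : steinerComb u A B ⊆ closedBall 0 R := by
  rintro _ ⟨⟨x, y⟩, ⟨⟨hx, hy⟩, -⟩, rfl⟩
  have h1 := mem_closedBall_zero_iff.1 (hA hx)
  have h2 := mem_closedBall_zero_iff.1 (hB hy)
  have h3 := norm_add_le x ((ℝ ∙ u)ᗮ.reflection y)
  rw [LinearIsometryEquiv.norm_map] at h3
  rw [mem_closedBall_zero_iff, norm_smul]
  norm_num
  linarith

lemma steinerComb_self_nonempty (u : V) {A : Set V} (hA : A.Nonempty) :
    (steinerComb u A A).Nonempty := by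
  obtain ⟨x, hx⟩ := hA
  exact ⟨_, (x, x), ⟨⟨hx, hx⟩, by simp⟩, rfl⟩

/-- A set which is invariant under all reflections and star-shaped is a ball. -/
lemma exists_eq_closedBall_of_reflection_mem {L : Set V} (hL : IsCompact L) (hLc : Convex ℝ L)
    (hne : L.Nonempty) (h : ∀ u : V, ‖u‖ = 1 → ∀ x ∈ L, (ℝ ∙ u)ᗮ.reflection x ∈ L) :
    ∃ r, 0 ≤ r ∧ L = closedBall 0 r := by
  obtain ⟨m, hm, hmax⟩ := hL.exists_isMaxOn hne continuous_norm.continuousOn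
  have hsph : ∀ x : V, ‖x‖ = ‖m‖ → x ∈ L := by
    intro x hx
    rcases eq_or_ne m x with rfl | hmx
    · exact hm
    have hne0 : m - x ≠ 0 := sub_ne_zero.2 hmx
    have h1 := h (‖m - x‖⁻¹ • (m - x)) (norm_smul_inv_norm hne0) m hm
    have h2 : (ℝ ∙ (‖m - x‖⁻¹ • (m - x))) = ℝ ∙ (m - x) :=
      Submodule.span_singleton_smul_eq (IsUnit.mk0 _ (inv_ne_zero (norm_ne_zero_iff.2 hne0))) _
    have h3 : (ℝ ∙ (m - x))ᗮ.reflection m = x := Submodule.reflection_sub hx.symm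
    simp_rw [h2] at h1
    rwa [h3] at h1
  refine ⟨‖m‖, norm_nonneg _, Subset.antisymm (fun x hx => mem_closedBall_zero_iff.2 (hmax hx)) ?_⟩
  intro x hx
  rw [mem_closedBall_zero_iff] at hx
  rcases eq_or_ne x 0 with rfl | hx0
  · have h1 := hsph (-m) (norm_neg m)
    have := hLc hm h1 (a := 1 / 2) (b := 1 / 2) (by norm_num) (by norm_num) (by norm_num)
    simpa using this
  have hxn : 0 < ‖x‖ := norm_pos_iff.2 hx0
  set y := (‖m‖ / ‖x‖) • x with hy
  have hyn : ‖y‖ = ‖m‖ := by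
    rw [hy, norm_smul, Real.norm_eq_abs, abs_of_nonneg (by positivity)]
    field_simp
  have h1 := hsph y hyn
  have h2 := hsph (-y) (by rw [norm_neg, hyn])
  have hmpos : 0 < ‖m‖ := hxn.trans_le hx
  have hle : ‖x‖ / ‖m‖ ≤ 1 := (div_le_one hmpos).2 hx
  have := hLc h1 h2 (a := (1 + ‖x‖ / ‖m‖) / 2) (b := (1 - ‖x‖ / ‖m‖) / 2) (by positivity)
    (by linarith) (by ring)
  convert this using 1
  rw [smul_neg, ← sub_eq_add_neg, ← sub_smul, hy, smul_smul]
  have : ((1 + ‖x‖ / ‖m‖) / 2 - (1 - ‖x‖ / ‖m‖) / 2) * (‖m‖ / ‖x‖) = 1 := by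
    field_simp; ring
  rw [this, one_smul]

variable [FiniteDimensional ℝ V] [MeasurableSpace V] [BorelSpace V]

/-- The Petty projection inequality: among convex bodies of given volume, a ball maximises the
volume of the polar projection body. -/
theorem exists_closedBall_volume_polarProj_le {K : Set V} (hK : IsCompact K) (hKc : Convex ℝ K)
    (h0 : volume K ≠ 0) : ∃ r, 0 ≤ r ∧ volume (closedBall (0 : V) r) = volume K ∧
      volume (polarProj K) ≤ volume (polarProj (closedBall (0 : V) r)) := by
  obtain ⟨R, hR, hKR⟩ := exists_subset_closedBall hK
  have hne : K.Nonempty := nonempty_of_measure_ne_zero h0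
  let F : Set (NonemptyCompacts V) := {L | (Convex ℝ (L : Set V) ∧ volume (L : Set V) = volume K ∧
    volume (polarProj K) ≤ volume (polarProj (L : Set V))) ∧ (L : Set V) ⊆ closedBall 0 R}
  have hFclosed : IsClosed F := by
    refine IsSeqClosed.isClosed fun L M hL hLM => ?_
    have h := hausdorffTendsto_of_tendsto hLM
    have hc := fun i => (hL i).1.1
    refine ⟨⟨h.convex hc M.isCompact.isClosed, ?_, ?_⟩, ?_⟩
    · refine tendsto_nhds_unique (h.tendsto_volume hc (fun i => (L i).isCompact) M.isCompact) ?_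
      simp_rw [fun i => (hL i).1.2.1]
      exact tendsto_const_nhds
    · exact h.le_volume_polarProj hc (fun i => (L i).isCompact) M.isCompact hR (fun i => (hL i).2)
        h0 (fun i => (hL i).1.2.1) (fun i => (hL i).1.2.2)
    · exact (NonemptyCompacts.isClosed_subsets_of_isClosed isClosed_closedBall).mem_of_tendsto hLM
        (Eventually.of_forall fun i => (hL i).2)
  have hF : IsCompact F :=
    (NonemptyCompacts.isCompact_subsets_of_isCompact (isCompact_closedBall (0 : V) R)).of_isClosed_subset
      hFclosed fun L hL => hL.2
  have hFne : F.Nonempty := ⟨⟨⟨K, hK⟩, hne⟩, ⟨hKc, rfl, le_rfl⟩, hKR⟩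
  have hcont : ContinuousOn (fun L : NonemptyCompacts V => expWidth (L : Set V)) F := by
    rw [continuousOn_iff_continuous_domRestrict]
    refine SeqContinuous.continuous fun L M hLM => ?_
    have h := hausdorffTendsto_of_tendsto ((continuous_subtype_val.tendsto M).comp hLM)
    exact h.tendsto_expWidth (fun i => (L i).1.isCompact) (fun i => (L i).1.nonempty)
      M.1.isCompact M.1.nonempty (fun i => (L i).2.2)
  obtain ⟨L, ⟨⟨hLc, hLvol, hLp⟩, hLR⟩, hmin⟩ := hF.exists_isMinOn hFne hcont
  have hL0 : volume (L : Set V) ≠ 0 := hLvol ▸ h0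
  obtain ⟨r, hr, hLr⟩ := exists_eq_closedBall_of_reflection_mem L.isCompact hLc L.nonempty
    fun u hu x hx => by
      have hSne := steinerComb_self_nonempty u L.nonempty
      let S : NonemptyCompacts V :=
        ⟨⟨steinerComb u L L, steinerComb_isCompact u L.isCompact L.isCompact⟩, hSne⟩
      have hS : S ∈ F := ⟨⟨steinerComb_convex u hLc hLc,
        (volume_steinerComb_self L.isCompact hLc hu).trans hLvol,
        hLp.trans (volume_polarProj_le_steinerComb L.isCompact hLc hL0 hu)⟩,
        steinerComb_subset_closedBall u hLR hLR⟩
      have hsymm := supportFun_comp_reflection_eq_of_expWidth_le u L.isCompact L.nonempty hSne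
        (hmin hS)
      refine subset_of_supportFun_le (K := (ℝ ∙ u)ᗮ.reflection '' L)
        (L.isCompact.image (LinearIsometryEquiv.continuous _)) L.isCompact hLc L.nonempty
        (fun v => ?_) (mem_image_of_mem _ hx)
      refine supportFun_le (L.nonempty.image _) (forall_mem_image.2 fun y hy => ?_)
      rw [← hsymm, ← LinearIsometryEquiv.inner_map_map (ℝ ∙ u)ᗮ.reflection,
        Submodule.reflection_reflection]
      exact inner_le_supportFun L.isCompact _ hy
  exact ⟨r, hr, hLr ▸ hLvol, hLr ▸ hLp⟩

end Petty

section Affine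
variable [FiniteDimensional ℝ V] [MeasurableSpace V] [BorelSpace V]

lemma smul_mem_polarProj_iff {K : Set V} (hK : IsCompact K) (hKc : Convex ℝ K) {d : ℝ}
    (hd : 0 < d) (v : V) : d • v ∈ polarProj K ↔
      ENNReal.ofReal d * volume (K + segment ℝ 0 v) ≤ ENNReal.ofReal d * volume K + 1 := by
  rcases eq_or_ne v 0 with rfl | hv0
  · simp [polarProj]
  have hu : ‖‖v‖⁻¹ • v‖ = 1 := norm_smul_inv_norm hv0
  have hvu : v = ‖v‖ • (‖v‖⁻¹ • v) := by
    rw [smul_inv_smul₀ (norm_ne_zero_iff.2 hv0)]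
  have hnn := norm_nonneg v
  set u := ‖v‖⁻¹ • v
  set r := ‖v‖
  rw [hvu, smul_smul, mem_polarProj_smul_iff hK hKc hu (by positivity),
    volume_add_segment hu hK hKc hnn, mul_add, ENNReal.add_le_add_iff_left
      (ENNReal.mul_ne_top ENNReal.ofReal_ne_top hK.measure_ne_top), ← mul_assoc,
    ENNReal.ofReal_mul hd.le]

lemma abs_det_pos (T : V ≃ₗ[ℝ] V) : 0 < |LinearMap.det (T : V →ₗ[ℝ] V)| :=
  abs_pos.2 (LinearEquiv.isUnit_det' T).ne_zero

lemma volume_image_linearEquiv (T : V ≃ₗ[ℝ] V) (A : Set V) :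
    volume (T '' A) = ENNReal.ofReal |LinearMap.det (T : V →ₗ[ℝ] V)| * volume A :=
  Measure.addHaar_image_linearMap volume (T : V →ₗ[ℝ] V) A

lemma isCompact_image_linearEquiv (T : V ≃ₗ[ℝ] V) {K : Set V} (hK : IsCompact K) :
    IsCompact (T '' K) :=
  hK.image (LinearMap.continuous_of_finiteDimensional (T : V →ₗ[ℝ] V))

lemma polarProj_image_linearEquiv (T : V ≃ₗ[ℝ] V) {K : Set V} (hK : IsCompact K)
    (hKc : Convex ℝ K) : polarProj (T '' K) =
      T '' (|LinearMap.det (T : V →ₗ[ℝ] V)|⁻¹ • polarProj K) := by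
  have hd := abs_det_pos T
  ext w
  obtain ⟨v, rfl⟩ := T.surjective w
  rw [T.injective.mem_set_image, mem_inv_smul_set_iff₀ hd.ne', smul_mem_polarProj_iff hK hKc hd,
    polarProj, mem_ofPred_eq, ← volume_image_linearEquiv, ← volume_image_linearEquiv]
  have h1 : T '' segment ℝ 0 v = segment ℝ 0 (T v) := by
    simpa using image_segment ℝ (T : V →ₗ[ℝ] V).toAffineMap 0 v
  rw [← h1, ← image_add]

/-- The affine invariant Petty product `|K|^(n-1) |Π°K|`. -/
def pettyProduct (K : Set V) : ℝ≥0∞ :=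
  volume K ^ (Module.finrank ℝ V - 1) * volume (polarProj K)

lemma pettyProduct_image_linearEquiv (T : V ≃ₗ[ℝ] V) {K : Set V} (hK : IsCompact K)
    (hKc : Convex ℝ K) (hV : 1 ≤ Module.finrank ℝ V) :
    pettyProduct (T '' K) = pettyProduct K := by
  have hd := abs_det_pos T
  rw [pettyProduct, polarProj_image_linearEquiv T hK hKc, volume_image_linearEquiv,
    volume_image_linearEquiv, Measure.addHaar_smul, pettyProduct]
  set d := |LinearMap.det (T : V →ₗ[ℝ] V)|
  obtain ⟨m, hm⟩ : ∃ m, Module.finrank ℝ V = m + 1 := ⟨_, (Nat.sub_add_cancel hV).symm⟩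
  rw [hm, Nat.add_sub_cancel, mul_pow]
  have h1 : ENNReal.ofReal d ^ m * (ENNReal.ofReal d * ENNReal.ofReal |d⁻¹ ^ (m + 1)|) = 1 := by
    rw [abs_of_pos (by positivity), ← ENNReal.ofReal_mul hd.le, ← ENNReal.ofReal_pow hd.le,
      ← ENNReal.ofReal_mul (by positivity), ← ENNReal.ofReal_one]
    congr 1
    rw [inv_pow, pow_succ]
    field_simp
  calc _ = (ENNReal.ofReal d ^ m * (ENNReal.ofReal d * ENNReal.ofReal |d⁻¹ ^ (m + 1)|)) *
        (volume K ^ m * volume (polarProj K)) := by ring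
    _ = _ := by rw [h1, one_mul]

lemma volume_polarProj_ne_zero {K : Set V} (hK : IsCompact K) (hKc : Convex ℝ K) :
    volume (polarProj K) ≠ 0 := by
  have hcont : Tendsto (fun v => volume (K + segment ℝ 0 v)) (𝓝 0)
      (𝓝 (volume (K + segment ℝ 0 (0 : V)))) := by
    refine tendsto_of_seq_tendsto fun v hv => ?_
    exact ((HausdorffTendsto.refl K).add (hausdorffTendsto_segment hv)).tendsto_volume
      (fun i => hKc.add (convex_segment _ _)) (fun i => hK.add (isCompact_segment _ _))
      (hK.add (isCompact_segment _ _))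
  rw [segment_same, add_singleton, image_congr (fun x _ => add_zero x), image_id'] at hcont
  have h1 : volume K < volume K + 1 := ENNReal.lt_add_right hK.measure_ne_top one_ne_zero
  have h2 : polarProj K ∈ 𝓝 (0 : V) := by
    filter_upwards [hcont.eventually_lt_const h1] with v hv using hv.le
  exact (Measure.measure_pos_of_mem_nhds volume h2).ne'

/-- If the polar projection body of a convex body is at least as large as that of an ellipsoid,
then the body itself is at most as large as the ellipsoid. -/
theorem volume_le_of_volume_polarProj_le (hV : 2 ≤ Module.finrank ℝ V) {K : Set V}
    (hK : IsCompact K) (hKc : Convex ℝ K) (T : V ≃ₗ[ℝ] V)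
    (h : volume (polarProj (T '' closedBall (0 : V) 1)) ≤ volume (polarProj K)) :
    volume K ≤ volume (T '' closedBall (0 : V) 1) := by
  rcases eq_or_ne (volume K) 0 with h0 | h0
  · simp [h0]
  have hB := isCompact_closedBall (0 : V) 1
  have hBc := convex_closedBall (0 : V) 1
  set E := T '' closedBall (0 : V) 1 with hE
  have hEk : IsCompact E := isCompact_image_linearEquiv T hB
  have hEc : Convex ℝ E := hBc.linear_image (T : V →ₗ[ℝ] V)
  have hE0 : volume E ≠ 0 := by
    rw [hE, volume_image_linearEquiv]
    exact mul_ne_zero (ENNReal.ofReal_pos.2 (abs_det_pos T)).ne'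
      (Metric.measure_closedBall_pos volume _ one_pos).ne'
  have hpK : pettyProduct K ≤ pettyProduct E := by
    obtain ⟨r, hr, hvol, hle⟩ := exists_closedBall_volume_polarProj_le hK hKc h0
    have hr0 : r ≠ 0 := by
      rintro rfl
      have : Nontrivial V := Module.nontrivial_of_finrank_pos (R := ℝ) (by omega)
      rw [closedBall_zero, measure_singleton] at hvol
      exact h0 hvol.symm
    have hball : closedBall (0 : V) r = LinearEquiv.smulOfNeZero ℝ V r hr0 '' closedBall 0 1 := by
      change _ = (fun x => r • x) '' _
      rw [image_smul, smul_unitClosedBall, Real.norm_eq_abs, abs_of_nonneg hr]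
    calc pettyProduct K ≤ pettyProduct (closedBall (0 : V) r) := by
          rw [pettyProduct, pettyProduct, hvol]
          gcongr
      _ = pettyProduct (closedBall (0 : V) 1) := by
          rw [hball, pettyProduct_image_linearEquiv _ hB hBc (by omega)]
      _ = pettyProduct E := by
          rw [hE, pettyProduct_image_linearEquiv _ hB hBc (by omega)]
  have h1 : volume K ^ (Module.finrank ℝ V - 1) * volume (polarProj E) ≤
      volume E ^ (Module.finrank ℝ V - 1) * volume (polarProj E) :=
    (mul_le_mul' le_rfl h).trans hpK
  have h2 := (ENNReal.mul_le_mul_iff_left (volume_polarProj_ne_zero hEk hEc)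
    (polarProj_isCompact hEk hEc hE0).measure_ne_top).1 h1
  exact (ENNReal.pow_le_pow_left_iff (by omega)).1 h2

end Affine

section InvariantMeasure
variable [FiniteDimensional ℝ V] [MeasurableSpace V] [BorelSpace V]

lemma exists_linearIsometryEquiv_apply_eq_s15 {x y : V} (h : ‖x‖ = ‖y‖) :
    ∃ ρ : V ≃ₗᵢ[ℝ] V, ρ x = y :=
  ⟨_, Submodule.reflection_sub h⟩

instance [CompleteSpace V] : CompactSpace (unitary (V →L[ℝ] V)) := by
  have : ProperSpace (V →L[ℝ] V) := FiniteDimensional.proper ℝ _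
  refine isCompact_iff_compactSpace.1 ((isCompact_closedBall (0 : V →L[ℝ] V) 1).of_isClosed_subset
    isClosed_unitary fun g hg => ?_)
  rw [mem_closedBall_zero_iff]
  refine ContinuousLinearMap.opNorm_le_bound _ zero_le_one fun x => ?_
  rw [one_mul]
  exact ((Unitary.linearIsometryEquiv ⟨g, hg⟩).norm_map x).le

/-- Rotation invariant finite measures on a sphere are proportional. -/
lemma measure_mul_measure_univ_comm {μ ν : Measure V} [IsFiniteMeasure μ] [IsFiniteMeasure ν]
    (hμ : ∀ ρ : V ≃ₗᵢ[ℝ] V, μ.map ρ = μ) (hν : ∀ ρ : V ≃ₗᵢ[ℝ] V, ν.map ρ = ν)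
    (hμs : ∀ᵐ x ∂μ, ‖x‖ = 1) (hνs : ∀ᵐ x ∂ν, ‖x‖ = 1) {A : Set V} (hA : MeasurableSet A) :
    μ A * ν univ = ν A * μ univ := by
  have : CompleteSpace V := FiniteDimensional.complete ℝ V
  let G := unitary (V →L[ℝ] V)
  let _ : MeasurableSpace G := borel G
  have : BorelSpace G := ⟨rfl⟩
  let l : Measure G := Measure.haar
  have hcont : Continuous fun p : G × V => ((p.1⁻¹ : G) : V →L[ℝ] V) p.2 :=
    (continuous_subtype_val.comp continuous_fst.inv).clm_apply continuous_snd
  rcases eq_or_ne μ 0 with rfl | hμ0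
  · simp
  have : NeZero μ := ⟨hμ0⟩
  obtain ⟨x₀, hx₀⟩ := hμs.exists
  have key : ∀ ξ : Measure V, IsFiniteMeasure ξ → (∀ ρ : V ≃ₗᵢ[ℝ] V, ξ.map ρ = ξ) →
      (∀ᵐ x ∂ξ, ‖x‖ = 1) → l univ * ξ A = l {g | ((g⁻¹ : G) : V →L[ℝ] V) x₀ ∈ A} * ξ univ := by
    intro ξ hfin hinv hs
    have hM := hcont.measurable hA
    have h1 := Measure.prod_apply (μ := l) (ν := ξ) hM
    have h2 := Measure.prod_apply_symm (μ := l) (ν := ξ) hM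
    rw [h1] at h2
    have h3 : ∀ g : G, ξ (Prod.mk g ⁻¹' ((fun p : G × V => ((p.1⁻¹ : G) : V →L[ℝ] V) p.2) ⁻¹' A))
        = ξ A := by
      intro g
      conv_rhs => rw [← hinv (Unitary.linearIsometryEquiv g⁻¹),
        Measure.map_apply (LinearIsometryEquiv.continuous _).measurable hA]
      rfl
    have h4 : ∀ᵐ x ∂ξ, l ((fun g => (g, x)) ⁻¹'
        ((fun p : G × V => ((p.1⁻¹ : G) : V →L[ℝ] V) p.2) ⁻¹' A)) =
        l {g | ((g⁻¹ : G) : V →L[ℝ] V) x₀ ∈ A} := by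
      filter_upwards [hs] with x hx
      obtain ⟨ρ, hρ⟩ := exists_linearIsometryEquiv_apply_eq_s15 (hx₀.trans hx.symm)
      let k : G := Unitary.linearIsometryEquiv.symm ρ
      have hk : (k : V →L[ℝ] V) x₀ = x := hρ
      conv_rhs => rw [← measure_preimage_mul l k⁻¹]
      congr 1
      ext g
      have h5 : ((k⁻¹ * g)⁻¹ : G) = g⁻¹ * k := by group
      simp only [mem_preimage, mem_ofPred_eq, h5, ← hk]
      rfl
    simp_rw [h3] at h2
    rw [lintegral_congr_ae h4, lintegral_const, lintegral_const, mul_comm] at h2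
    exact h2
  have hl0 : l univ ≠ 0 := (isOpen_univ.measure_pos l univ_nonempty).ne'
  have h1 := key μ inferInstance hμ hμs
  have h2 := key ν inferInstance hν hνs
  have h3 : l univ * (μ A * ν univ) = l univ * (ν A * μ univ) := by
    rw [← mul_assoc, h1, ← mul_assoc, h2]; ring
  exact (ENNReal.mul_right_inj hl0 (measure_ne_top _ _)).1 h3

end InvariantMeasure

section HausdorffSphere
variable [FiniteDimensional ℝ V] [MeasurableSpace V] [BorelSpace V]

lemma isAddHaarMeasure_hausdorffMeasure_of_finrank_eq {d : ℕ} (h : Module.finrank ℝ V = d) :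
    (μH[(d : ℝ)] : Measure V).IsAddHaarMeasure := by
  subst h
  infer_instance

lemma finrank_orthogonal_span_singleton_of_norm_eq_one {d : ℕ} (h : Module.finrank ℝ V = d + 1)
    {u : V} (hu : ‖u‖ = 1) : Module.finrank ℝ (ℝ ∙ u)ᗮ = d := by
  have : Fact (Module.finrank ℝ V = d + 1) := ⟨h⟩
  exact Submodule.finrank_orthogonal_span_singleton (norm_ne_zero_iff.1 (by rw [hu]; exact one_ne_zero))

lemma dist_normalize_le {a b : V} (ha : 1 ≤ ‖a‖) (hb : 1 ≤ ‖b‖) :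
    dist (‖a‖⁻¹ • a) (‖b‖⁻¹ • b) ≤ 2 * dist a b := by
  have ha0 : 0 < ‖a‖ := by linarith
  have hb0 : 0 < ‖b‖ := by linarith
  have h1 : ‖a‖⁻¹ • a - ‖b‖⁻¹ • b = ‖a‖⁻¹ • (a - b) + (‖a‖⁻¹ - ‖b‖⁻¹) • b := by
    module
  have h2 : ‖(‖a‖⁻¹ - ‖b‖⁻¹) • b‖ = ‖a‖⁻¹ * |‖b‖ - ‖a‖| := by
    rw [norm_smul, Real.norm_eq_abs, inv_sub_inv ha0.ne' hb0.ne', abs_div, abs_mul, abs_norm, abs_norm]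
    field_simp
  have h3 : |‖b‖ - ‖a‖| ≤ ‖a - b‖ := by
    rw [abs_sub_comm]; exact abs_norm_sub_norm_le a b
  have h4 : ‖a‖⁻¹ ≤ 1 := inv_le_one_of_one_le₀ ha
  rw [dist_eq_norm, dist_eq_norm, h1]
  refine (norm_add_le _ _).trans ?_
  rw [h2, norm_smul, norm_inv, norm_norm, two_mul]
  refine add_le_add (mul_le_of_le_one_left (norm_nonneg _) h4) ?_
  exact (mul_le_of_le_one_left (abs_nonneg _) h4).trans h3

lemma hausdorffMeasure_sphere_ne_top {d : ℕ} (h : Module.finrank ℝ V = d + 1) :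
    μH[(d : ℝ)] (sphere (0 : V) 1) ≠ ∞ := by
  refine (IsCompact.measure_lt_top_of_nhdsWithin (isCompact_sphere (0 : V) 1) fun θ hθ => ?_).ne
  have hu : ‖θ‖ = 1 := mem_sphere_zero_iff_norm.1 hθ
  have hH := isAddHaarMeasure_hausdorffMeasure_of_finrank_eq
    (finrank_orthogonal_span_singleton_of_norm_eq_one h hu)
  let N : (ℝ ∙ θ)ᗮ → V := fun y => ‖θ + (y : V)‖⁻¹ • (θ + (y : V))
  have hnorm : ∀ y : (ℝ ∙ θ)ᗮ, 1 ≤ ‖θ + (y : V)‖ := fun y => by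
    have h1 := norm_add_sq_eq_norm_sq_add_norm_sq_real
      (Submodule.mem_orthogonal_singleton_iff_inner_right.1 y.2)
    rw [hu] at h1
    nlinarith [norm_nonneg (θ + (y : V)), norm_nonneg (y : V)]
  have hN : LipschitzWith 2 N := LipschitzWith.of_dist_le_mul fun y z => by
    refine (dist_normalize_le (hnorm y) (hnorm z)).trans ?_
    rw [dist_add_left]
    rfl
  refine ⟨N '' closedBall 0 3, ?_, ?_⟩
  · have hopen : {x : V | 1 / 2 < ⟪θ, x⟫} ∈ 𝓝 θ := by
      refine (isOpen_lt continuous_const (by fun_prop)).mem_nhds ?_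
      simp only [mem_ofPred_eq, real_inner_self_eq_norm_sq, hu]
      norm_num
    filter_upwards [mem_nhdsWithin_of_mem_nhds hopen, self_mem_nhdsWithin] with x hx hxs
    have hxn : ‖x‖ = 1 := mem_sphere_zero_iff_norm.1 hxs
    have hpos : 0 < ⟪θ, x⟫ := by linarith
    have hinv : ⟪θ, x⟫⁻¹ ≤ 2 := by
      rw [inv_le_comm₀ hpos two_pos]; linarith
    refine ⟨⟨⟪θ, x⟫⁻¹ • x - θ, ?_⟩, ?_, ?_⟩
    · rw [Submodule.mem_orthogonal_singleton_iff_inner_right, inner_sub_right, inner_smul_right,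
        real_inner_self_eq_norm_sq, hu, inv_mul_cancel₀ hpos.ne']
      norm_num
    · rw [mem_closedBall_zero_iff, Submodule.coe_norm]
      refine (norm_sub_le _ _).trans ?_
      rw [norm_smul, hxn, hu, Real.norm_eq_abs, abs_of_pos (inv_pos.2 hpos)]
      linarith
    · simp only [N]
      rw [add_sub_cancel, norm_smul, hxn, mul_one, norm_inv, inv_inv, smul_smul, Real.norm_eq_abs,
        abs_of_pos hpos, mul_inv_cancel₀ hpos.ne', one_smul]
  · refine (hN.hausdorffMeasure_image_le (Nat.cast_nonneg d) _).trans_lt ?_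
    exact ENNReal.mul_lt_top (by simp) (isCompact_closedBall _ _).measure_lt_top

lemma hausdorffMeasure_sphere_ne_zero_s15 {d : ℕ} (h : Module.finrank ℝ V = d + 1) :
    μH[(d : ℝ)] (sphere (0 : V) 1) ≠ 0 := by
  have : Nontrivial V := Module.nontrivial_of_finrank_pos (R := ℝ) (by omega)
  obtain ⟨θ, hu⟩ := exists_norm_eq V zero_le_one
  have hH := isAddHaarMeasure_hausdorffMeasure_of_finrank_eq
    (finrank_orthogonal_span_singleton_of_norm_eq_one h hu)
  intro h0
  have h1 := (ℝ ∙ θ)ᗮ.lipschitzWith_orthogonalProjectionOnto.hausdorffMeasure_image_le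
    (Nat.cast_nonneg d) (sphere (0 : V) 1)
  rw [h0, mul_zero] at h1
  have h2 : closedBall (0 : (ℝ ∙ θ)ᗮ) 1 ⊆ (ℝ ∙ θ)ᗮ.orthogonalProjectionOnto '' sphere (0 : V) 1 := by
    intro y hy
    rw [mem_closedBall_zero_iff, Submodule.coe_norm] at hy
    have hyo := Submodule.mem_orthogonal_singleton_iff_inner_right.1 y.2
    refine ⟨(y : V) + √(1 - ‖(y : V)‖ ^ 2) • θ, ?_, ?_⟩
    · have h3 : ⟪(y : V), √(1 - ‖(y : V)‖ ^ 2) • θ⟫ = 0 := by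
        rw [inner_smul_right, real_inner_comm, hyo, mul_zero]
      have h4 := norm_add_sq_eq_norm_sq_add_norm_sq_real h3
      rw [norm_smul, hu, mul_one, Real.norm_eq_abs, abs_of_nonneg (Real.sqrt_nonneg _),
        Real.mul_self_sqrt (by nlinarith [norm_nonneg (y : V)])] at h4
      rw [mem_sphere_zero_iff_norm]
      nlinarith [norm_nonneg ((y : V) + √(1 - ‖(y : V)‖ ^ 2) • θ)]
    · rw [map_add, map_smul, Submodule.orthogonalProjectionOnto_mem_subspace_eq_self]
      simp
  have h3 := Metric.measure_closedBall_pos (μH[(d : ℝ)] : Measure (ℝ ∙ θ)ᗮ) 0 one_pos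
  exact absurd ((measure_mono h2).trans h1) (not_le.2 h3)

/-- The rotation invariant measure on the unit sphere coming from polar coordinates, as a measure on
the ambient space. -/
def sphereMeasure (V : Type*) [NormedAddCommGroup V] [InnerProductSpace ℝ V]
    [FiniteDimensional ℝ V] [MeasurableSpace V] [BorelSpace V] : Measure V :=
  (volume : Measure V).toSphere.map (↑)

lemma sphereMeasure_apply {A : Set V} (hA : MeasurableSet A) :
    sphereMeasure V A = (volume : Measure V).toSphere ((↑) ⁻¹' A) :=
  Measure.map_apply measurable_subtype_coe hA

instance : IsFiniteMeasure (sphereMeasure V) := by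
  unfold sphereMeasure; infer_instance

lemma ae_sphereMeasure_norm_eq_one : ∀ᵐ x ∂sphereMeasure V, ‖x‖ = 1 := by
  rw [sphereMeasure, ae_map_iff measurable_subtype_coe.aemeasurable
    (measurableSet_eq_fun measurable_norm measurable_const)]
  exact Eventually.of_forall fun x => mem_sphere_zero_iff_norm.1 x.2

lemma map_sphereMeasure (ρ : V ≃ₗᵢ[ℝ] V) : (sphereMeasure V).map ρ = sphereMeasure V := by
  ext A hA
  have hρ := ρ.continuous.measurable
  rw [Measure.map_apply hρ hA, sphereMeasure_apply (hρ hA), sphereMeasure_apply hA,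
    Measure.toSphere_apply' _ (measurable_subtype_coe (hρ hA)),
    Measure.toSphere_apply' _ (measurable_subtype_coe hA)]
  congr 1
  conv_rhs => rw [← ρ.measurePreserving.measure_preimage_emb ρ.toHomeomorph.measurableEmbedding]
  congr 1
  ext x
  simp only [mem_preimage, Set.mem_smul, mem_image, Subtype.exists, mem_sphere_zero_iff_norm,
    exists_and_left, exists_prop]
  constructor
  · rintro ⟨r, hr, y, ⟨z, hz, hzn, rfl⟩, rfl⟩
    exact ⟨r, hr, ρ z, ⟨ρ z, hz, by simpa using hzn, rfl⟩, by simp⟩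
  · rintro ⟨r, hr, y, ⟨z, hz, hzn, rfl⟩, h⟩
    refine ⟨r, hr, ρ.symm z, ⟨ρ.symm z, by simpa using hz, by simpa using hzn, rfl⟩, ?_⟩
    rw [← map_smul, h, ρ.symm_apply_apply]

lemma hausdorffMeasure_inter_sphere_mul {d : ℕ} (h : Module.finrank ℝ V = d + 1) {A : Set V}
    (hA : MeasurableSet A) :
    μH[(d : ℝ)] (A ∩ sphere (0 : V) 1) * sphereMeasure V univ =
      sphereMeasure V A * μH[(d : ℝ)] (sphere (0 : V) 1) := by
  have hfin : IsFiniteMeasure ((μH[(d : ℝ)] : Measure V).restrict (sphere 0 1)) :=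
    ⟨by rw [Measure.restrict_apply_univ]; exact (hausdorffMeasure_sphere_ne_top h).lt_top⟩
  have := measure_mul_measure_univ_comm (μ := (μH[(d : ℝ)] : Measure V).restrict (sphere 0 1))
    (ν := sphereMeasure V) (fun ρ => ?_) map_sphereMeasure ?_ ae_sphereMeasure_norm_eq_one hA
  · rwa [Measure.restrict_apply hA, Measure.restrict_apply_univ] at this
  · have h1 := (ρ.toIsometryEquiv.measurePreserving_hausdorffMeasure (d : ℝ)).restrict_preimage
      (s := sphere (0 : V) 1) isClosed_sphere.measurableSet
    have h2 : ρ.toIsometryEquiv ⁻¹' sphere (0 : V) 1 = sphere 0 1 := by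
      ext x; simp
    rw [h2] at h1
    exact h1.map_eq
  · filter_upwards [ae_restrict_mem isClosed_sphere.measurableSet] with x hx
    exact mem_sphere_zero_iff_norm.1 hx

end HausdorffSphere

section Comparison
variable [FiniteDimensional ℝ V] [MeasurableSpace V] [BorelSpace V]

lemma volume_eq_lintegral_sphereMeasure [Nontrivial V] {A : Set V} (hA : MeasurableSet A) :
    volume A = ∫⁻ r : Ioi (0 : ℝ), sphereMeasure V {θ | (r : ℝ) • θ ∈ A}
      ∂Measure.volumeIoiPow (Module.finrank ℝ V - 1) := by
  have hmp := ((volume : Measure V).measurePreserving_homeomorphUnitSphereProd).symm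
    (homeomorphUnitSphereProd V).toMeasurableEquiv
  have hA' : MeasurableSet ((↑) ⁻¹' A : Set ({0}ᶜ : Set V)) := measurable_subtype_coe hA
  have h1 := hmp.measure_preimage hA'.nullMeasurableSet
  rw [comap_subtype_coe_apply (measurableSet_singleton (0 : V)).compl,
    Subtype.image_preimage_coe, inter_comm, ← sdiff_eq,
    measure_sdiff_null (measure_singleton (0 : V)),
    Measure.prod_apply_symm (hmp.measurable hA')] at h1
  rw [← h1]
  refine lintegral_congr fun r => ?_
  exact (sphereMeasure_apply ((continuous_const_smul (r : ℝ)).measurable hA)).symm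

lemma volume_le_of_forall_sphereMeasure_le [Nontrivial V] {A B : Set V} (hA : MeasurableSet A)
    (hB : MeasurableSet B)
    (h : ∀ r : ℝ, 0 < r → sphereMeasure V {θ | r • θ ∈ A} ≤ sphereMeasure V {θ | r • θ ∈ B}) :
    volume A ≤ volume B := by
  rw [volume_eq_lintegral_sphereMeasure hA, volume_eq_lintegral_sphereMeasure hB]
  exact lintegral_mono fun r => h r r.2

lemma measure_setOf_le_le_of_forall_le {α : Type*} [MeasurableSpace α] {μ : Measure α}
    [IsFiniteMeasure μ] {f g : α → ℝ≥0∞} (hf : Measurable f) (hg : Measurable g)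
    (h : ∀ s : ℝ≥0, μ {x | s ≤ f x} ≤ μ {x | s ≤ g x}) (s : ℝ≥0) :
    μ {x | g x ≤ s} ≤ μ {x | f x ≤ s} := by
  have hunion : ∀ f : α → ℝ≥0∞, {x | f x ≤ s}ᶜ =
      ⋃ k : ℕ, {x | ((s + 1 / (k + 1) : ℝ≥0) : ℝ≥0∞) ≤ f x} := by
    intro f
    ext x
    simp only [mem_compl_iff, mem_ofPred_eq, not_le, mem_iUnion]
    constructor
    · intro hx
      obtain ⟨q, hq, hqx⟩ := ENNReal.lt_iff_exists_nnreal_btwn.1 hx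
      rw [ENNReal.coe_lt_coe] at hq
      obtain ⟨k, hk⟩ := exists_nat_one_div_lt (tsub_pos_of_lt hq)
      refine ⟨k, le_trans (ENNReal.coe_le_coe.2 ?_) hqx.le⟩
      rw [← add_tsub_cancel_of_le hq.le]
      gcongr
    · rintro ⟨k, hk⟩
      refine lt_of_lt_of_le (ENNReal.coe_lt_coe.2 ?_) hk
      exact lt_add_of_pos_right _ (by positivity)
  have hmono : ∀ f : α → ℝ≥0∞, Monotone fun k : ℕ =>
      {x | ((s + 1 / (k + 1) : ℝ≥0) : ℝ≥0∞) ≤ f x} := by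
    intro f k l hkl x hx
    refine le_trans (ENNReal.coe_le_coe.2 ?_) hx
    gcongr
  have hcompl : μ {x | f x ≤ s}ᶜ ≤ μ {x | g x ≤ s}ᶜ := by
    rw [hunion, hunion, (hmono f).measure_iUnion, (hmono g).measure_iUnion]
    exact iSup_mono fun k => h _
  rw [measure_compl (measurableSet_le hf measurable_const) (measure_ne_top _ _),
    measure_compl (measurableSet_le hg measurable_const) (measure_ne_top _ _)] at hcompl
  exact (ENNReal.sub_le_sub_iff_left (measure_mono (subset_univ _)) (measure_ne_top _ _)).1 hcompl

/-- On unit vectors, the volume of the shadow of a convex body `K`. -/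
def shadowVolume (K : Set V) (v : V) : ℝ≥0∞ := volume (K + segment ℝ 0 v) - volume K

lemma measurable_shadowVolume {K : Set V} (hK : IsCompact K) (hKc : Convex ℝ K) :
    Measurable (shadowVolume K) := by
  have hcont : Continuous fun v : V => volume (K + segment ℝ 0 v) :=
    SeqContinuous.continuous fun v w hw =>
      ((HausdorffTendsto.refl K).add (hausdorffTendsto_segment hw)).tendsto_volume
        (fun i => hKc.add (convex_segment _ _)) (fun i => hK.add (isCompact_segment _ _))
        (hK.add (isCompact_segment _ _))
  exact hcont.measurable.sub_const _

lemma shadowVolume_eq {K : Set V} (hK : IsCompact K) (hKc : Convex ℝ K) {u : V} (hu : ‖u‖ = 1) :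
    shadowVolume K u = volume (shadow K u) := by
  have := volume_add_segment hu hK hKc zero_le_one
  rw [one_smul, ENNReal.ofReal_one, one_mul] at this
  rw [shadowVolume, this, ENNReal.add_sub_cancel_left hK.measure_ne_top]

lemma shadowVolume_eq_mul_hausdorffMeasure {d : ℕ} (h : Module.finrank ℝ V = d + 1) {K : Set V}
    (hK : IsCompact K) (hKc : Convex ℝ K) {u : V} (hu : ‖u‖ = 1) :
    shadowVolume K u =
      (volume : Measure (EuclideanSpace ℝ (Fin d))).addHaarScalarFactor μH[(d : ℝ)] *
        μH[(d : ℝ)] ((fun x => x - ⟪x, u⟫ • u) '' K) := by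
  have himage : (fun x => x - ⟪x, u⟫ • u) '' K = (↑) '' shadow K u := by
    rw [shadow, image_image]
    refine image_congr fun x _ => ?_
    change _ = (ℝ ∙ u)ᗮ.starProjection x
    rw [Submodule.starProjection_orthogonal_val,
      Submodule.starProjection_unit_singleton ℝ hu, real_inner_comm]
  rw [shadowVolume_eq hK hKc hu, himage,
    isometry_subtype_coe.hausdorffMeasure_image (Or.inl (Nat.cast_nonneg d)),
    ← InnerProductSpace.euclideanHausdorffMeasure_eq_volume,
    finrank_orthogonal_span_singleton_of_norm_eq_one h hu, Measure.euclideanHausdorffMeasure_def]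
  rfl

lemma volume_polarProj_le_of_shadowVolume_le [Nontrivial V] {K L : Set V} (hK : IsCompact K)
    (hKc : Convex ℝ K) (hL : IsCompact L) (hLc : Convex ℝ L)
    (h : ∀ s : ℝ≥0, sphereMeasure V {θ | s ≤ shadowVolume K θ} ≤
      sphereMeasure V {θ | s ≤ shadowVolume L θ}) :
    volume (polarProj L) ≤ volume (polarProj K) := by
  refine volume_le_of_forall_sphereMeasure_le (polarProj_isClosed hL hLc).measurableSet
    (polarProj_isClosed hK hKc).measurableSet fun r hr => ?_
  have key : ∀ {M : Set V}, IsCompact M → Convex ℝ M → sphereMeasure V {θ | r • θ ∈ polarProj M} =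
      sphereMeasure V {θ | shadowVolume M θ ≤ ((r⁻¹).toNNReal : ℝ≥0)} := fun {M} hM hMc => by
    refine measure_congr ?_
    filter_upwards [ae_sphereMeasure_norm_eq_one] with θ hθ
    refine propext ((mem_polarProj_smul_iff hM hMc hθ hr.le).trans ?_)
    change _ ↔ shadowVolume M θ ≤ _
    rw [shadowVolume_eq hM hMc hθ, ← ENNReal.ofReal, ENNReal.ofReal_inv_of_pos hr,
      ENNReal.le_inv_iff_mul_le, mul_comm]
  rw [key hK hKc, key hL hLc]
  exact measure_setOf_le_le_of_forall_le (measurable_shadowVolume hK hKc)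
    (measurable_shadowVolume hL hLc) h _

end Comparison

lemma PiDist_eq_shadowVolume {d : ℕ} {K : Set (Euc (d + 1))} (hK : IsCompact K) (hKc : Convex ℝ K)
    (t : ℝ) : PiDist (d + 1) K t * sphereMeasure (Euc (d + 1)) univ =
      sphereMeasure (Euc (d + 1)) {θ | (volume : Measure (EuclideanSpace ℝ (Fin d))).addHaarScalarFactor
        μH[(d : ℝ)] * ENNReal.ofReal t ≤ shadowVolume K θ} := by
  have hfin : Module.finrank ℝ (Euc (d + 1)) = d + 1 := finrank_euclideanSpace_fin
  have ha := Measure.addHaarScalarFactor_volume_hausdorffMeasure_ne_zero d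
  set a := (volume : Measure (EuclideanSpace ℝ (Fin d))).addHaarScalarFactor μH[(d : ℝ)] with ha_def
  have hset : {θ | ENNReal.ofReal t ≤ projVol (d + 1) K θ} ∩ sphere 0 1 =
      {θ | a * ENNReal.ofReal t ≤ shadowVolume K θ} ∩ sphere 0 1 := by
    ext θ
    simp only [mem_inter_iff, mem_ofPred_eq, mem_sphere_zero_iff_norm]
    refine and_congr_left fun hθ => ?_
    rw [shadowVolume_eq_mul_hausdorffMeasure hfin hK hKc hθ, ← ha_def,
      ENNReal.mul_le_mul_iff_right (ENNReal.coe_ne_zero.2 ha) ENNReal.coe_ne_top, projVol,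
      Nat.cast_add_one, add_sub_cancel_right]
  rw [PiDist, sphHaar, hset, Nat.cast_add_one, add_sub_cancel_right, ENNReal.mul_div_right_comm.symm,
    hausdorffMeasure_inter_sphere_mul hfin
      (measurableSet_le measurable_const (measurable_shadowVolume hK hKc)),
    ENNReal.mul_div_cancel_right (hausdorffMeasure_sphere_ne_zero_s15 hfin)
      (hausdorffMeasure_sphere_ne_top hfin)]

end Petty

/-- If a convex body `K` and a centered ellipsoid `E = T(B₂ⁿ)` satisfy
`Π_K(t) ≤ Π_E(t)` for all `t ≥ 0`, then `|K| ≤ |E|`. -/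
theorem stmt_15 (n : ℕ) (hn : 2 ≤ n) (K : Set (Euc n)) (hK : IsConvexBody K)
    (T : Euc n ≃ₗ[ℝ] Euc n) (E : Set (Euc n))
    (hE : E = (T : Euc n → Euc n) '' closedBall (0 : Euc n) 1)
    (h : ∀ t : ℝ, 0 ≤ t → PiDist n K t ≤ PiDist n E t) :
    volume K ≤ volume E := by
  obtain ⟨hKc, hKk, -⟩ := hK
  have hEk : IsCompact E := hE ▸ isCompact_image_linearEquiv T (isCompact_closedBall _ _)
  have hEc : Convex ℝ E := hE ▸ (convex_closedBall _ _).linear_image (T : Euc n →ₗ[ℝ] Euc n)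
  have hfin : Module.finrank ℝ (Euc n) = n := finrank_euclideanSpace_fin
  have : Nontrivial (Euc n) := Module.nontrivial_of_finrank_pos (R := ℝ) (by omega)
  suffices volume (polarProj E) ≤ volume (polarProj K) by
    subst hE
    exact volume_le_of_volume_polarProj_le (hfin.symm ▸ hn) hKk hKc T this
  refine volume_polarProj_le_of_shadowVolume_le hKk hKc hEk hEc fun s => ?_
  obtain ⟨d, rfl⟩ : ∃ d, n = d + 1 := ⟨n - 1, by omega⟩
  have ha := Measure.addHaarScalarFactor_volume_hausdorffMeasure_ne_zero d
  set a := (volume : Measure (EuclideanSpace ℝ (Fin d))).addHaarScalarFactor μH[(d : ℝ)]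
  have hs : (s : ℝ≥0∞) = a * ENNReal.ofReal (s / a : ℝ≥0) := by
    rw [ENNReal.ofReal_coe_nnreal, ← ENNReal.coe_mul, mul_div_cancel₀ _ ha]
  rw [hs, ← PiDist_eq_shadowVolume hKk hKc, ← PiDist_eq_shadowVolume hEk hEc]
  exact mul_le_mul' (h _ (NNReal.coe_nonneg _)) le_rfl
end
end
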